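/- arXiv:1007.3385 — 8 statements merged into one kernel-verified Lean document; each statement's English description precedes it below -/
import Mathlib

section
/- Let A_n denote the largest of the three interior angles of T(n). Then the triangles become strongly flat in probability: for every ε > 0, lim_{n→∞} P[A_n < π − ε] = 0. -/
open MeasureTheory ProbabilityTheory Filter Set

noncomputable section

/-- A triangle: an ordered triple of points in the plane (identified with `ℂ`). -/
abbrev Tri : Type := ℂ × ℂ × ℂ

namespace Tri

def A (T : Tri) : ℂ := T.1
def B (T : Tri) : ℂ := T.2.1
def C (T : Tri) : ℂ := T.2.2

/-- The vertices are not all equal. -/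
def Nondeg (T : Tri) : Prop := ¬ (T.A = T.B ∧ T.B = T.C)

/-- The vertices are not collinear. -/
def Nonflat (T : Tri) : Prop := ((T.B - T.A) * (starRingEnd ℂ (T.C - T.A))).im ≠ 0

end Tri

/-- The area of a triangle. -/
def triArea (T : Tri) : ℝ := |((T.B - T.A) * (starRingEnd ℂ (T.C - T.A))).im| / 2

/-- The six triangles of the barycentric subdivision. -/
def subdiv (T : Tri) : Fin 6 → Tri :=
  ![ (T.A, (T.A + T.B)/2, (T.A + T.B + T.C)/3),
     ((T.A + T.B)/2, T.B, (T.A + T.B + T.C)/3),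
     (T.B, (T.B + T.C)/2, (T.A + T.B + T.C)/3),
     ((T.B + T.C)/2, T.C, (T.A + T.B + T.C)/3),
     (T.C, (T.C + T.A)/2, (T.A + T.B + T.C)/3),
     ((T.C + T.A)/2, T.A, (T.A + T.B + T.C)/3) ]

/-- Edge lengths. -/
def e₁ (T : Tri) : ℝ := ‖T.A - T.B‖
def e₂ (T : Tri) : ℝ := ‖T.B - T.C‖
def e₃ (T : Tri) : ℝ := ‖T.C - T.A‖

/-- Largest edge length. -/
def Lmax (T : Tri) : ℝ := max (e₁ T) (max (e₂ T) (e₃ T))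
/-- Smallest edge length. -/
def Lmin (T : Tri) : ℝ := min (e₁ T) (min (e₂ T) (e₃ T))
/-- Middle edge length. -/
def Lmid (T : Tri) : ℝ := e₁ T + e₂ T + e₃ T - Lmax T - Lmin T

/-- Abscissa of the characterizing point. -/
def charX (T : Tri) : ℝ := ((Lmax T)^2 + (Lmin T)^2 - (Lmid T)^2) / (2 * (Lmax T)^2)
/-- Ordinate of the characterizing point. -/
def charY (T : Tri) : ℝ := 2 * triArea T / (Lmax T)^2

variable {Ω : Type*}

/-- The triangle Markov chain driven by the choices `ι`. -/
def triChain (ι : ℕ → Ω → Fin 6) (T0 : Tri) : ℕ → Ω → Tri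
  | 0 => fun _ => T0
  | n+1 => fun ω => subdiv (triChain ι T0 n ω) (ι (n+1) ω)

/-- `ι` is an i.i.d. sequence of uniform `{1,…,6}`-valued random variables. -/
def IsIIDUniform [MeasurableSpace Ω] (P : Measure Ω) (ι : ℕ → Ω → Fin 6) : Prop :=
  (∀ n, Measurable (ι n)) ∧
  iIndepFun ι P ∧
  (∀ n (i : Fin 6), P {ω | ι n ω = i} = 1/6)

/-- The six maps of the flat-triangle iterated function system. -/
def zfun : Fin 6 → ℝ → ℝ :=
  ![ fun x => 3*x/(2+2*x),
     fun x => if x < 2/7 then 3*x/(2-x) else (2-4*x)/(2-x),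
     fun x => if x < 1/5 then (1+x)/(3-3*x) else (2-4*x)/(3-3*x),
     fun x => (1+x)/(4-2*x),
     fun x => (1-2*x)/(4-2*x),
     fun x => (1-2*x)/3 ]

/-- The flat-triangle Markov chain driven by the choices `ι`. -/
def flatChain (ι : ℕ → Ω → Fin 6) (z0 : ℝ) : ℕ → Ω → ℝ
  | 0 => fun _ => z0
  | n+1 => fun ω => zfun (ι (n+1) ω) (flatChain ι z0 n ω)

/-- The function `G` of the paper. -/
def Gfun : Fin 6 → ℝ → ℝ :=
  ![ fun x => Real.sqrt (2/3) * (1+x),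
     fun x => Real.sqrt (1/6) * (2-x),
     fun x => Real.sqrt (3/2) * (1-x),
     fun x => Real.sqrt (2/3) * (2-x),
     fun x => Real.sqrt (2/3) * (2-x),
     fun _ => Real.sqrt (3/2) ]


/-- The (unsigned) angle at vertex `Q` between the rays towards `P` and `R`. -/
def angleAt (Q P R : ℂ) : ℝ :=
  Real.arccos (((P - Q) * (starRingEnd ℂ (R - Q))).re /
    (‖P - Q‖ * ‖R - Q‖))

/-- The largest interior angle of a triangle. -/
def maxAngle (T : Tri) : ℝ :=
  max (angleAt T.A T.B T.C) (max (angleAt T.B T.A T.C) (angleAt T.C T.A T.B))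


/-! ### The quadratic forms -/

def NN (a b : ℝ) : ℝ := a^2 + a*b + b^2
def UU (a b : ℝ) : ℝ := (4*a^2 + 2*a*b + b^2)/2

/-- The exponent. -/
def ss : ℝ := 1/120
/-- The contraction rate. -/
def cc : ℝ := 1 - 1/3600

lemma NN_pos {a b : ℝ} (h : a ≠ 0 ∨ b ≠ 0) : 0 < NN a b := by
  unfold NN
  rcases h with h | h
  · have := pow_pos (abs_pos.mpr h) 2
    rw [sq_abs] at this
    nlinarith [sq_nonneg (a + 2*b)]
  · have := pow_pos (abs_pos.mpr h) 2
    rw [sq_abs] at this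
    nlinarith [sq_nonneg (2*a + b)]

lemma UU_lower (a b : ℝ) : NN a b / 3 ≤ UU a b := by
  unfold NN UU
  nlinarith [sq_nonneg (a + b), sq_nonneg a, sq_nonneg b, sq_nonneg (5*a+b)]

lemma UU_upper (a b : ℝ) : UU a b ≤ 3 * NN a b := by
  unfold NN UU
  nlinarith [sq_nonneg (a + b), sq_nonneg a, sq_nonneg b]

lemma NN_cyc (a b : ℝ) : NN b (-a-b) = NN a b := by unfold NN; ring
lemma NN_cyc' (a b : ℝ) : NN (-a-b) a = NN a b := by unfold NN; ring
lemma NN_swap (a b : ℝ) : NN b a = NN a b := by unfold NN; ring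

lemma UU_prod (a b : ℝ) : 5/4 * NN a b ^ 3 ≤ UU a b * UU b (-a-b) * UU (-a-b) a := by
  unfold NN UU
  have h1 := sq_nonneg ((a-b)*(2*a+b)*(a+2*b) - 3*(a*b*(a+b)))
  have h2 := sq_nonneg (a*b*(a+b))
  nlinarith

lemma rpow_bound {u : ℝ} (h1 : 1/3 ≤ u) (h2 : u ≤ 3) :
    u ^ (-ss) ≤ 1 - ss * Real.log u + 4 * ss^2 := by
  have hu : 0 < u := by linarith
  have hl3 : Real.log 3 ≤ 2 := by
    have := Real.log_le_sub_one_of_pos (show (0:ℝ) < 3 by norm_num)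
    linarith
  have ha : Real.log u ≤ 2 := (Real.log_le_log hu h2).trans hl3
  have hb : -2 ≤ Real.log u := by
    have := Real.log_le_log (by norm_num) h1
    rw [one_div, Real.log_inv] at this
    linarith
  rw [Real.rpow_def_of_pos hu]
  have h3 : |Real.log u * -ss| ≤ 1 := by
    rw [abs_le]; unfold ss; constructor <;> linarith
  have := Real.abs_exp_sub_one_sub_id_le h3
  have h4 := (abs_le.mp this).2
  have h5 : (Real.log u)^2 ≤ 4 := by nlinarith
  have : (Real.log u * -ss)^2 ≤ 4 * ss^2 := by
    have := mul_le_mul_of_nonneg_right h5 (sq_nonneg ss)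
    calc _ = (Real.log u)^2 * ss^2 := by ring
      _ ≤ _ := this
  linarith

lemma three_bound {u v w : ℝ} (hu : 1/3 ≤ u) (hu' : u ≤ 3) (hv : 1/3 ≤ v) (hv' : v ≤ 3)
    (hw : 1/3 ≤ w) (hw' : w ≤ 3) (h : 5/4 ≤ u * v * w) :
    u ^ (-ss) + v ^ (-ss) + w ^ (-ss) ≤ 3 * cc := by
  have a1 := rpow_bound hu hu'
  have a2 := rpow_bound hv hv'
  have a3 := rpow_bound hw hw'
  have h1 : Real.log (5/4) ≤ Real.log (u * v * w) := Real.log_le_log (by norm_num) h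
  have hu0 : u ≠ 0 := by linarith
  have hv0 : v ≠ 0 := by linarith
  have hw0 : w ≠ 0 := by linarith
  rw [Real.log_mul (mul_ne_zero hu0 hv0) hw0, Real.log_mul hu0 hv0] at h1
  have h2 : 1/5 ≤ Real.log (5/4) := by
    have := Real.one_sub_inv_le_log_of_pos (show (0:ℝ) < 5/4 by norm_num)
    norm_num at this ⊢
    linarith
  unfold cc
  unfold ss at *
  linarith

lemma rot_bound {a b : ℝ} (h : a ≠ 0 ∨ b ≠ 0) :
    UU a b ^ (-ss) + UU b (-a-b) ^ (-ss) + UU (-a-b) a ^ (-ss) ≤ 3 * cc * NN a b ^ (-ss) := by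
  have hN := NN_pos h
  have key : ∀ x y : ℝ, NN x y = NN a b → 1/3 ≤ UU x y / NN a b ∧ UU x y / NN a b ≤ 3 ∧
      UU x y ^ (-ss) = (UU x y / NN a b) ^ (-ss) * NN a b ^ (-ss) := by
    intro x y hxy
    have h1 := UU_lower x y
    have h2 := UU_upper x y
    rw [hxy] at h1 h2
    have h3 : 1/3 ≤ UU x y / NN a b := by rw [le_div_iff₀ hN]; linarith
    refine ⟨h3, by rw [div_le_iff₀ hN]; linarith, ?_⟩
    rw [← Real.mul_rpow (by linarith) hN.le, div_mul_cancel₀ _ hN.ne']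
  obtain ⟨p1, p2, p3⟩ := key a b rfl
  obtain ⟨q1, q2, q3⟩ := key b (-a-b) (NN_cyc a b)
  obtain ⟨r1, r2, r3⟩ := key (-a-b) a (NN_cyc' a b)
  have hp : 5/4 ≤ UU a b / NN a b * (UU b (-a-b) / NN a b) * (UU (-a-b) a / NN a b) := by
    have := UU_prod a b
    rw [div_mul_div_comm, div_mul_div_comm, le_div_iff₀ (by positivity)]
    linarith
  have := three_bound p1 p2 q1 q2 r1 r2 hp
  rw [p3, q3, r3]
  calc _ = (_ + _ + _) * NN a b ^ (-ss) := by ring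
    _ ≤ _ := mul_le_mul_of_nonneg_right this (Real.rpow_nonneg hN.le _)

/-- The Lyapunov function. -/
def Phi (a b : ℝ) : ℝ := UU a b ^ (-ss) + UU b a ^ (-ss)

lemma UU_nonneg (a b : ℝ) : 0 ≤ UU a b := by
  unfold UU; nlinarith [sq_nonneg (a+b), sq_nonneg a]

lemma Phi_nonneg (a b : ℝ) : 0 ≤ Phi a b :=
  add_nonneg (Real.rpow_nonneg (UU_nonneg _ _) _) (Real.rpow_nonneg (UU_nonneg _ _) _)

lemma Phi_rot {a b : ℝ} (h : a ≠ 0 ∨ b ≠ 0) :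
    Phi a b + Phi b (-a-b) + Phi (-a-b) a ≤ 6 * cc * NN a b ^ (-ss) := by
  have h1 := rot_bound h
  have h2 := rot_bound h.symm
  rw [NN_swap, show -b-a = -a-b by ring] at h2
  unfold Phi
  linarith

/-- First coordinate of the basic linear map. -/
def x1 (a b : ℝ) : ℝ := 2*a/3 + b/6
def y1 (a b : ℝ) : ℝ := b/6 - a/3

lemma NN_x1 (a b : ℝ) : NN (x1 a b) (y1 a b) = UU a b / 6 := by
  unfold NN UU x1 y1; ring

lemma xy1_ne {a b : ℝ} (h : a ≠ 0 ∨ b ≠ 0) : x1 a b ≠ 0 ∨ y1 a b ≠ 0 := by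
  by_contra hc
  push Not at hc
  unfold x1 y1 at hc
  have ha : a = 0 := by linarith [hc.1, hc.2]
  have hb : b = 0 := by linarith [hc.1, hc.2]
  tauto

/-- The six linear maps. -/
def Lx (i : Fin 6) (a b : ℝ) : ℝ :=
  ![x1 a b, y1 b a, - x1 a b - y1 a b, - x1 b a - y1 b a, y1 a b, x1 b a] i
def Ly (i : Fin 6) (a b : ℝ) : ℝ :=
  ![y1 a b, x1 b a, x1 a b, y1 b a, - x1 a b - y1 a b, - x1 b a - y1 b a] i

/-- Edge functional. -/
def EE (T : Tri) (a b : ℝ) : ℂ := a * (T.A - T.C) + b * (T.B - T.C)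

lemma EE_subdiv (T : Tri) (i : Fin 6) (a b : ℝ) :
    EE (subdiv T i) a b = EE T (Lx i a b) (Ly i a b) := by
  fin_cases i <;> simp [EE, subdiv, Lx, Ly, x1, y1, Tri.A, Tri.B, Tri.C] <;> ring

lemma L_ne {a b : ℝ} (h : a ≠ 0 ∨ b ≠ 0) (i : Fin 6) : Lx i a b ≠ 0 ∨ Ly i a b ≠ 0 := by
  by_contra hc
  push Not at hc
  obtain ⟨h1, h2⟩ := hc
  have h3 := xy1_ne h
  have h4 := xy1_ne h.symm
  fin_cases i <;> simp [Lx, Ly] at h1 h2 <;> grind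

lemma Phi_swap (a b : ℝ) : Phi b a = Phi a b := by unfold Phi; ring

lemma Phi_step {a b : ℝ} (h : a ≠ 0 ∨ b ≠ 0) :
    ∑ i : Fin 6, Phi (Lx i a b) (Ly i a b) ≤ 6 * (cc * 6 ^ ss) * Phi a b := by
  have h1 := Phi_rot (xy1_ne h)
  have h2 := Phi_rot (xy1_ne h.symm)
  have e : ∀ u v : ℝ, (UU u v / 6) ^ (-ss) = 6 ^ ss * UU u v ^ (-ss) := by
    intro u v
    rw [Real.div_rpow (UU_nonneg _ _) (by norm_num), Real.rpow_neg (by norm_num : (0:ℝ) ≤ 6)]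
    field_simp
  rw [NN_x1, e] at h1 h2
  rw [Fin.sum_univ_six]
  simp only [Lx, Ly]
  simp only [Matrix.cons_val]
  rw [Phi_swap (x1 b a) (y1 b a), Phi_swap (y1 b a) (- x1 b a - y1 b a),
    Phi_swap (- x1 b a - y1 b a) (x1 b a)]
  rw [show Phi a b = UU a b ^ (-ss) + UU b a ^ (-ss) from rfl]
  linarith

/-! ### The area -/

def DD (T : Tri) : ℝ := ((T.B - T.A) * (starRingEnd ℂ (T.C - T.A))).im

lemma DD_eq (T : Tri) : DD T = (T.B - T.A).im * (T.C - T.A).re -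
    (T.B - T.A).re * (T.C - T.A).im := by
  rw [DD, Complex.mul_im, Complex.conj_re, Complex.conj_im]; ring

lemma DD_subdiv (T : Tri) (i : Fin 6) : DD (subdiv T i) = DD T / 6 := by
  rw [DD_eq, DD_eq]
  fin_cases i <;> simp [subdiv, Tri.A, Tri.B, Tri.C] <;> ring

lemma DD_chain {Ω : Type*} (ι : ℕ → Ω → Fin 6) (T0 : Tri) (n : ℕ) (ω : Ω) :
    DD (triChain ι T0 n ω) = DD T0 / 6^n := by
  induction n with
  | zero => simp [triChain]
  | succ n ih => rw [triChain, DD_subdiv, ih, pow_succ]; field_simp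

lemma EE_lower (T : Tri) (hT : DD T ≠ 0) :
    ∃ m : ℝ, 0 < m ∧ ∀ a b : ℝ, m * UU a b ≤ Complex.normSq (EE T a b) := by
  set x := T.A - T.C with hx
  set y := T.B - T.C with hy
  have hD : DD T = x.im * y.re - x.re * y.im := by
    rw [DD_eq]; simp [hx, hy]; ring
  have hne : 0 < Complex.normSq x + Complex.normSq y := by
    have h1 := Complex.normSq_nonneg x
    have h2 := Complex.normSq_nonneg y
    rcases h1.lt_or_eq with h | h
    · linarith
    · exfalso
      have : x = 0 := Complex.normSq_eq_zero.mp h.symm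
      rw [this] at hD
      simp at hD
      exact hT hD
  refine ⟨DD T ^2 / (3 * (Complex.normSq x + Complex.normSq y)), by positivity, ?_⟩
  intro a b
  rw [div_mul_eq_mul_div, div_le_iff₀ (by positivity)]
  have e1 : (a * DD T)^2 ≤ Complex.normSq (EE T a b) * Complex.normSq y := by
    have : a * DD T = -((EE T a b).re * y.im - (EE T a b).im * y.re) := by
      rw [hD]; simp [EE, ← hx, ← hy]; ring
    rw [this]; simp only [Complex.normSq_apply]
    nlinarith [sq_nonneg ((EE T a b).re * y.re + (EE T a b).im * y.im)]
  have e2 : (b * DD T)^2 ≤ Complex.normSq (EE T a b) * Complex.normSq x := by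
    have : b * DD T = (EE T a b).re * x.im - (EE T a b).im * x.re := by
      rw [hD]; simp [EE, ← hx, ← hy]; ring
    rw [this]; simp only [Complex.normSq_apply]
    nlinarith [sq_nonneg ((EE T a b).re * x.re + (EE T a b).im * x.im)]
  have e3 : UU a b ≤ 3 * (a^2+b^2) := by
    unfold UU; nlinarith [sq_nonneg (a-b), sq_nonneg a, sq_nonneg b]
  have := mul_le_mul_of_nonneg_left e3 (sq_nonneg (DD T))
  nlinarith

/-! ### Geometry of angles -/

lemma angle_lemma (Q P R : ℂ) (ε : ℝ) (h0 : 0 < ε) (h1 : ε ≤ 1)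
    (hP : P ≠ Q) (hR : R ≠ Q) (h : angleAt Q P R < Real.pi - ε)
    (hL' : Complex.normSq (P - Q) ≤ Complex.normSq (P - R) ∧
      Complex.normSq (R - Q) ≤ Complex.normSq (P - R)) :
    Complex.normSq (P - Q) * Complex.normSq (R - Q) * (1 - Real.cos ε ^ 2) ≤
      (((P - Q) * (starRingEnd ℂ (R - Q))).im) ^ 2 := by
  have hcos : 1/2 ≤ Real.cos ε := by
    have := Real.one_sub_sq_div_two_le_cos (x := ε)
    nlinarith
  set p := ‖P - Q‖ with hp
  set r := ‖R - Q‖ with hr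
  have hp0 : 0 < p := norm_pos_iff.mpr (sub_ne_zero.mpr hP)
  have hr0 : 0 < r := norm_pos_iff.mpr (sub_ne_zero.mpr hR)
  set z := (P - Q) * (starRingEnd ℂ (R - Q)) with hz
  have hz2 : z.re^2 + z.im^2 = p^2 * r^2 := by
    have : Complex.normSq z = p^2 * r^2 := by
      rw [hz, map_mul, Complex.normSq_conj, Complex.normSq_eq_norm_sq, Complex.normSq_eq_norm_sq]
    rw [← this, Complex.normSq_apply]; ring
  have ht : - Real.cos ε < z.re / (p * r) := by
    by_contra hc
    push Not at hc
    rw [← Real.cos_pi_sub] at hc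
    have := Real.arccos_le_arccos hc
    rw [Real.arccos_cos (by linarith [Real.pi_gt_three]) (by linarith)] at this
    unfold angleAt at h
    linarith
  rw [lt_div_iff₀ (by positivity)] at ht
  have hpr : Complex.normSq (P - R) = p^2 + r^2 - 2 * z.re := by
    rw [show P - R = (P - Q) - (R - Q) by ring, Complex.normSq_sub, Complex.normSq_eq_norm_sq,
      Complex.normSq_eq_norm_sq]
  rw [hpr, Complex.normSq_eq_norm_sq, Complex.normSq_eq_norm_sq, ← hp, ← hr] at hL'
  rw [Complex.normSq_eq_norm_sq, Complex.normSq_eq_norm_sq, ← hp, ← hr]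
  have hre : z.re ≤ p * r / 2 := by
    rcases le_total p r with hle | hle <;> nlinarith
  have hre2 : z.re ≤ Real.cos ε * (p * r) := by nlinarith [mul_pos hp0 hr0]
  have : z.re^2 ≤ (Real.cos ε * (p * r))^2 := sq_le_sq' (by linarith) hre2
  nlinarith

lemma min_of_mul {a b k D : ℝ} (ha : 0 ≤ a) (hb : 0 ≤ b) (hk : 0 < k)
    (h : a * b * k ≤ D^2) : a ≤ |D| / √k ∨ b ≤ |D| / √k := by
  by_contra hc
  push Not at hc
  have h0 : 0 ≤ |D| / √k := by positivity
  have : (|D| / √k)^2 < a * b := by nlinarith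
  rw [div_pow, sq_abs, Real.sq_sqrt hk.le, div_lt_iff₀ hk] at this
  linarith

lemma tri_event (T : Tri) (hT : DD T ≠ 0) (ε : ℝ) (h0 : 0 < ε) (h1 : ε ≤ 1)
    (h : maxAngle T < Real.pi - ε) :
    Complex.normSq (EE T 1 0) ≤ |DD T| / √(1 - Real.cos ε ^ 2) ∨
    Complex.normSq (EE T 0 1) ≤ |DD T| / √(1 - Real.cos ε ^ 2) ∨
    Complex.normSq (EE T 1 (-1)) ≤ |DD T| / √(1 - Real.cos ε ^ 2) := by
  have hk : 0 < 1 - Real.cos ε ^ 2 := by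
    have : 0 < Real.sin ε := Real.sin_pos_of_pos_of_lt_pi h0 (by linarith [Real.pi_gt_three])
    have := Real.sin_sq_add_cos_sq ε
    nlinarith
  obtain ⟨A, B, C⟩ := T
  simp only [maxAngle, max_lt_iff, Tri.A, Tri.B, Tri.C] at h
  obtain ⟨hA, hB, hC⟩ := h
  have hAB : A ≠ B := by rintro rfl; exact hT (by simp [DD, Tri.A, Tri.B])
  have hAC : A ≠ C := by rintro rfl; exact hT (by simp [DD, Tri.A, Tri.C])
  have hBC : B ≠ C := by
    rintro rfl; exact hT (by simp [DD, Tri.A, Tri.B, Tri.C]; ring)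
  have n1 : Complex.normSq (EE (A,B,C) 1 0) = Complex.normSq (A - C) := by
    simp [EE, Tri.A, Tri.B, Tri.C]
  have n2 : Complex.normSq (EE (A,B,C) 0 1) = Complex.normSq (B - C) := by
    simp [EE, Tri.A, Tri.B, Tri.C]
  have n3 : Complex.normSq (EE (A,B,C) 1 (-1)) = Complex.normSq (A - B) := by
    congr 1; simp [EE, Tri.A, Tri.B, Tri.C]
  rw [n1, n2, n3]
  have sw : ∀ z w : ℂ, Complex.normSq (z - w) = Complex.normSq (w - z) := by
    intro z w; rw [← Complex.normSq_neg, neg_sub]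
  have dA : (((B - A) * (starRingEnd ℂ (C - A))).im)^2 = DD (A,B,C)^2 := by
    simp [DD, Tri.A, Tri.B, Tri.C]
  have dB : (((A - B) * (starRingEnd ℂ (C - B))).im)^2 = DD (A,B,C)^2 := by
    simp [DD, Tri.A, Tri.B, Tri.C]; ring
  have dC : (((A - C) * (starRingEnd ℂ (B - C))).im)^2 = DD (A,B,C)^2 := by
    simp [DD, Tri.A, Tri.B, Tri.C]; ring
  have cA := fun hh => angle_lemma A B C ε h0 h1 hAB.symm hAC.symm hA hh
  have cB := fun hh => angle_lemma B A C ε h0 h1 hAB hBC.symm hB hh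
  have cC := fun hh => angle_lemma C A B ε h0 h1 hAC hBC hC hh
  rw [dA, sw B A, sw C A] at cA
  rw [dB, sw C B] at cB
  rw [dC] at cC
  have p1 := Complex.normSq_nonneg (A - B)
  have p2 := Complex.normSq_nonneg (A - C)
  have p3 := Complex.normSq_nonneg (B - C)
  generalize Complex.normSq (A - B) = u at *
  generalize Complex.normSq (A - C) = v at *
  generalize Complex.normSq (B - C) = w at *
  have hmax : (u ≤ w ∧ v ≤ w) ∨ (u ≤ v ∧ w ≤ v) ∨ (v ≤ u ∧ w ≤ u) := by
    rcases le_total u v with g1 | g1 <;> rcases le_total u w with g2 | g2 <;>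
      rcases le_total v w with g3 | g3 <;> grind
  rcases hmax with g | g | g
  · rcases min_of_mul p1 p2 hk (cA g) with q | q
    · exact Or.inr (Or.inr q)
    · exact Or.inl q
  · rcases min_of_mul p1 p3 hk (cB g) with q | q
    · exact Or.inr (Or.inr q)
    · exact Or.inr (Or.inl q)
  · rcases min_of_mul p2 p3 hk (cC g) with q | q
    · exact Or.inl q
    · exact Or.inr (Or.inl q)

/-! ### Probability -/

/-- The chain as a deterministic function of the choices. -/
def wordChain (T0 : Tri) : (n : ℕ) → ((Finset.range (n+1)) → Fin 6) → Tri
  | 0 => fun _ => T0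
  | n+1 => fun w => subdiv
      (wordChain T0 n (fun k => w ⟨k.1, Finset.mem_range.mpr ((Finset.mem_range.mp k.2).trans (Nat.lt_succ_self _))⟩))
      (w ⟨n+1, by simp⟩)

lemma triChain_eq {Ω : Type*} (ι : ℕ → Ω → Fin 6) (T0 : Tri) (n : ℕ) (ω : Ω) :
    triChain ι T0 n ω = wordChain T0 n (fun k => ι k.1 ω) := by
  induction n with
  | zero => rfl
  | succ n ih => simp only [triChain, wordChain, ih]

lemma step_lintegral {Ω : Type*} [MeasurableSpace Ω] (P : Measure Ω) [IsProbabilityMeasure P]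
    (ι : ℕ → Ω → Fin 6) (hι : IsIIDUniform P ι) (T0 : Tri) (n : ℕ) (f : Tri → ENNReal) :
    ∫⁻ ω, f (triChain ι T0 (n+1) ω) ∂P =
      ∑ i : Fin 6, (1/6) * ∫⁻ ω, f (subdiv (triChain ι T0 n ω) i) ∂P := by
  obtain ⟨hm, hind, hu⟩ := hι
  have hI := hind.indepFun_finset (Finset.range (n+1)) {n+1} (by simp) hm
  have hW : Measurable (fun ω (k : Finset.range (n+1)) => ι k.1 ω) :=
    measurable_pi_lambda _ (fun k => hm _)
  have hmeas : ∀ g : Tri → ENNReal, Measurable (fun ω => g (triChain ι T0 n ω)) := by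
    intro g
    simp_rw [triChain_eq]
    exact (measurable_of_countable (fun w => g (wordChain T0 n w))).comp hW
  have hsplit : ∀ ω, f (triChain ι T0 (n+1) ω) =
      ∑ i : Fin 6, (if ι (n+1) ω = i then (1 : ENNReal) else 0) *
        f (subdiv (triChain ι T0 n ω) i) := by
    intro ω
    simp [triChain]
  have hmi : ∀ i : Fin 6, Measurable (fun ω => if ι (n+1) ω = i then (1 : ENNReal) else 0) :=
    fun i => (measurable_of_countable (fun j : Fin 6 => if j = i then (1 : ENNReal) else 0)).comp
      (hm (n+1))
  simp_rw [hsplit]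
  have hms : ∀ i ∈ (Finset.univ : Finset (Fin 6)), Measurable (fun ω =>
      (if ι (n+1) ω = i then (1 : ENNReal) else 0) * f (subdiv (triChain ι T0 n ω) i)) :=
    fun i _ => (hmi i).mul (hmeas (fun T => f (subdiv T i)))
  rw [lintegral_finsetSum _ hms]
  refine Finset.sum_congr rfl fun i _ => ?_
  have hI2 : IndepFun (fun ω => if ι (n+1) ω = i then (1 : ENNReal) else 0)
      (fun ω => f (subdiv (triChain ι T0 n ω) i)) P := by
    have := hI.symm.comp
      (measurable_of_countable (fun w : (({n+1} : Finset ℕ) → Fin 6) =>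
        if w ⟨n+1, by simp⟩ = i then (1 : ENNReal) else 0))
      (measurable_of_countable (fun w => f (subdiv (wordChain T0 n w) i)))
    simp_rw [triChain_eq]
    exact this
  have := lintegral_mul_eq_lintegral_mul_lintegral_of_indepFun (hmi i)
    (hmeas (fun T => f (subdiv T i))) hI2
  simp only [Pi.mul_apply] at this
  rw [this]
  congr 1
  have hset : MeasurableSet {ω | ι (n+1) ω = i} := hm (n+1) (measurableSet_singleton i)
  rw [← hu (n+1) i, ← lintegral_indicator_one hset]
  refine lintegral_congr fun ω => ?_
  simp [Set.indicator_apply]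

lemma measurable_chain {Ω : Type*} [MeasurableSpace Ω] (ι : ℕ → Ω → Fin 6)
    (hm : ∀ n, Measurable (ι n)) (T0 : Tri) (n : ℕ) (g : Tri → ENNReal) :
    Measurable (fun ω => g (triChain ι T0 n ω)) := by
  have hW : Measurable (fun ω (k : Finset.range (n+1)) => ι k.1 ω) :=
    measurable_pi_lambda _ (fun k => hm _)
  simp_rw [triChain_eq]
  exact (measurable_of_countable (fun w => g (wordChain T0 n w))).comp hW

lemma moment_bound {Ω : Type*} [MeasurableSpace Ω] (P : Measure Ω) [IsProbabilityMeasure P]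
    (ι : ℕ → Ω → Fin 6) (hι : IsIIDUniform P ι) (T0 : Tri) (hT : DD T0 ≠ 0) :
    ∃ K : ℝ, 0 ≤ K ∧ ∀ (n : ℕ) (a b : ℝ), (a ≠ 0 ∨ b ≠ 0) →
      ∫⁻ ω, ENNReal.ofReal (Complex.normSq (EE (triChain ι T0 n ω) a b) ^ (-ss)) ∂P ≤
        ENNReal.ofReal (K * (cc * 6 ^ ss) ^ n * Phi a b) := by
  obtain ⟨m, hm, hE⟩ := EE_lower T0 hT
  have hc : (0:ℝ) ≤ cc * 6 ^ ss := mul_nonneg (by norm_num [cc]) (by positivity)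
  refine ⟨m ^ (-ss), by positivity, ?_⟩
  intro n
  induction n with
  | zero =>
    intro a b hab
    simp only [triChain, lintegral_const, measure_univ, mul_one, pow_zero]
    apply ENNReal.ofReal_le_ofReal
    have hU : 0 < UU a b := lt_of_lt_of_le (by linarith [NN_pos hab]) (UU_lower a b)
    calc _ ≤ (m * UU a b) ^ (-ss) :=
          Real.rpow_le_rpow_of_nonpos (by positivity) (hE a b) (by norm_num [ss])
      _ = m ^ (-ss) * UU a b ^ (-ss) := Real.mul_rpow hm.le hU.le
      _ ≤ _ := by
        apply mul_le_mul_of_nonneg_left _ (by positivity)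
        unfold Phi
        linarith [Real.rpow_nonneg (UU_nonneg b a) (-ss)]
  | succ n ih =>
    intro a b hab
    rw [step_lintegral P ι hι T0 n
      (fun T => ENNReal.ofReal (Complex.normSq (EE T a b) ^ (-ss)))]
    simp_rw [EE_subdiv]
    have hnn : ∀ i ∈ (Finset.univ : Finset (Fin 6)),
        0 ≤ (1/6) * (m ^ (-ss) * (cc * 6 ^ ss) ^ n * Phi (Lx i a b) (Ly i a b)) := by
      intro i _
      have := Phi_nonneg (Lx i a b) (Ly i a b)
      positivity
    calc _ ≤ ∑ i : Fin 6, ENNReal.ofReal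
            ((1/6) * (m ^ (-ss) * (cc * 6 ^ ss) ^ n * Phi (Lx i a b) (Ly i a b))) := by
          apply Finset.sum_le_sum
          intro i _
          rw [ENNReal.ofReal_mul (by norm_num)]
          have : ENNReal.ofReal (1/6) = 1/6 := by
            rw [ENNReal.ofReal_div_of_pos (by norm_num)]; norm_num
          rw [this]
          gcongr
          exact ih _ _ (L_ne hab i)
      _ = ENNReal.ofReal (∑ i : Fin 6,
            ((1/6) * (m ^ (-ss) * (cc * 6 ^ ss) ^ n * Phi (Lx i a b) (Ly i a b)))) :=
          (ENNReal.ofReal_sum_of_nonneg hnn).symm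
      _ ≤ _ := by
        apply ENNReal.ofReal_le_ofReal
        rw [← Finset.mul_sum, ← Finset.mul_sum]
        have h1 := Phi_step hab
        have h2 : 0 ≤ m ^ (-ss) * (cc * 6 ^ ss) ^ n := by positivity
        have h3 := mul_le_mul_of_nonneg_left h1 h2
        rw [pow_succ]
        linarith

lemma edge_tendsto {Ω : Type*} [MeasurableSpace Ω] (P : Measure Ω) [IsProbabilityMeasure P]
    (ι : ℕ → Ω → Fin 6) (hι : IsIIDUniform P ι) (T0 : Tri) (hT : DD T0 ≠ 0)
    (R : ℝ) (hR : 0 < R) (a b : ℝ) (hab : a ≠ 0 ∨ b ≠ 0) :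
    Tendsto (fun n : ℕ => P {ω | Complex.normSq (EE (triChain ι T0 n ω) a b) ≤ R / 6^n})
      atTop (nhds 0) := by
  obtain ⟨K, hK, hb⟩ := moment_bound P ι hι T0 hT
  have hbound : ∀ n : ℕ, P {ω | Complex.normSq (EE (triChain ι T0 n ω) a b) ≤ R / 6^n} ≤
      ENNReal.ofReal (R ^ ss * K * Phi a b * cc ^ n) := by
    intro n
    have hq : 0 < R / 6^n := by positivity
    set t : ℝ := (R / 6^n) ^ (-ss) with ht
    have ht0 : 0 < t := Real.rpow_pos_of_pos hq _
    have hsub : {ω | Complex.normSq (EE (triChain ι T0 n ω) a b) ≤ R / 6^n} ⊆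
        {ω | ENNReal.ofReal t ≤
          ENNReal.ofReal (Complex.normSq (EE (triChain ι T0 n ω) a b) ^ (-ss))} := by
      intro ω hω
      simp only [mem_ofPred_eq] at hω ⊢
      apply ENNReal.ofReal_le_ofReal
      have hpos : 0 < Complex.normSq (EE (triChain ι T0 n ω) a b) := by
        have hD : DD (triChain ι T0 n ω) ≠ 0 := by
          rw [DD_chain]; positivity
        obtain ⟨m, hm, hE⟩ := EE_lower _ hD
        have hU : 0 < UU a b := lt_of_lt_of_le (by linarith [NN_pos hab]) (UU_lower a b)
        exact lt_of_lt_of_le (by positivity) (hE a b)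
      exact Real.rpow_le_rpow_of_nonpos hpos hω (by norm_num [ss])
    refine (measure_mono hsub).trans ?_
    refine (meas_ge_le_lintegral_div (measurable_chain ι hι.1 T0 n
      (fun T => ENNReal.ofReal (Complex.normSq (EE T a b) ^ (-ss)))).aemeasurable
      (by simpa using ht0) ENNReal.ofReal_ne_top).trans ?_
    refine (ENNReal.div_le_div_right (hb n a b hab) _).trans ?_
    rw [← ENNReal.ofReal_div_of_pos ht0]
    apply ENNReal.ofReal_le_ofReal
    apply le_of_eq
    rw [ht, Real.rpow_neg hq.le, Real.div_rpow hR.le (by positivity), mul_pow,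
      ← Real.rpow_natCast_mul (by norm_num) n ss, mul_comm (n:ℝ) ss,
      Real.rpow_mul_natCast (by norm_num)]
    field_simp
  have hlim : Tendsto (fun n : ℕ => ENNReal.ofReal (R ^ ss * K * Phi a b * cc ^ n))
      atTop (nhds 0) := by
    have h1 : Tendsto (fun n : ℕ => cc ^ n) atTop (nhds 0) :=
      tendsto_pow_atTop_nhds_zero_of_lt_one (by norm_num [cc]) (by norm_num [cc])
    have h2 := ENNReal.tendsto_ofReal (h1.const_mul (R ^ ss * K * Phi a b))
    simpa using h2
  exact tendsto_of_tendsto_of_tendsto_of_le_of_le tendsto_const_nhds hlim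
    (fun _ => bot_le) hbound

/-- **Theorem 2 of the paper.** The triangles of the chain become strongly flat in
probability: their largest angle converges to `π` in probability. -/
theorem largest_angle_tendsto_pi_in_probability
    (Ω : Type*) [MeasurableSpace Ω] (P : Measure Ω) [IsProbabilityMeasure P]
    (ι : ℕ → Ω → Fin 6) (hι : IsIIDUniform P ι)
    (T0 : Tri) (hT0 : T0.Nonflat) :
    ∀ ε : ℝ, 0 < ε →
      Tendsto (fun n : ℕ => P {ω | maxAngle (triChain ι T0 n ω) < Real.pi - ε})
        atTop (nhds 0) := by
  intro ε hε
  have hD : DD T0 ≠ 0 := hT0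
  set δ := min ε 1 with hδ
  have hδ0 : 0 < δ := lt_min hε one_pos
  have hδ1 : δ ≤ 1 := min_le_right _ _
  have hk : 0 < 1 - Real.cos δ ^ 2 := by
    have : 0 < Real.sin δ := Real.sin_pos_of_pos_of_lt_pi hδ0 (by linarith [Real.pi_gt_three])
    have := Real.sin_sq_add_cos_sq δ
    nlinarith
  set R := |DD T0| / √(1 - Real.cos δ ^ 2) with hR
  have hR0 : 0 < R := div_pos (abs_pos.mpr hD) (Real.sqrt_pos.mpr hk)
  have t1 := edge_tendsto P ι hι T0 hD R hR0 1 0 (by norm_num)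
  have t2 := edge_tendsto P ι hι T0 hD R hR0 0 1 (by norm_num)
  have t3 := edge_tendsto P ι hι T0 hD R hR0 1 (-1) (by norm_num)
  have t := t1.add (t2.add t3)
  simp only [add_zero] at t
  refine tendsto_of_tendsto_of_tendsto_of_le_of_le tendsto_const_nhds t
    (fun _ => bot_le) ?_
  intro n
  refine (measure_mono (t := {ω | Complex.normSq (EE (triChain ι T0 n ω) 1 0) ≤ R / 6^n} ∪
    ({ω | Complex.normSq (EE (triChain ι T0 n ω) 0 1) ≤ R / 6^n} ∪
     {ω | Complex.normSq (EE (triChain ι T0 n ω) 1 (-1)) ≤ R / 6^n})) ?_).trans ?_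
  · intro ω hω
    simp only [mem_ofPred_eq] at hω
    have hDn := DD_chain ι T0 n ω
    have := tri_event (triChain ι T0 n ω) (by rw [hDn]; positivity) δ hδ0 hδ1
      (by linarith [min_le_left ε 1])
    have e : |DD (triChain ι T0 n ω)| / √(1 - Real.cos δ ^ 2) = R / 6^n := by
      rw [hDn, abs_div, abs_of_pos (show (0:ℝ) < 6^n by positivity), hR]
      ring
    rw [e] at this
    exact this
  · refine (measure_union_le _ _).trans ?_
    exact add_le_add le_rfl (measure_union_le _ _)


end
end

section
/- For any initial triangle T(0) (vertices not all equal), almost surely the set of limit points of the sequence (X_n)_{n∈ℕ} is the whole segment [0,1/2] (where the limit set is ∩_{p∈ℕ} closure{X_n : n ≥ p}). -/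
open MeasureTheory ProbabilityTheory Filter Set

noncomputable section

variable {Ω : Type*}

/-! ### Edge lengths and range of `charX` -/

lemma Lmin_nonneg (T : Tri) : 0 ≤ Lmin T := by
  simp only [Lmin, e₁, e₂, e₃]
  positivity

lemma Lmin_le_Lmid (T : Tri) : Lmin T ≤ Lmid T := by
  simp only [Lmid, Lmin, Lmax]
  rcases le_total (e₁ T) (e₂ T) with h1 | h1 <;> rcases le_total (e₂ T) (e₃ T) with h2 | h2 <;>
    rcases le_total (e₁ T) (e₃ T) with h3 | h3 <;> simp [h1, h2, h3] <;> linarith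

lemma Lmid_le_Lmax (T : Tri) : Lmid T ≤ Lmax T := by
  simp only [Lmid, Lmin, Lmax]
  rcases le_total (e₁ T) (e₂ T) with h1 | h1 <;> rcases le_total (e₂ T) (e₃ T) with h2 | h2 <;>
    rcases le_total (e₁ T) (e₃ T) with h3 | h3 <;> simp [h1, h2, h3] <;> linarith

lemma charX_mem (T : Tri) : charX T ∈ Set.Icc (0 : ℝ) (1/2) := by
  have h0 := Lmin_nonneg T
  have h1 := Lmin_le_Lmid T
  have h2 := Lmid_le_Lmax T
  unfold charX
  constructor
  · apply div_nonneg _ (by positivity)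
    nlinarith
  · apply div_le_of_le_mul₀ (by positivity) (by norm_num)
    nlinarith

/-! ### Nondegeneracy -/

lemma Lmax_pos {T : Tri} (hT : T.Nondeg) : 0 < Lmax T := by
  by_contra h
  apply hT
  simp only [Lmax, not_lt, max_le_iff] at h
  obtain ⟨h1, h2, h3⟩ := h
  simp only [e₁, e₂, norm_le_zero_iff, sub_eq_zero] at h1 h2
  exact ⟨h1, h2⟩

lemma Nondeg_subdiv {T : Tri} (hT : T.Nondeg) (i : Fin 6) : (subdiv T i).Nondeg := by
  obtain ⟨a, b, c⟩ := T
  intro h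
  apply hT
  fin_cases i <;> simp [subdiv, Tri.A, Tri.B, Tri.C] at h ⊢ <;> grind

lemma Nondeg_foldl (w : List (Fin 6)) : ∀ {T : Tri}, T.Nondeg → (w.foldl subdiv T).Nondeg := by
  induction w with
  | nil => intro T h; exact h
  | cons i w ih => intro T h; exact ih (Nondeg_subdiv h i)

/-! ### Continuity -/

lemma continuous_e₁ : Continuous e₁ := by unfold e₁ Tri.A Tri.B; fun_prop
lemma continuous_e₂ : Continuous e₂ := by unfold e₂ Tri.B Tri.C; fun_prop
lemma continuous_e₃ : Continuous e₃ := by unfold e₃ Tri.A Tri.C; fun_prop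

lemma continuous_Lmax : Continuous Lmax :=
  continuous_e₁.max (continuous_e₂.max continuous_e₃)

lemma continuous_Lmin : Continuous Lmin :=
  continuous_e₁.min (continuous_e₂.min continuous_e₃)

lemma continuous_Lmid : Continuous Lmid :=
  (((continuous_e₁.add continuous_e₂).add continuous_e₃).sub continuous_Lmax).sub continuous_Lmin

lemma continuousAt_charX {T : Tri} (hT : T.Nondeg) : ContinuousAt charX T := by
  have h := Lmax_pos hT
  unfold charX
  apply ContinuousAt.div
  · exact (((continuous_Lmax.pow 2).add (continuous_Lmin.pow 2)).sub
      (continuous_Lmid.pow 2)).continuousAt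
  · exact (continuous_const.mul (continuous_Lmax.pow 2)).continuousAt
  · positivity

lemma continuous_subdiv (i : Fin 6) : Continuous (fun T => subdiv T i) := by
  fin_cases i <;> simp only [subdiv, Tri.A, Tri.B, Tri.C] <;> simp <;>
    refine ⟨?_, ?_, ?_⟩ <;> fun_prop

lemma continuous_foldl (w : List (Fin 6)) : Continuous (fun T : Tri => w.foldl subdiv T) := by
  induction w with
  | nil => exact continuous_id
  | cons i w ih => exact ih.comp (continuous_subdiv i)

lemma continuousAt_run (w : List (Fin 6)) {T : Tri} (hT : T.Nondeg) :
    ContinuousAt (fun T : Tri => charX (w.foldl subdiv T)) T :=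
  ContinuousAt.comp (f := fun T : Tri => w.foldl subdiv T)
    (continuousAt_charX (Nondeg_foldl w hT)) (continuous_foldl w).continuousAt

/-! ### Similarity invariance -/

/-- Image of a triangle under the similarity `z ↦ a + c z`. -/
def simil (a c : ℂ) (T : Tri) : Tri := (a + c * T.A, a + c * T.B, a + c * T.C)

lemma subdiv_simil (a c : ℂ) (T : Tri) (i : Fin 6) :
    subdiv (simil a c T) i = simil a c (subdiv T i) := by
  obtain ⟨x, y, z⟩ := T
  fin_cases i <;> simp [subdiv, simil, Tri.A, Tri.B, Tri.C] <;> grind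

lemma foldl_simil (a c : ℂ) (w : List (Fin 6)) :
    ∀ T : Tri, w.foldl subdiv (simil a c T) = simil a c (w.foldl subdiv T) := by
  induction w with
  | nil => intro T; rfl
  | cons i w ih => intro T; simp only [List.foldl_cons, subdiv_simil, ih]

lemma charX_simil (a : ℂ) {c : ℂ} (hc : c ≠ 0) (T : Tri) : charX (simil a c T) = charX T := by
  have hr : 0 < ‖c‖ := norm_pos_iff.mpr hc
  have h1 : e₁ (simil a c T) = ‖c‖ * e₁ T := by
    simp only [e₁, ← norm_mul]; congr 1; simp only [simil, Tri.A, Tri.B]; ring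
  have h2 : e₂ (simil a c T) = ‖c‖ * e₂ T := by
    simp only [e₂, ← norm_mul]; congr 1; simp only [simil, Tri.C, Tri.B]; ring
  have h3 : e₃ (simil a c T) = ‖c‖ * e₃ T := by
    simp only [e₃, ← norm_mul]; congr 1; simp only [simil, Tri.A, Tri.C]; ring
  have hM : Lmax (simil a c T) = ‖c‖ * Lmax T := by
    simp only [Lmax, h1, h2, h3, mul_max_of_nonneg _ _ hr.le]
  have hm : Lmin (simil a c T) = ‖c‖ * Lmin T := by
    simp only [Lmin, h1, h2, h3, mul_min_of_nonneg _ _ hr.le]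
  have hd : Lmid (simil a c T) = ‖c‖ * Lmid T := by
    simp only [Lmid, h1, h2, h3, hM, hm]; ring
  unfold charX
  rw [hM, hm, hd]
  have : ((‖c‖ * Lmax T) ^ 2 + (‖c‖ * Lmin T) ^ 2 - (‖c‖ * Lmid T) ^ 2)
      = ‖c‖ ^ 2 * (Lmax T ^ 2 + Lmin T ^ 2 - Lmid T ^ 2) := by ring
  rw [this, show 2 * (‖c‖ * Lmax T) ^ 2 = ‖c‖ ^ 2 * (2 * Lmax T ^ 2) by ring]
  exact mul_div_mul_left _ _ (by positivity)

/-! ### Flat triangles -/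

/-- `T` is flat with characterizing abscissa `x`. -/
def FlatAt (T : Tri) (x : ℝ) : Prop :=
  ∃ p c : ℂ, c ≠ 0 ∧
    (T = (p, p + x * c, p + c) ∨ T = (p, p + c, p + x * c) ∨ T = (p + x * c, p, p + c) ∨
     T = (p + x * c, p + c, p) ∨ T = (p + c, p, p + x * c) ∨ T = (p + c, p + x * c, p))

lemma charX_swap (a b c : ℂ) : charX (b, a, c) = charX (a, b, c) := by
  have h1 : e₁ (b, a, c) = e₁ (a, b, c) := norm_sub_rev _ _
  have h2 : e₂ (b, a, c) = e₃ (a, b, c) := norm_sub_rev _ _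
  have h3 : e₃ (b, a, c) = e₂ (a, b, c) := norm_sub_rev _ _
  have hM : Lmax (b, a, c) = Lmax (a, b, c) := by
    simp only [Lmax, h1, h2, h3, max_comm (e₃ (a, b, c))]
  have hm : Lmin (b, a, c) = Lmin (a, b, c) := by
    simp only [Lmin, h1, h2, h3, min_comm (e₃ (a, b, c))]
  have hd : Lmid (b, a, c) = Lmid (a, b, c) := by
    simp only [Lmid, h1, h2, h3, hM, hm]; ring
  simp only [charX, hM, hm, hd]

lemma charX_swap' (a b c : ℂ) : charX (a, c, b) = charX (a, b, c) := by
  have h1 : e₁ (a, c, b) = e₃ (a, b, c) := norm_sub_rev _ _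
  have h2 : e₂ (a, c, b) = e₂ (a, b, c) := norm_sub_rev _ _
  have h3 : e₃ (a, c, b) = e₁ (a, b, c) := norm_sub_rev _ _
  have hM : Lmax (a, c, b) = Lmax (a, b, c) := by
    simp only [Lmax, h1, h2, h3]; grind
  have hm : Lmin (a, c, b) = Lmin (a, b, c) := by
    simp only [Lmin, h1, h2, h3]; grind
  have hd : Lmid (a, c, b) = Lmid (a, b, c) := by
    simp only [Lmid, h1, h2, h3, hM, hm]; ring
  simp only [charX, hM, hm, hd]

lemma charX_flat_base {x : ℝ} (hx : x ∈ Set.Icc (0 : ℝ) (1/2)) (p : ℂ) {c : ℂ} (hc : c ≠ 0) :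
    charX (p, p + x * c, p + c) = x := by
  obtain ⟨h0, h1⟩ := hx
  have hr : 0 < ‖c‖ := norm_pos_iff.mpr hc
  have E1 : e₁ (p, p + x * c, p + c) = x * ‖c‖ := by
    simp only [e₁, Tri.A, Tri.B]
    rw [norm_sub_rev, add_sub_cancel_left, norm_mul, Complex.norm_real, Real.norm_of_nonneg h0]
  have E2 : e₂ (p, p + x * c, p + c) = (1 - x) * ‖c‖ := by
    simp only [e₂, Tri.B, Tri.C]
    rw [norm_sub_rev, show p + c - (p + x * c) = ((1 - x : ℝ) : ℂ) * c by push_cast; ring,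
      norm_mul, Complex.norm_real, Real.norm_of_nonneg (by linarith)]
  have E3 : e₃ (p, p + x * c, p + c) = ‖c‖ := by
    simp only [e₃, Tri.A, Tri.C]
    rw [add_sub_cancel_left]
  have hM : Lmax (p, p + x * c, p + c) = ‖c‖ := by
    simp only [Lmax, E1, E2, E3]
    rw [max_eq_right (b := ‖c‖) (by nlinarith), max_eq_right (by nlinarith)]
  have hm : Lmin (p, p + x * c, p + c) = x * ‖c‖ := by
    simp only [Lmin, E1, E2, E3]
    rw [min_eq_left (b := ‖c‖) (by nlinarith), min_eq_left (by nlinarith)]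
  have hd : Lmid (p, p + x * c, p + c) = (1 - x) * ‖c‖ := by
    simp only [Lmid, hM, hm, E1, E2, E3]; ring
  simp only [charX, hM, hm, hd]
  field_simp
  ring

lemma charX_flat {T : Tri} {x : ℝ} (hx : x ∈ Set.Icc (0 : ℝ) (1/2)) (h : FlatAt T x) :
    charX T = x := by
  obtain ⟨p, c, hc, h⟩ := h
  have key := charX_flat_base hx p hc
  rcases h with h | h | h | h | h | h <;> subst h
  · exact key
  · rw [charX_swap', key]
  · rw [charX_swap, key]
  · rw [charX_swap', charX_swap, key]
  · rw [charX_swap, charX_swap', key]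
  · rw [charX_swap, charX_swap', charX_swap, key]

lemma flat_child4 {T : Tri} {x : ℝ} (hx : x ∈ Set.Icc (0 : ℝ) (1/2)) (h : FlatAt T x) :
    ∃ i, FlatAt (subdiv T i) ((1 + x) / (4 - 2 * x)) := by
  obtain ⟨p, c, hc, h⟩ := h
  have hx2 : (2 - x : ℂ) ≠ 0 := by
    have : (2 - x : ℝ) ≠ 0 := by have := hx.2; intro h; linarith
    exact_mod_cast this
  have hx4 : (4 - 2 * x : ℂ) ≠ 0 := by
    rw [show (4 - 2 * x : ℂ) = 2 * (2 - x) by ring]; simpa using hx2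
  have hc' : c * (2 - x) / 3 ≠ 0 := by simp [hc, hx2]
  have hm : (((1 + x) / (4 - 2 * x) : ℝ) : ℂ) * (c * (2 - x) / 3) = (1 + x) * c / 6 := by
    push_cast; rw [div_mul_eq_mul_div, div_eq_iff hx4]; ring
  rcases h with h | h | h | h | h | h <;> subst h
  · refine ⟨3, p + (1 + x) * c / 3, c * (2 - x) / 3, hc', .inr (.inr (.inr (.inl ?_)))⟩
    rw [hm]; simp [subdiv, Tri.A, Tri.B, Tri.C]; grind
  · refine ⟨2, p + (1 + x) * c / 3, c * (2 - x) / 3, hc', .inr (.inr (.inr (.inr (.inr ?_))))⟩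
    rw [hm]; simp [subdiv, Tri.A, Tri.B, Tri.C]; grind
  · refine ⟨4, p + (1 + x) * c / 3, c * (2 - x) / 3, hc', .inr (.inr (.inr (.inr (.inr ?_))))⟩
    rw [hm]; simp [subdiv, Tri.A, Tri.B, Tri.C]; grind
  · refine ⟨1, p + (1 + x) * c / 3, c * (2 - x) / 3, hc', .inr (.inr (.inr (.inl ?_)))⟩
    rw [hm]; simp [subdiv, Tri.A, Tri.B, Tri.C]; grind
  · refine ⟨5, p + (1 + x) * c / 3, c * (2 - x) / 3, hc', .inr (.inr (.inr (.inl ?_)))⟩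
    rw [hm]; simp [subdiv, Tri.A, Tri.B, Tri.C]; grind
  · refine ⟨0, p + (1 + x) * c / 3, c * (2 - x) / 3, hc', .inr (.inr (.inr (.inr (.inr ?_))))⟩
    rw [hm]; simp [subdiv, Tri.A, Tri.B, Tri.C]; grind

lemma flat_child5 {T : Tri} {x : ℝ} (hx : x ∈ Set.Icc (0 : ℝ) (1/2)) (h : FlatAt T x) :
    ∃ i, FlatAt (subdiv T i) ((1 - 2 * x) / (4 - 2 * x)) := by
  obtain ⟨p, c, hc, h⟩ := h
  have hx2 : (2 - x : ℂ) ≠ 0 := by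
    have : (2 - x : ℝ) ≠ 0 := by have := hx.2; intro h; linarith
    exact_mod_cast this
  have hx4 : (4 - 2 * x : ℂ) ≠ 0 := by
    rw [show (4 - 2 * x : ℂ) = 2 * (2 - x) by ring]; simpa using hx2
  have hc' : c * (2 - x) / 3 ≠ 0 := by simp [hc, hx2]
  have hm : (((1 - 2 * x) / (4 - 2 * x) : ℝ) : ℂ) * (c * (2 - x) / 3) = (1 - 2 * x) * c / 6 := by
    push_cast; rw [div_mul_eq_mul_div, div_eq_iff hx4]; ring
  rcases h with h | h | h | h | h | h <;> subst h
  · refine ⟨4, p + (1 + x) * c / 3, c * (2 - x) / 3, hc', .inr (.inr (.inr (.inr (.inr ?_))))⟩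
    rw [hm]; simp [subdiv, Tri.A, Tri.B, Tri.C]; grind
  · refine ⟨1, p + (1 + x) * c / 3, c * (2 - x) / 3, hc', .inr (.inr (.inr (.inl ?_)))⟩
    rw [hm]; simp [subdiv, Tri.A, Tri.B, Tri.C]; grind
  · refine ⟨3, p + (1 + x) * c / 3, c * (2 - x) / 3, hc', .inr (.inr (.inr (.inl ?_)))⟩
    rw [hm]; simp [subdiv, Tri.A, Tri.B, Tri.C]; grind
  · refine ⟨2, p + (1 + x) * c / 3, c * (2 - x) / 3, hc', .inr (.inr (.inr (.inr (.inr ?_))))⟩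
    rw [hm]; simp [subdiv, Tri.A, Tri.B, Tri.C]; grind
  · refine ⟨0, p + (1 + x) * c / 3, c * (2 - x) / 3, hc', .inr (.inr (.inr (.inr (.inr ?_))))⟩
    rw [hm]; simp [subdiv, Tri.A, Tri.B, Tri.C]; grind
  · refine ⟨5, p + (1 + x) * c / 3, c * (2 - x) / 3, hc', .inr (.inr (.inr (.inl ?_)))⟩
    rw [hm]; simp [subdiv, Tri.A, Tri.B, Tri.C]; grind

lemma z4_mem {x : ℝ} (hx : x ∈ Set.Icc (0 : ℝ) (1/2)) :
    (1 + x) / (4 - 2 * x) ∈ Set.Icc (0 : ℝ) (1/2) := by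
  obtain ⟨h0, h1⟩ := hx
  have : 0 < 4 - 2 * x := by linarith
  constructor
  · positivity
  · rw [div_le_iff₀ this]; linarith

lemma z5_mem {x : ℝ} (hx : x ∈ Set.Icc (0 : ℝ) (1/2)) :
    (1 - 2 * x) / (4 - 2 * x) ∈ Set.Icc (0 : ℝ) (1/2) := by
  obtain ⟨h0, h1⟩ := hx
  have : 0 < 4 - 2 * x := by linarith
  constructor
  · apply div_nonneg <;> linarith
  · rw [div_le_iff₀ this]; linarith

lemma six_div_le {x y : ℝ} (hx : x ∈ Set.Icc (0 : ℝ) (1/2)) (hy : y ∈ Set.Icc (0 : ℝ) (1/2)) :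
    |6 * (x - y) / ((4 - 2 * x) * (4 - 2 * y))| ≤ 2 / 3 * |x - y| := by
  obtain ⟨h0, h1⟩ := hx
  obtain ⟨h2, h3⟩ := hy
  have hp : 9 ≤ (4 - 2 * x) * (4 - 2 * y) := by nlinarith
  rw [abs_div, abs_mul, abs_of_pos (show (0 : ℝ) < 6 by norm_num),
    abs_of_pos (show 0 < (4 - 2 * x) * (4 - 2 * y) by linarith), div_le_iff₀ (by linarith)]
  nlinarith [abs_nonneg (x - y)]

lemma z4_contr {x y : ℝ} (hx : x ∈ Set.Icc (0 : ℝ) (1/2)) (hy : y ∈ Set.Icc (0 : ℝ) (1/2)) :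
    |(1 + x) / (4 - 2 * x) - (1 + y) / (4 - 2 * y)| ≤ 2 / 3 * |x - y| := by
  have hx' : 4 - 2 * x ≠ 0 := by have := hx.2; intro h; linarith
  have hy' : 4 - 2 * y ≠ 0 := by have := hy.2; intro h; linarith
  have := six_div_le hx hy
  rwa [show (1 + x) / (4 - 2 * x) - (1 + y) / (4 - 2 * y)
    = 6 * (x - y) / ((4 - 2 * x) * (4 - 2 * y)) by
      rw [div_sub_div _ _ hx' hy']; congr 1; ring]

lemma z5_contr {x y : ℝ} (hx : x ∈ Set.Icc (0 : ℝ) (1/2)) (hy : y ∈ Set.Icc (0 : ℝ) (1/2)) :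
    |(1 - 2 * x) / (4 - 2 * x) - (1 - 2 * y) / (4 - 2 * y)| ≤ 2 / 3 * |x - y| := by
  have hx' : 4 - 2 * x ≠ 0 := by have := hx.2; intro h; linarith
  have hy' : 4 - 2 * y ≠ 0 := by have := hy.2; intro h; linarith
  have := six_div_le hx hy
  rwa [show (1 - 2 * x) / (4 - 2 * x) - (1 - 2 * y) / (4 - 2 * y)
    = - (6 * (x - y) / ((4 - 2 * x) * (4 - 2 * y))) by
      rw [div_sub_div _ _ hx' hy', ← neg_div]; congr 1; ring, abs_neg]

/-- The two contractions cover `[0,1/2]`, hence orbits of flat triangles are dense. -/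
lemma flat_dense {T : Tri} {x : ℝ} (hx : x ∈ Set.Icc (0 : ℝ) (1/2)) (h : FlatAt T x) (n : ℕ) :
    ∀ y ∈ Set.Icc (0 : ℝ) (1/2), ∃ (w : List (Fin 6)) (x' : ℝ), x' ∈ Set.Icc (0 : ℝ) (1/2) ∧
      FlatAt (w.foldl subdiv T) x' ∧ |x' - y| ≤ (2/3) ^ n := by
  induction n with
  | zero =>
    intro y hy
    refine ⟨[], x, hx, h, ?_⟩
    rw [pow_zero, abs_le]
    constructor <;> linarith [hx.1, hx.2, hy.1, hy.2]
  | succ n ih =>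
    intro y hy
    rcases le_total (1/4) y with hy4 | hy4
    · have hpos : 0 < 1 + 2 * y := by linarith
      have hy' : (4 * y - 1) / (1 + 2 * y) ∈ Set.Icc (0 : ℝ) (1/2) := by
        constructor
        · apply div_nonneg <;> linarith
        · rw [div_le_iff₀ hpos]; linarith [hy.2]
      obtain ⟨w, x', hx', hF, hd⟩ := ih _ hy'
      obtain ⟨i, hi⟩ := flat_child4 hx' hF
      refine ⟨w ++ [i], _, z4_mem hx', by simpa using hi, ?_⟩
      have hc := z4_contr hx' hy'
      have e : (1 + (4 * y - 1) / (1 + 2 * y)) / (4 - 2 * ((4 * y - 1) / (1 + 2 * y))) = y := by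
        rw [div_eq_iff (by have := hy'.2; intro h; linarith)]
        field_simp; ring
      rw [e] at hc
      rw [pow_succ]; linarith
    · have hpos : 0 < 2 - 2 * y := by linarith
      have hy' : (1 - 4 * y) / (2 - 2 * y) ∈ Set.Icc (0 : ℝ) (1/2) := by
        constructor
        · apply div_nonneg <;> linarith
        · rw [div_le_iff₀ hpos]; linarith [hy.1]
      obtain ⟨w, x', hx', hF, hd⟩ := ih _ hy'
      obtain ⟨i, hi⟩ := flat_child5 hx' hF
      refine ⟨w ++ [i], _, z5_mem hx', by simpa using hi, ?_⟩
      have hc := z5_contr hx' hy'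
      have e : (1 - 2 * ((1 - 4 * y) / (2 - 2 * y))) / (4 - 2 * ((1 - 4 * y) / (2 - 2 * y)))
          = y := by
        rw [div_eq_iff (by have := hy'.2; intro h; linarith)]
        have h1y : 1 - y ≠ 0 := by intro h; linarith
        field_simp; ring
      rw [e] at hc
      rw [pow_succ]; linarith

lemma flat_hits {T : Tri} {x : ℝ} (hx : x ∈ Set.Icc (0 : ℝ) (1/2)) (h : FlatAt T x)
    {y : ℝ} (hy : y ∈ Set.Icc (0 : ℝ) (1/2)) {U : Set ℝ} (hU : IsOpen U) (hyU : y ∈ U) :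
    ∃ w : List (Fin 6), charX (w.foldl subdiv T) ∈ U := by
  obtain ⟨ε, hε, hb⟩ := Metric.isOpen_iff.mp hU y hyU
  obtain ⟨n, hn⟩ := exists_pow_lt_of_lt_one hε (show (2/3 : ℝ) < 1 by norm_num)
  obtain ⟨w, x', hx', hF, hd⟩ := flat_dense hx h n y hy
  refine ⟨w, hb ?_⟩
  rw [charX_flat hx' hF, Metric.mem_ball, Real.dist_eq]
  linarith

/-! ### Flattening -/

lemma foldl_zero (a u v : ℂ) (n : ℕ) :
    (List.replicate n (0 : Fin 6)).foldl subdiv (a, a + u, a + v)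
      = simil a ((1/2) ^ n) (0, u, 2 * u + (2/3) ^ n * (v - 2 * u)) := by
  induction n with
  | zero => simp [simil, Tri.A, Tri.B, Tri.C]
  | succ n ih =>
    rw [List.replicate_succ', List.foldl_append, ih]
    simp only [List.foldl_cons, List.foldl_nil, subdiv_simil]
    simp [subdiv, simil, Tri.A, Tri.B, Tri.C, pow_succ]
    constructor <;> ring

lemma exists_hit {T : Tri} (hT : T.Nondeg)
    {y : ℝ} (hy : y ∈ Set.Icc (0 : ℝ) (1/2)) {U : Set ℝ} (hU : IsOpen U) (hyU : y ∈ U) :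
    ∃ w : List (Fin 6), charX (w.foldl subdiv T) ∈ U := by
  obtain ⟨a, b, c⟩ := T
  by_cases hab : a = b
  · subst hab
    have hac : c - a ≠ 0 := fun h => hT ⟨rfl, (sub_eq_zero.mp h).symm⟩
    refine flat_hits (x := 0) (by norm_num) ⟨a, c - a, hac, .inl ?_⟩ hy hU hyU
    simp
  · have hu : b - a ≠ 0 := sub_ne_zero.mpr (Ne.symm hab)
    set u := b - a with hu_def
    set v := c - a with hv_def
    obtain ⟨w, hw⟩ := flat_hits (T := (0, u, 2 * u)) (x := 1/2) (by norm_num)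
      ⟨0, 2 * u, by simpa using hu, .inl (by simp)⟩ hy hU hyU
    have hnd : Tri.Nondeg (0, u, 2 * u) := fun h => hu h.1.symm
    have hlim : Tendsto (fun n : ℕ => ((0, u, 2 * u + (2/3) ^ n * (v - 2 * u)) : Tri)) atTop
        (nhds (0, u, 2 * u)) := by
      have h1 : Tendsto (fun n : ℕ => ((2/3 : ℂ)) ^ n) atTop (nhds 0) :=
        tendsto_pow_atTop_nhds_zero_of_norm_lt_one (by norm_num)
      have h2 : Tendsto (fun n : ℕ => 2 * u + (2/3 : ℂ) ^ n * (v - 2 * u)) atTop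
          (nhds (2 * u)) := by
        simpa using (h1.mul_const (v - 2 * u)).const_add (2 * u)
      exact tendsto_const_nhds.prodMk_nhds (tendsto_const_nhds.prodMk_nhds h2)
    have hev := ((continuousAt_run w hnd).tendsto.comp hlim).eventually (hU.mem_nhds hw)
    obtain ⟨n, hn⟩ := hev.exists
    refine ⟨List.replicate n 0 ++ w, ?_⟩
    rw [List.foldl_append, show ((a, b, c) : Tri) = (a, a + u, a + v) by simp [u, v],
      foldl_zero, foldl_simil, charX_simil _ (by simp)]
    exact hn

/-- Uniform bound on the number of steps needed to reach an open set. -/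
lemma exists_hit_uniform
    {y : ℝ} (hy : y ∈ Set.Icc (0 : ℝ) (1/2)) {U : Set ℝ} (hU : IsOpen U) (hyU : y ∈ U) :
    ∃ N : ℕ, ∀ T : Tri, T.Nondeg →
      ∃ w : List (Fin 6), w.length ≤ N ∧ charX (w.foldl subdiv T) ∈ U := by
  have hK : IsCompact (Metric.sphere (0 : ℂ × ℂ) 1) := isCompact_sphere _ _
  have key : ∃ N : ℕ, ∀ q ∈ Metric.sphere (0 : ℂ × ℂ) 1,
      ∃ w : List (Fin 6), w.length ≤ N ∧ charX (w.foldl subdiv ((0, q) : Tri)) ∈ U := by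
    refine hK.induction_on (p := fun S => ∃ N : ℕ, ∀ q ∈ S,
      ∃ w : List (Fin 6), w.length ≤ N ∧ charX (w.foldl subdiv ((0, q) : Tri)) ∈ U) ?_ ?_ ?_ ?_
    · exact ⟨0, by simp⟩
    · rintro s t hst ⟨N, hN⟩
      exact ⟨N, fun q hq => hN q (hst hq)⟩
    · rintro s t ⟨N, hN⟩ ⟨M, hM⟩
      refine ⟨max N M, ?_⟩
      rintro q (hq | hq)
      · obtain ⟨w, h1, h2⟩ := hN q hq
        exact ⟨w, h1.trans (le_max_left _ _), h2⟩
      · obtain ⟨w, h1, h2⟩ := hM q hq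
        exact ⟨w, h1.trans (le_max_right _ _), h2⟩
    · intro q hq
      have hnd : Tri.Nondeg (0, q) := by
        rintro ⟨h1, h2⟩
        have hq1 : q.1 = 0 := h1.symm
        have hq2 : q.2 = 0 := h2.symm.trans hq1
        have : q = 0 := Prod.ext hq1 hq2
        subst this
        simp at hq
      obtain ⟨w, hw⟩ := exists_hit hnd hy hU hyU
      have hc : ContinuousAt (fun q : ℂ × ℂ => charX (w.foldl subdiv ((0, q) : Tri))) q :=
        ContinuousAt.comp (f := fun q : ℂ × ℂ => ((0, q) : Tri)) (continuousAt_run w hnd)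
          (by fun_prop)
      refine ⟨_, mem_nhdsWithin_of_mem_nhds (hc (hU.mem_nhds hw)), w.length, ?_⟩
      intro q' hq'
      exact ⟨w, le_rfl, hq'⟩
  obtain ⟨N, hN⟩ := key
  refine ⟨N, ?_⟩
  rintro ⟨a, b, c⟩ hT
  have hne : ((b - a, c - a) : ℂ × ℂ) ≠ 0 := by
    intro h
    rw [Prod.mk_eq_zero, sub_eq_zero, sub_eq_zero] at h
    exact hT ⟨h.1.symm, h.1.trans h.2.symm⟩
  set q : ℂ × ℂ := (b - a, c - a) with hq
  have hr : 0 < ‖q‖ := norm_pos_iff.mpr hne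
  have hr' : (‖q‖ : ℂ) ≠ 0 := by exact_mod_cast hr.ne'
  obtain ⟨w, h1, h2⟩ := hN (((‖q‖⁻¹ : ℝ) : ℂ) • q) (by
    rw [mem_sphere_zero_iff_norm, norm_smul, Complex.norm_real, norm_inv, norm_norm,
      inv_mul_cancel₀ hr.ne'])
  refine ⟨w, h1, ?_⟩
  have e : ((a, b, c) : Tri) = simil a (‖q‖ : ℂ) ((0, ((‖q‖⁻¹ : ℝ) : ℂ) • q) : Tri) := by
    simp only [simil, Tri.A, Tri.B, Tri.C, Prod.smul_fst, Prod.smul_snd, smul_eq_mul,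
      Complex.ofReal_inv, mul_inv_cancel_left₀ hr']
    simp [hq]
  rw [e, foldl_simil, charX_simil _ hr']
  exact h2

/-! ### Probability -/

/-- The cylinder event of a (reversed) history. -/
def histEvent (ι : ℕ → Ω → Fin 6) : List (Fin 6) → Set Ω
  | [] => Set.univ
  | i :: l => histEvent ι l ∩ {ω | ι (l.length + 1) ω = i}

/-- The triangle reached after a (reversed) history. -/
def histTri (T0 : Tri) : List (Fin 6) → Tri
  | [] => T0
  | i :: l => subdiv (histTri T0 l) i

/-- No visit to `U` from time `m` on. -/
def noHit (ι : ℕ → Ω → Fin 6) (T0 : Tri) (U : Set ℝ) (m : ℕ) : Set Ω :=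
  {ω | ∀ n, m ≤ n → charX (triChain ι T0 n ω) ∉ U}

lemma Nondeg_histTri {T0 : Tri} (h : T0.Nondeg) (l : List (Fin 6)) : (histTri T0 l).Nondeg := by
  induction l with
  | nil => exact h
  | cons i l ih => exact Nondeg_subdiv ih i

lemma triChain_eq_s2 (ι : ℕ → Ω → Fin 6) (T0 : Tri) (l : List (Fin 6)) {ω : Ω}
    (h : ω ∈ histEvent ι l) : triChain ι T0 l.length ω = histTri T0 l := by
  induction l with
  | nil => rfl
  | cons i l ih =>
    obtain ⟨h1, h2⟩ := h
    simp only [List.length_cons, triChain, histTri, ih h1]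
    rw [show ι (l.length + 1) ω = i from h2]

lemma histEvent_eq (ι : ℕ → Ω → Fin 6) (l : List (Fin 6)) :
    ∃ g : ℕ → Fin 6, histEvent ι l = ⋂ j ∈ Finset.Icc 1 l.length, ι j ⁻¹' {g j} := by
  induction l with
  | nil => exact ⟨fun _ => 0, by simp [histEvent]⟩
  | cons i l ih =>
    obtain ⟨g, hg⟩ := ih
    refine ⟨Function.update g (l.length + 1) i, ?_⟩
    ext ω
    simp only [histEvent, hg, List.length_cons, Set.mem_inter_iff, Set.mem_iInter, Finset.mem_Icc,
      Set.mem_preimage, Set.mem_singleton_iff, Set.mem_setOf_eq]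
    constructor
    · rintro ⟨h1, h2⟩ j ⟨hj1, hj2⟩
      rcases Nat.lt_or_ge l.length j with h | h
      · have : j = l.length + 1 := by omega
        subst this; simp [h2]
      · rw [Function.update_of_ne (by omega)]
        exact h1 j ⟨hj1, h⟩
    · intro h
      refine ⟨fun j hj => ?_, ?_⟩
      · have := h j ⟨hj.1, by omega⟩
        rwa [Function.update_of_ne (by omega)] at this
      · have := h (l.length + 1) ⟨by omega, le_rfl⟩
        simpa using this

lemma measure_histEvent [MeasurableSpace Ω] {P : Measure Ω} {ι : ℕ → Ω → Fin 6}
    (hι : IsIIDUniform P ι) (l : List (Fin 6)) : P (histEvent ι l) = (1/6) ^ l.length := by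
  obtain ⟨g, hg⟩ := histEvent_eq ι l
  rw [hg, hι.2.1.measure_inter_preimage_eq_mul (Finset.Icc 1 l.length)
    (sets := fun j => {g j}) (fun _ _ => measurableSet_singleton _)]
  rw [Finset.prod_congr rfl (fun j _ => show P (ι j ⁻¹' {g j}) = 1/6 from hι.2.2 j (g j))]
  simp

lemma exists_hist (ι : ℕ → Ω → Fin 6) (ω : Ω) (m : ℕ) :
    ∃ l : List (Fin 6), l.length = m ∧ ω ∈ histEvent ι l := by
  induction m with
  | zero => exact ⟨[], rfl, trivial⟩
  | succ m ih =>
    obtain ⟨l, hl, h⟩ := ih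
    exact ⟨ι (l.length + 1) ω :: l, by simp [hl], h, rfl⟩

lemma noHit_null [MeasurableSpace Ω] {P : Measure Ω} [IsProbabilityMeasure P]
    {ι : ℕ → Ω → Fin 6} (hι : IsIIDUniform P ι) {T0 : Tri} (hT0 : T0.Nondeg)
    {U : Set ℝ} {N : ℕ} (hN : ∀ T : Tri, T.Nondeg →
      ∃ w : List (Fin 6), w.length ≤ N ∧ charX (w.foldl subdiv T) ∈ U) (p : ℕ) :
    P (noHit ι T0 U p) = 0 := by
  set f : List (Fin 6) → ℝ := fun l =>
    6 ^ l.length * P.real (histEvent ι l ∩ noHit ι T0 U l.length) with hf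
  have hf0 : ∀ l, 0 ≤ f l := fun l => by simp only [hf]; positivity
  have hf1 : ∀ l, f l ≤ 1 := by
    intro l
    have h1 : P.real (histEvent ι l ∩ noHit ι T0 U l.length) ≤ (1/6) ^ l.length := by
      refine (measureReal_mono Set.inter_subset_left).trans (le_of_eq ?_)
      rw [Measure.real, measure_histEvent hι]
      simp
    calc f l ≤ 6 ^ l.length * (1/6) ^ l.length := by simp only [hf]; gcongr
      _ = 1 := by rw [← mul_pow]; norm_num
  have hbdd : BddAbove (Set.range f) := ⟨1, by rintro _ ⟨l, rfl⟩; exact hf1 l⟩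
  set s : ℝ := ⨆ l, f l with hs
  have hle : ∀ l, f l ≤ s := fun l => le_ciSup hbdd l
  have hs0 : 0 ≤ s := (hf0 []).trans (hle [])
  have hstep : ∀ l, f l ≤ (1/6) * ∑ i : Fin 6, f (i :: l) := by
    intro l
    have hsub : histEvent ι l ∩ noHit ι T0 U l.length ⊆
        ⋃ i : Fin 6, (histEvent ι (i :: l) ∩ noHit ι T0 U (i :: l).length) := by
      rintro ω ⟨h1, h2⟩
      refine Set.mem_iUnion.mpr ⟨ι (l.length + 1) ω, ⟨h1, rfl⟩, fun n hn => h2 n ?_⟩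
      simp only [List.length_cons] at hn
      omega
    have h1 := (measureReal_mono (μ := P) hsub).trans (measureReal_iUnion_fintype_le _)
    calc f l ≤ 6 ^ l.length * ∑ i : Fin 6,
          P.real (histEvent ι (i :: l) ∩ noHit ι T0 U (i :: l).length) := by
            simp only [hf]; gcongr
      _ = (1/6) * ∑ i : Fin 6, f (i :: l) := by
        simp only [hf, Finset.mul_sum, List.length_cons, pow_succ]
        refine Finset.sum_congr rfl fun i _ => ?_
        ring
  have hA : ∀ (w l : List (Fin 6)), charX (w.foldl subdiv (histTri T0 l)) ∈ U →
      f l ≤ (1 - (1/6) ^ w.length) * s := by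
    intro w
    induction w with
    | nil =>
      intro l hl
      have : histEvent ι l ∩ noHit ι T0 U l.length = ∅ := by
        rw [Set.eq_empty_iff_forall_notMem]
        rintro ω ⟨h1, h2⟩
        apply h2 _ le_rfl
        rw [triChain_eq_s2 ι T0 l h1]
        exact hl
      simp [hf, this]
    | cons i w ih =>
      intro l hl
      have h1 := ih (i :: l) hl
      have h2 := hstep l
      rw [← Finset.add_sum_erase _ _ (Finset.mem_univ i)] at h2
      have h3 : ∑ j ∈ Finset.univ.erase i, f (j :: l) ≤ 5 * s := by
        refine (Finset.sum_le_card_nsmul _ _ s (fun j _ => hle _)).trans (le_of_eq ?_)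
        simp
      rw [List.length_cons, pow_succ]
      linarith
  have hB : ∀ l, f l ≤ (1 - (1/6) ^ N) * s := by
    intro l
    obtain ⟨w, hw, hU⟩ := hN _ (Nondeg_histTri hT0 l)
    refine (hA w l hU).trans ?_
    have : (1/6 : ℝ) ^ N ≤ (1/6) ^ w.length :=
      pow_le_pow_of_le_one (by norm_num) (by norm_num) hw
    gcongr
  have hs1 : s ≤ (1 - (1/6) ^ N) * s := ciSup_le hB
  have hs2 : s = 0 := by
    have : (0 : ℝ) < (1/6) ^ N := by positivity
    nlinarith
  have hz : ∀ l, P (histEvent ι l ∩ noHit ι T0 U l.length) = 0 := by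
    intro l
    have h1 : f l = 0 := le_antisymm (hs2 ▸ hle l) (hf0 l)
    have h2 : P.real (histEvent ι l ∩ noHit ι T0 U l.length) = 0 := by
      simpa [hf] using h1
    exact (measureReal_eq_zero_iff).mp h2
  refine measure_mono_null ?_ (measure_iUnion_null
    (s := fun l : List (Fin 6) => histEvent ι l ∩ noHit ι T0 U l.length) hz)
  intro ω hω
  obtain ⟨l, hl, h⟩ := exists_hist ι ω p
  refine Set.mem_iUnion.mpr ⟨l, h, ?_⟩
  rw [hl]
  exact hω

/-- **Theorem 3 of the paper.** For any initial triangle (vertices not all equal),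
almost surely the limit set of the abscissas `(X_n)` of the characterizing points
is the whole segment `[0, 1/2]`. -/
theorem limit_set_of_X_is_Icc
    (Ω : Type*) [MeasurableSpace Ω] (P : Measure Ω) [IsProbabilityMeasure P]
    (ι : ℕ → Ω → Fin 6) (hι : IsIIDUniform P ι)
    (T0 : Tri) (hT0 : T0.Nondeg) :
    ∀ᵐ ω ∂P,
      (⋂ p : ℕ, closure {x : ℝ | ∃ n, p ≤ n ∧ charX (triChain ι T0 n ω) = x})
        = Set.Icc (0 : ℝ) (1/2) := by
  have key : ∀ q : ℚ × ℚ, ∀ᵐ ω ∂P,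
      (Set.Icc (0 : ℝ) (1/2) ∩ Set.Ioo (q.1 : ℝ) q.2).Nonempty →
      ∀ p : ℕ, ∃ n, p ≤ n ∧ charX (triChain ι T0 n ω) ∈ Set.Ioo (q.1 : ℝ) q.2 := by
    intro q
    by_cases hq : (Set.Icc (0 : ℝ) (1/2) ∩ Set.Ioo (q.1 : ℝ) q.2).Nonempty
    · obtain ⟨y, hy, hyU⟩ := hq
      obtain ⟨N, hN⟩ := exists_hit_uniform hy isOpen_Ioo hyU
      have h : ∀ᵐ ω ∂P, ∀ p : ℕ, ω ∉ noHit ι T0 (Set.Ioo (q.1 : ℝ) q.2) p :=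
        ae_all_iff.mpr fun p => measure_eq_zero_iff_ae_notMem.mp (noHit_null hι hT0 hN p)
      filter_upwards [h] with ω hω _ p
      have := hω p
      simp only [noHit, Set.mem_setOf_eq] at this
      push Not at this
      exact this
    · exact Filter.Eventually.of_forall fun ω h => absurd h hq
  filter_upwards [ae_all_iff.mpr key] with ω hω
  apply Set.Subset.antisymm
  · intro x hx
    have hx0 := Set.mem_iInter.mp hx 0
    refine closure_minimal ?_ isClosed_Icc hx0
    rintro _ ⟨n, _, rfl⟩
    exact charX_mem _
  · intro y hy
    refine Set.mem_iInter.mpr fun p => Metric.mem_closure_iff.mpr fun ε hε => ?_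
    obtain ⟨a, ha1, ha2⟩ := exists_rat_btwn (show y - ε < y by linarith)
    obtain ⟨b, hb1, hb2⟩ := exists_rat_btwn (show y < y + ε by linarith)
    obtain ⟨n, hn, h1, h2⟩ := hω (a, b) ⟨y, hy, ha2, hb1⟩ p
    refine ⟨_, ⟨n, hn, rfl⟩, ?_⟩
    simp only at h1 h2
    rw [Real.dist_eq, abs_lt]
    constructor <;> linarith


end
end

section
/- For every non-flat triangle T with barycentric subdivision T₁,…,T₆, one has (1/6)·∑_{i=1}^{6} J(T_i) = (4/3)·J(T). Consequently, for the triangle Markov chain, E[J_{n+1} | 𝒯_n] = (4/3)·J_n for every n, where 𝒯_n is the σ-algebra generated by T(0),…,T(n). -/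
open MeasureTheory ProbabilityTheory Filter Set

noncomputable section

variable {Ω : Type*}

/-- The functional `J`: sum of squared edge lengths divided by the area. -/
def Jval (T : Tri) : ℝ := ((e₁ T)^2 + (e₂ T)^2 + (e₃ T)^2) / triArea T

lemma subdiv_area (T : Tri) (i : Fin 6) : triArea (subdiv T i) = triArea T / 6 := by
  have key : ∀ x y : ℝ, (x = y / 6 ∨ x = -(y/6)) → |x| / 2 = |y| / 2 / 6 := by
    rintro x y (h | h) <;> rw [h] <;> simp only [abs_neg, abs_div] <;> norm_num <;> ring
  obtain ⟨⟨a1, a2⟩, ⟨b1, b2⟩, ⟨c1, c2⟩⟩ := T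
  apply key
  left
  fin_cases i <;>
  · simp [subdiv, Tri.A, Tri.B, Tri.C, Complex.div_re, Complex.div_im, Complex.normSq]
    ring

lemma mean_J (T : Tri) :
    (1/6 : ℝ) * ∑ i : Fin 6, Jval (subdiv T i) = (4/3) * Jval T := by
  simp only [Jval, subdiv_area]
  rw [← Finset.sum_div]
  have : ∑ i : Fin 6, (e₁ (subdiv T i)^2 + e₂ (subdiv T i)^2 + e₃ (subdiv T i)^2)
      = (4/3) * (e₁ T^2 + e₂ T^2 + e₃ T^2) := by
    obtain ⟨⟨a1, a2⟩, ⟨b1, b2⟩, ⟨c1, c2⟩⟩ := T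
    simp only [e₁, e₂, e₃, Complex.sq_norm, Fin.sum_univ_six]
    simp [subdiv, Tri.A, Tri.B, Tri.C, Complex.div_re, Complex.div_im, Complex.normSq]
    ring
  rw [this, div_div_eq_mul_div]
  ring

lemma meas_subdiv (i : Fin 6) : Measurable fun T => subdiv T i := by
  fin_cases i <;> simp [subdiv, Tri.A, Tri.B, Tri.C] <;> fun_prop

lemma meas_Jval : Measurable Jval := by
  unfold Jval e₁ e₂ e₃ triArea Tri.A Tri.B Tri.C
  have : Measurable (starRingEnd ℂ) := Complex.continuous_conj.measurable
  fun_prop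

lemma chain_finite (ι : ℕ → Ω → Fin 6) (T0 : Tri) (n : ℕ) :
    (range (triChain ι T0 n)).Finite := by
  induction n with
  | zero => exact (Set.finite_singleton T0).subset (by rintro _ ⟨ω, rfl⟩; rfl)
  | succ n ih =>
    refine (Set.Finite.image2 subdiv ih (Set.finite_univ (α := Fin 6))).subset ?_
    rintro _ ⟨ω, rfl⟩
    exact ⟨_, ⟨ω, rfl⟩, _, mem_univ _, rfl⟩

lemma chain_meas (ι : ℕ → Ω → Fin 6) (T0 : Tri) (m : MeasurableSpace Ω) (n : ℕ)
    (h : ∀ k ≤ n, Measurable[m] (ι k)) : Measurable[m] (triChain ι T0 n) := by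
  induction n with
  | zero => exact measurable_const
  | succ n ih =>
    have hs : Measurable (fun p : Tri × Fin 6 => subdiv p.1 p.2) :=
      measurable_from_prod_countable_left meas_subdiv
    exact hs.comp ((ih fun k hk => h k (by omega)).prodMk (h (n+1) le_rfl))

/-- Main probabilistic step: pulling out the `𝒯_n`-measurable part. -/
lemma condExp_step [mΩ : MeasurableSpace Ω] (P : Measure Ω) [IsProbabilityMeasure P]
    (ι : ℕ → Ω → Fin 6) (hι : IsIIDUniform P ι) (T0 : Tri) (n : ℕ) :
    P[(fun ω => Jval (triChain ι T0 (n+1) ω)) |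
            ⨆ k : Fin (n+1), MeasurableSpace.comap (triChain ι T0 k) inferInstance]
          =ᵐ[P] fun ω => (4/3) * Jval (triChain ι T0 n ω) := by
  obtain ⟨hm, hind, hunif⟩ := hι
  set m : MeasurableSpace Ω :=
    ⨆ k : Fin (n+1), MeasurableSpace.comap (triChain ι T0 k) inferInstance with hmdef
  have hle : m ≤ mΩ := iSup_le fun k =>
    (chain_meas ι T0 mΩ k fun j _ => hm j).comap_le
  have hle' : m ≤ ⨆ j ∈ Set.Iic n, MeasurableSpace.comap (ι j) inferInstance := by
    refine iSup_le fun k => Measurable.comap_le ?_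
    refine chain_meas ι T0 _ k fun j hj => ?_
    have hjn : j ∈ Set.Iic n := by
      have := k.2
      simp only [Set.mem_Iic]
      omega
    exact measurable_iff_comap_le.2
      (le_iSup₂_of_le (f := fun j (_ : j ∈ Set.Iic n) =>
        MeasurableSpace.comap (ι j) inferInstance) j hjn le_rfl)
  have hindep : Indep (MeasurableSpace.comap (ι (n+1)) inferInstance) m P := by
    have h1 := indep_iSup_of_disjoint (m := fun j => MeasurableSpace.comap (ι j) inferInstance)
      (fun j => (hm j).comap_le) hind.iIndep (S := {n+1}) (T := Set.Iic n) (by simp)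
    simp only [Set.mem_singleton_iff, iSup_iSup_eq_left] at h1
    exact indep_of_indep_of_le_right h1 hle'
  have hTm : Measurable[m] (triChain ι T0 n) :=
    measurable_iff_comap_le.2 (le_iSup_of_le (f := fun k : Fin (n+1) =>
      MeasurableSpace.comap (triChain ι T0 k) inferInstance) ⟨n, by omega⟩ le_rfl)
  let f : Fin 6 → Ω → ℝ := fun i ω => Jval (subdiv (triChain ι T0 n ω) i)
  let g : Fin 6 → Ω → ℝ := fun i => (ι (n+1) ⁻¹' {i}).indicator (fun _ => (1:ℝ))
  have hdec : (fun ω => Jval (triChain ι T0 (n+1) ω)) = ∑ i, f i * g i := by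
    funext ω
    rw [Finset.sum_apply, Finset.sum_eq_single (ι (n+1) ω)]
    · simp [f, g, triChain]
    · intro i _ hi
      have : ω ∉ ι (n+1) ⁻¹' {i} := fun h => hi (by simpa using h.symm)
      simp only [g, Pi.mul_apply, Set.indicator_of_notMem this, mul_zero]
    · simp
  have hfm : ∀ i, StronglyMeasurable[m] (f i) := fun i =>
    ((meas_Jval.comp (meas_subdiv i)).comp hTm).stronglyMeasurable
  have hset : ∀ i, MeasurableSet[mΩ] (ι (n+1) ⁻¹' {i}) := fun i => hm _ (measurableSet_singleton i)
  have hg : ∀ i, Integrable (g i) P := fun i => (integrable_const (1:ℝ)).indicator (hset i)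
  have hb : ∀ i, ∃ c, ∀ ω, ‖f i ω‖ ≤ c := fun i => by
    obtain ⟨c, hc⟩ := ((chain_finite ι T0 n).image fun T => ‖Jval (subdiv T i)‖).bddAbove
    exact ⟨c, fun ω => hc ⟨_, ⟨ω, rfl⟩, rfl⟩⟩
  have hfg : ∀ i, Integrable (f i * g i) P := fun i => by
    obtain ⟨c, hc⟩ := hb i
    exact (hg i).bdd_mul ((hfm i).mono hle).aestronglyMeasurable (ae_of_all _ hc)
  have hce : ∀ i, P[f i * g i | m] =ᵐ[P] fun ω => f i ω * (1/6) := fun i => by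
    have h1 := condExp_mul_of_stronglyMeasurable_left (hfm i) (hfg i) (hg i)
    have h2 : P[g i | m] =ᵐ[P] fun _ => P[g i] :=
      condExp_indep_eq (hm (n+1)).comap_le hle
        (stronglyMeasurable_const.indicator ⟨{i}, measurableSet_singleton i, rfl⟩) hindep
    have h3 : P[g i] = 1/6 := by
      have h4 : P (ι (n+1) ⁻¹' {i}) = 1/6 := hunif (n+1) i
      simp only [g]
      rw [integral_indicator (hset i)]
      simp [Measure.real, h4]
    filter_upwards [h1, h2] with ω h1 h2
    rw [h1, Pi.mul_apply, h2, h3]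
  rw [hdec]
  have hall := ae_all_iff.2 hce
  filter_upwards [condExp_finset_sum (s := Finset.univ) (fun i _ => hfg i) m, hall] with ω h1 h2
  rw [h1, Finset.sum_apply, Finset.sum_congr rfl fun i _ => h2 i, ← Finset.sum_mul, mul_comm]
  exact mean_J _

/-- **Lemma (submartingale identity).** For any non-flat triangle, the mean of `J` over
the six triangles of the barycentric subdivision is `(4/3)·J(T)`; consequently, for the
triangle Markov chain, `E[J_{n+1} | 𝒯_n] = (4/3)·J_n`, where `𝒯_n` is the σ-algebra
generated by `T(0), …, T(n)`. -/
theorem J_subdivision_mean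
    (Ω : Type*) [MeasurableSpace Ω] (P : Measure Ω) [IsProbabilityMeasure P]
    (ι : ℕ → Ω → Fin 6) (hι : IsIIDUniform P ι)
    (T0 : Tri) (hT0 : T0.Nonflat) :
    (∀ T : Tri, T.Nonflat →
        (1/6 : ℝ) * ∑ i : Fin 6, Jval (subdiv T i) = (4/3) * Jval T) ∧
    (∀ n : ℕ,
        P[(fun ω => Jval (triChain ι T0 (n+1) ω)) |
            ⨆ k : Fin (n+1), MeasurableSpace.comap (triChain ι T0 k) inferInstance]
          =ᵐ[P] fun ω => (4/3) * Jval (triChain ι T0 n ω)) := by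
  exact ⟨fun T _ => mean_J T, fun n => condExp_step P ι hι T0 n⟩

end
end

section
/- For every non-flat initial triangle T(0), almost surely limsup_{n→∞} J_n = +∞. -/
open MeasureTheory ProbabilityTheory Filter Set

noncomputable section

variable {Ω : Type*}

lemma subdiv_zero_e₁ (T : Tri) : e₁ (subdiv T 0) = e₁ T / 2 := by
  have h : T.A - (T.A + T.B) / 2 = (T.A - T.B) / 2 := by ring
  show ‖T.A - (T.A + T.B) / 2‖ = _
  rw [h, norm_div]
  simp [e₁]

lemma area_le (T : Tri) : 2 * triArea T ≤ e₁ T * e₃ T := by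
  unfold triArea e₁ e₃
  have h := Complex.abs_im_le_norm ((T.B - T.A) * (starRingEnd ℂ (T.C - T.A)))
  rw [norm_mul, RCLike.norm_conj, norm_sub_rev T.B T.A] at h
  linarith

lemma block_area {Ω : Type*} (ι : ℕ → Ω → Fin 6) (T0 : Tri) (ω : Ω) (n : ℕ) :
    triArea (triChain ι T0 n ω) = triArea T0 / 6 ^ n := by
  induction n with
  | zero => simp [triChain]
  | succ n ih => rw [triChain, subdiv_area, ih, pow_succ]; field_simp

lemma block_e₁ {Ω : Type*} (ι : ℕ → Ω → Fin 6) (T0 : Tri) (ω : Ω) (n k : ℕ)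
    (h : ∀ j < k, ι (n + j + 1) ω = 0) :
    e₁ (triChain ι T0 (n + k) ω) = e₁ (triChain ι T0 n ω) / 2 ^ k := by
  induction k with
  | zero => simp
  | succ k ih =>
    rw [← add_assoc, triChain]
    beta_reduce
    rw [h k (by lia), subdiv_zero_e₁,
      ih (fun j hj => h j (by lia)), pow_succ]
    field_simp

lemma block_J {Ω : Type*} (ι : ℕ → Ω → Fin 6) (T0 : Tri) (hT0 : T0.Nonflat) (ω : Ω) (n k : ℕ)
    (M : ℝ) (hM : 0 < M) (hk : M ^ 2 < 4 * (3 / 2 : ℝ) ^ k)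
    (h : ∀ j < k, ι (n + j + 1) ω = 0) :
    M < Jval (triChain ι T0 n ω) ∨ M < Jval (triChain ι T0 (n + k) ω) := by
  by_contra! hc
  obtain ⟨h1, h2⟩ := hc
  have ha0 : 0 < triArea T0 := by
    unfold triArea
    have : 0 < |((T0.B - T0.A) * (starRingEnd ℂ (T0.C - T0.A))).im| := abs_pos.mpr hT0
    linarith
  have he := block_e₁ ι T0 ω n k h
  have hak : triArea (triChain ι T0 (n + k) ω) = triArea (triChain ι T0 n ω) / 6 ^ k := by
    rw [block_area, block_area, pow_add]; field_simp
  have ha : 0 < triArea (triChain ι T0 n ω) := by rw [block_area]; positivity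
  have hle := area_le (triChain ι T0 n ω)
  have hx0 : 0 ≤ e₁ (triChain ι T0 n ω) := norm_nonneg _
  have hz0 : 0 ≤ e₃ (triChain ι T0 n ω) := norm_nonneg _
  unfold Jval at h1 h2
  rw [hak, he, div_le_iff₀ (by positivity)] at h2
  rw [div_le_iff₀ ha] at h1
  generalize triArea (triChain ι T0 n ω) = a at *
  generalize e₁ (triChain ι T0 n ω) = x at *
  generalize e₂ (triChain ι T0 n ω) = y at *
  generalize e₃ (triChain ι T0 n ω) = z at *
  have hz : z ^ 2 ≤ M * a := by nlinarith [sq_nonneg x, sq_nonneg y]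
  have hx : (x / 2 ^ k) ^ 2 ≤ M * (a / 6 ^ k) := by
    nlinarith [sq_nonneg (e₂ (triChain ι T0 (n + k) ω)), sq_nonneg (e₃ (triChain ι T0 (n + k) ω))]
  have hx' : x ^ 2 * (3 / 2 : ℝ) ^ k ≤ M * a := by
    have e6 : (6 : ℝ) ^ k = (3 / 2) ^ k * (2 ^ k) ^ 2 := by
      rw [← pow_mul, mul_comm k 2, pow_mul, ← mul_pow]; norm_num
    rw [e6, div_pow, ← mul_div_assoc, div_le_div_iff₀ (by positivity) (by positivity)] at hx
    have hp : (0 : ℝ) < (2 ^ k) ^ 2 := by positivity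
    nlinarith
  have h4 : 4 * a ^ 2 ≤ x ^ 2 * z ^ 2 := by nlinarith
  have hp : (0 : ℝ) < (3 / 2) ^ k := by positivity
  have h5 : (x ^ 2 * (3 / 2 : ℝ) ^ k) * z ^ 2 ≤ (M * a) * (M * a) :=
    mul_le_mul hx' hz (by positivity) (by positivity)
  have h6 : 4 * a ^ 2 * (3 / 2 : ℝ) ^ k ≤ x ^ 2 * z ^ 2 * (3 / 2 : ℝ) ^ k := by gcongr
  have h7 : M ^ 2 * a ^ 2 < 4 * (3 / 2 : ℝ) ^ k * a ^ 2 := by gcongr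
  nlinarith

lemma block_often {Ω : Type*} [MeasurableSpace Ω] (P : Measure Ω) [IsProbabilityMeasure P]
    (ι : ℕ → Ω → Fin 6) (hι : IsIIDUniform P ι) (k : ℕ) :
    ∀ᵐ ω ∂P, ∃ᶠ m in atTop, ∀ j < k, ι (m * k + j + 1) ω = 0 := by
  obtain ⟨hm, hind, hu⟩ := hι
  set I : ℕ → Finset ℕ := fun m => (Finset.range k).image (fun j => m * k + j + 1) with hI
  set E : ℕ → Set Ω := fun m => ⋂ i ∈ I m, ι i ⁻¹' {0} with hE
  have hprod : ∀ s : Finset ℕ, P (⋂ i ∈ s, ι i ⁻¹' {0}) = ∏ i ∈ s, P (ι i ⁻¹' {0}) := fun s =>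
    hind.measure_inter_preimage_eq_mul s (fun _ _ => measurableSet_singleton _)
  have h6 : ∀ i, P (ι i ⁻¹' {0}) = 1 / 6 := fun i => hu i 0
  have hEm : ∀ m, MeasurableSet (E m) := fun m =>
    Finset.measurableSet_biInter _ (fun i _ => hm i (measurableSet_singleton _))
  have hEP : ∀ m, P (E m) = (1 / 6) ^ k := by
    intro m
    rw [hE, hprod]
    simp only [h6, Finset.prod_const, hI]
    rw [Finset.card_image_of_injective _ (fun a b h => by simpa using h), Finset.card_range]
  have hdisj : ∀ m m', m ≠ m' → Disjoint (I m) (I m') := by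
    intro m m' hne
    rw [Finset.disjoint_left]
    intro a h1 h2
    simp only [hI, Finset.mem_image, Finset.mem_range] at h1 h2
    obtain ⟨j, hj, rfl⟩ := h1
    obtain ⟨j', hj', he⟩ := h2
    apply hne
    rcases lt_trichotomy m m' with hl | hl | hl
    · have := Nat.mul_le_mul_right k (Nat.succ_le_of_lt hl)
      rw [Nat.succ_mul] at this
      lia
    · exact hl
    · have := Nat.mul_le_mul_right k (Nat.succ_le_of_lt hl)
      rw [Nat.succ_mul] at this
      lia
  have hEind : iIndepSet E P := by
    rw [iIndepSet_iff_meas_biInter hEm]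
    intro s
    have : (⋂ m ∈ s, E m) = ⋂ i ∈ s.biUnion I, ι i ⁻¹' {0} := by
      rw [Finset.set_biInter_biUnion]
    rw [this, hprod, Finset.prod_biUnion (fun a _ b _ hab => hdisj a b hab)]
    exact Finset.prod_congr rfl (fun m _ => (hprod _).symm)
  have hsum : ∑' m, P (E m) = ⊤ := by
    simp only [hEP]
    exact ENNReal.tsum_const_eq_top_of_ne_zero (by simp)
  have h1 := measure_limsup_eq_one hEm hEind hsum
  have h2 : ∀ᵐ ω ∂P, ω ∈ limsup E atTop := by
    rw [← prob_compl_eq_zero_iff (MeasurableSet.measurableSet_limsup hEm)] at h1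
    exact h1
  filter_upwards [h2] with ω hω
  rw [mem_limsup_iff_frequently_mem] at hω
  refine hω.mono (fun m hmE j hj => ?_)
  simp only [hE, hI, Set.mem_iInter] at hmE
  exact hmE _ (Finset.mem_image_of_mem _ (Finset.mem_range.mpr hj))

/-- **Proposition (divergence of `J`).** For any non-flat initial triangle, almost surely
`limsup J_n = +∞`. -/
theorem limsup_J_eq_top
    (Ω : Type*) [MeasurableSpace Ω] (P : Measure Ω) [IsProbabilityMeasure P]
    (ι : ℕ → Ω → Fin 6) (hι : IsIIDUniform P ι)
    (T0 : Tri) (hT0 : T0.Nonflat) :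
    ∀ᵐ ω ∂P,
      Filter.limsup (fun n : ℕ => (Jval (triChain ι T0 n ω) : EReal)) atTop = ⊤ := by
  have hall : ∀ᵐ ω ∂P, ∀ k, ∃ᶠ m in atTop, ∀ j < k, ι (m * k + j + 1) ω = 0 :=
    ae_all_iff.mpr (block_often P ι hι)
  filter_upwards [hall] with ω hω
  rw [EReal.eq_top_iff_forall_lt]
  intro y
  set M : ℝ := |y| + 1 with hMdef
  have hyM : y < M := by have := le_abs_self y; linarith
  have hM : 0 < M := by positivity
  obtain ⟨k, hk⟩ := pow_unbounded_of_one_lt (M ^ 2) (show (1 : ℝ) < 3 / 2 by norm_num)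
  have hk1 : M ^ 2 < 4 * (3 / 2 : ℝ) ^ (k + 1) := by
    have hp : (0 : ℝ) < (3 / 2) ^ k := by positivity
    rw [pow_succ (3 / 2 : ℝ)]; linarith
  have hfr : ∃ᶠ n in atTop, ((M : ℝ) : EReal) ≤ (Jval (triChain ι T0 n ω) : EReal) := by
    rw [frequently_atTop]
    intro N
    obtain ⟨m, hmN, hm⟩ := (frequently_atTop.mp (hω (k + 1))) N
    have hNm : N ≤ m * (k + 1) := hmN.trans (Nat.le_mul_of_pos_right m (Nat.succ_pos k))
    rcases block_J ι T0 hT0 ω (m * (k + 1)) (k + 1) M hM hk1 hm with h | h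
    · exact ⟨_, hNm, EReal.coe_le_coe_iff.mpr h.le⟩
    · exact ⟨_, hNm.trans (Nat.le_add_right _ _), EReal.coe_le_coe_iff.mpr h.le⟩
  exact lt_of_lt_of_le (EReal.coe_lt_coe_iff.mpr hyM) (le_limsup_of_frequently_le hfr)

end
end

section
/- There exist constants 0 < a < b < ∞ such that for every non-flat triangle T and every i ∈ {1,…,6}, a·J(T) ≤ J(T_i) ≤ b·J(T), where T₁,…,T₆ are the triangles of the barycentric subdivision of T. -/
open MeasureTheory ProbabilityTheory Filter Set

noncomputable section

variable {Ω : Type*}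

theorem aux_comparable (T T' : Tri) (hT : 0 < triArea T) (hA : triArea T' = triArea T / 6)
    (h1 : ((e₁ T)^2 + (e₂ T)^2 + (e₃ T)^2) / 60 ≤ (e₁ T')^2 + (e₂ T')^2 + (e₃ T')^2)
    (h2 : (e₁ T')^2 + (e₂ T')^2 + (e₃ T')^2 ≤ 10 * ((e₁ T)^2 + (e₂ T)^2 + (e₃ T)^2)) :
    (1/10) * Jval T ≤ Jval T' ∧ Jval T' ≤ 60 * Jval T := by
  unfold Jval
  rw [hA, ← mul_div_assoc, ← mul_div_assoc]
  constructor
  · rw [div_le_div_iff₀ hT (by positivity)]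
    nlinarith
  · rw [div_le_div_iff₀ (by positivity) hT]
    nlinarith

theorem sq_edges (a b c : ℂ) : (e₁ (a, b, c))^2 + (e₂ (a, b, c))^2 + (e₃ (a, b, c))^2 =
    ((a.re - b.re)^2 + (a.im - b.im)^2) + ((b.re - c.re)^2 + (b.im - c.im)^2)
      + ((c.re - a.re)^2 + (c.im - a.im)^2) := by
  simp only [e₁, e₂, e₃, Tri.A, Tri.B, Tri.C, Complex.sq_norm, Complex.normSq_apply,
    Complex.sub_re, Complex.sub_im]
  ring

theorem area_eq (a b c : ℂ) : triArea (a, b, c) =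
    |(b.im - a.im) * (c.re - a.re) - (b.re - a.re) * (c.im - a.im)| / 2 := by
  simp only [triArea, Tri.A, Tri.B, Tri.C]
  congr 2
  simp only [Complex.mul_im, Complex.conj_re, Complex.conj_im, Complex.sub_re, Complex.sub_im]
  ring

/-- Scalar quadratic bounds, applied to the real and imaginary parts. -/
theorem quad_bounds (a b c : ℝ) :
    ((a - b)^2 + (b - c)^2 + (c - a)^2) / 60 ≤
      (a - (a + b)/2)^2 + ((a + b)/2 - (a + b + c)/3)^2 + ((a + b + c)/3 - a)^2 ∧
    (a - (a + b)/2)^2 + ((a + b)/2 - (a + b + c)/3)^2 + ((a + b + c)/3 - a)^2 ≤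
      10 * ((a - b)^2 + (b - c)^2 + (c - a)^2) := by
  constructor
  · nlinarith [sq_nonneg ((a - b) + (a - c)), sq_nonneg (a - b), sq_nonneg (a - c),
      sq_nonneg (2 * c - a - b)]
  · nlinarith [sq_nonneg ((a - b) + (a - c)), sq_nonneg (a - b), sq_nonneg (a - c),
      sq_nonneg (b - c), sq_nonneg (2 * c - a - b)]

/-- **Lemma (comparability of `J` along one subdivision step).** There are constants
`0 < a < b < ∞` such that `a·J(T) ≤ J(T_i) ≤ b·J(T)` for every non-flat triangle `T`
and each of the six triangles `T_i` of its barycentric subdivision. -/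
theorem J_comparable_after_subdivision :
    ∃ a b : ℝ, 0 < a ∧ a < b ∧
      ∀ T : Tri, T.Nonflat → ∀ i : Fin 6,
        a * Jval T ≤ Jval (subdiv T i) ∧ Jval (subdiv T i) ≤ b * Jval T := by
  refine ⟨1/10, 60, by norm_num, by norm_num, ?_⟩
  rintro ⟨a, b, c⟩ hT i
  have hpos : 0 < triArea (a, b, c) := by
    unfold triArea
    have := abs_pos.mpr hT
    positivity
  have h2r : ∀ z : ℂ, (z / 2).re = z.re / 2 := fun z => Complex.div_ofNat_re z 2
  have h2i : ∀ z : ℂ, (z / 2).im = z.im / 2 := fun z => Complex.div_ofNat_im z 2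
  have h3r : ∀ z : ℂ, (z / 3).re = z.re / 3 := fun z => Complex.div_ofNat_re z 3
  have h3i : ∀ z : ℂ, (z / 3).im = z.im / 3 := fun z => Complex.div_ofNat_im z 3
  have key : ∀ k : ℝ, |k / 6| / 2 = |k| / 2 / 6 := by
    intro k
    rw [abs_div, abs_of_pos (by norm_num : (0:ℝ) < 6)]
    ring
  have q1 := quad_bounds a.re b.re c.re
  have q1' := quad_bounds a.im b.im c.im
  have q2 := quad_bounds b.re a.re c.re
  have q2' := quad_bounds b.im a.im c.im
  have q3 := quad_bounds b.re c.re a.re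
  have q3' := quad_bounds b.im c.im a.im
  have q4 := quad_bounds c.re b.re a.re
  have q4' := quad_bounds c.im b.im a.im
  have q5 := quad_bounds c.re a.re b.re
  have q5' := quad_bounds c.im a.im b.im
  have q6 := quad_bounds a.re c.re b.re
  have q6' := quad_bounds a.im c.im b.im
  apply aux_comparable _ _ hpos <;> fin_cases i <;>
    simp only [subdiv, Tri.A, Tri.B, Tri.C, Fin.reduceFinMk, Fin.zero_eta, Fin.mk_one,
      Matrix.cons_val, Matrix.cons_val_zero, Matrix.cons_val_one, sq_edges, area_eq,
      h2r, h2i, h3r, h3i, Complex.add_re, Complex.add_im]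
  any_goals
    rw [← key]
    congr 2
    ring
  · linarith [q1.1, q1'.1]
  · linarith [q2.1, q2'.1]
  · linarith [q3.1, q3'.1]
  · linarith [q4.1, q4'.1]
  · linarith [q5.1, q5'.1]
  · linarith [q6.1, q6'.1]
  · linarith [q1.2, q1'.2]
  · linarith [q2.2, q2'.2]
  · linarith [q3.2, q3'.2]
  · linarith [q4.2, q4'.2]
  · linarith [q5.2, q5'.2]
  · linarith [q6.2, q6'.2]

end
end

section
/- There exist constants γ > 0 and ε > 0 such that for every non-flat triangle T whose characterizing point (x,y) satisfies y < ε, one has (1/36)·∑_{i,j=1}^{6} ln( I(T_{i,j}) / I(T) ) ≥ γ, where T₁,…,T₆ are the triangles of the barycentric subdivision of T and T_{i,j} is the j-th triangle of the barycentric subdivision of T_i. -/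
open MeasureTheory ProbabilityTheory Filter Set

noncomputable section

variable {Ω : Type*}

/-- Perimeter of a triangle. -/
def perim (T : Tri) : ℝ := e₁ T + e₂ T + e₃ T

/-- The isoperimetric value: squared perimeter divided by the area. -/
def Ival (T : Tri) : ℝ := (perim T)^2 / triArea T

namespace LogGain

def w (a b c : ℝ) : ℝ := max |a - b| (max |b - c| |c - a|)

def W (a b c : ℝ) : ℝ :=
  w a ((a+b)/2) ((a+b+c)/3) * w ((a+b)/2) b ((a+b+c)/3) * w b ((b+c)/2) ((a+b+c)/3)
  * w ((b+c)/2) c ((a+b+c)/3) * w c ((c+a)/2) ((a+b+c)/3) * w ((c+a)/2) a ((a+b+c)/3)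

def V (a b c : ℝ) : ℝ :=
  W a ((a+b)/2) ((a+b+c)/3) * W ((a+b)/2) b ((a+b+c)/3) * W b ((b+c)/2) ((a+b+c)/3)
  * W ((b+c)/2) c ((a+b+c)/3) * W c ((c+a)/2) ((a+b+c)/3) * W ((c+a)/2) a ((a+b+c)/3)

lemma w_nonneg (a b c : ℝ) : 0 ≤ w a b c := le_max_of_le_left (abs_nonneg _)

lemma w_swap12 (a b c : ℝ) : w b a c = w a b c := by
  unfold w
  rw [abs_sub_comm b a, abs_sub_comm a c, abs_sub_comm c b, max_comm |c - a|]

lemma w_swap23 (a b c : ℝ) : w a c b = w a b c := by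
  unfold w
  rw [abs_sub_comm a c, abs_sub_comm c b, abs_sub_comm b a, max_comm |b - c|, max_left_comm,
    max_comm |c - a|, max_comm |b - c|]

lemma w_neg (a b c : ℝ) : w (-a) (-b) (-c) = w a b c := by
  unfold w
  rw [← abs_neg (-a - -b), ← abs_neg (-b - -c), ← abs_neg (-c - -a)]
  congr 2 <;> (try congr 1) <;> ring_nf

lemma w12 (a b c : ℝ) : |a - b| ≤ w a b c := le_max_left _ _
lemma w23 (a b c : ℝ) : |b - c| ≤ w a b c := le_max_of_le_right (le_max_left _ _)
lemma w31 (a b c : ℝ) : |c - a| ≤ w a b c := le_max_of_le_right (le_max_right _ _)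

lemma w_sorted {p q r : ℝ} (h1 : p ≤ q) (h2 : q ≤ r) : w p q r = r - p := by
  apply le_antisymm
  · refine max_le ?_ (max_le ?_ ?_) <;> rw [abs_le] <;> constructor <;> linarith
  · exact le_trans (le_abs_self _) (w31 _ _ _)

lemma W_nonneg (a b c : ℝ) : 0 ≤ W a b c := by
  unfold W
  have := w_nonneg
  repeat' apply mul_nonneg
  all_goals apply w_nonneg

/-- generic symmetry of the six-fold product -/
lemma prod_swap12 (f : ℝ → ℝ → ℝ → ℝ) (h12 : ∀ a b c, f b a c = f a b c) (a b c : ℝ) :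
    f b ((b+a)/2) ((b+a+c)/3) * f ((b+a)/2) a ((b+a+c)/3) * f a ((a+c)/2) ((b+a+c)/3)
  * f ((a+c)/2) c ((b+a+c)/3) * f c ((c+b)/2) ((b+a+c)/3) * f ((c+b)/2) b ((b+a+c)/3)
  = f a ((a+b)/2) ((a+b+c)/3) * f ((a+b)/2) b ((a+b+c)/3) * f b ((b+c)/2) ((a+b+c)/3)
  * f ((b+c)/2) c ((a+b+c)/3) * f c ((c+a)/2) ((a+b+c)/3) * f ((c+a)/2) a ((a+b+c)/3) := by
  rw [add_comm b a, add_comm c b, add_comm a c]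
  rw [h12 ((a+b)/2) b, h12 a ((a+b)/2), h12 ((c+a)/2) a, h12 c ((c+a)/2), h12 ((b+c)/2) c,
    h12 b ((b+c)/2)]
  ring

lemma prod_swap23 (f : ℝ → ℝ → ℝ → ℝ) (h12 : ∀ a b c, f b a c = f a b c) (a b c : ℝ) :
    f a ((a+c)/2) ((a+c+b)/3) * f ((a+c)/2) c ((a+c+b)/3) * f c ((c+b)/2) ((a+c+b)/3)
  * f ((c+b)/2) b ((a+c+b)/3) * f b ((b+a)/2) ((a+c+b)/3) * f ((b+a)/2) a ((a+c+b)/3)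
  = f a ((a+b)/2) ((a+b+c)/3) * f ((a+b)/2) b ((a+b+c)/3) * f b ((b+c)/2) ((a+b+c)/3)
  * f ((b+c)/2) c ((a+b+c)/3) * f c ((c+a)/2) ((a+b+c)/3) * f ((c+a)/2) a ((a+b+c)/3) := by
  rw [add_right_comm a c b, add_comm b a, add_comm c b, add_comm a c]
  rw [h12 ((a+b)/2) b, h12 a ((a+b)/2), h12 ((c+a)/2) a, h12 c ((c+a)/2), h12 ((b+c)/2) c,
    h12 b ((b+c)/2)]
  ring

lemma prod_neg (f : ℝ → ℝ → ℝ → ℝ) (hn : ∀ a b c, f (-a) (-b) (-c) = f a b c) (a b c : ℝ) :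
    f (-a) ((-a+-b)/2) ((-a+-b+-c)/3) * f ((-a+-b)/2) (-b) ((-a+-b+-c)/3)
  * f (-b) ((-b+-c)/2) ((-a+-b+-c)/3)
  * f ((-b+-c)/2) (-c) ((-a+-b+-c)/3) * f (-c) ((-c+-a)/2) ((-a+-b+-c)/3)
  * f ((-c+-a)/2) (-a) ((-a+-b+-c)/3)
  = f a ((a+b)/2) ((a+b+c)/3) * f ((a+b)/2) b ((a+b+c)/3) * f b ((b+c)/2) ((a+b+c)/3)
  * f ((b+c)/2) c ((a+b+c)/3) * f c ((c+a)/2) ((a+b+c)/3) * f ((c+a)/2) a ((a+b+c)/3) := by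
  rw [show (-a+-b)/2 = -((a+b)/2) by ring, show (-a+-b+-c)/3 = -((a+b+c)/3) by ring,
    show (-b+-c)/2 = -((b+c)/2) by ring, show (-c+-a)/2 = -((c+a)/2) by ring]
  simp only [hn]

lemma W_swap12 (a b c : ℝ) : W b a c = W a b c := prod_swap12 w w_swap12 a b c
lemma W_swap23 (a b c : ℝ) : W a c b = W a b c := prod_swap23 w w_swap12 a b c
lemma W_neg (a b c : ℝ) : W (-a) (-b) (-c) = W a b c := prod_neg w w_neg a b c
lemma V_swap12 (a b c : ℝ) : V b a c = V a b c := prod_swap12 W W_swap12 a b c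
lemma V_swap23 (a b c : ℝ) : V a c b = V a b c := prod_swap23 W W_swap12 a b c
lemma V_neg (a b c : ℝ) : V (-a) (-b) (-c) = V a b c := prod_neg W W_neg a b c

lemma sym_ind {P : ℝ → ℝ → ℝ → Prop} (s12 : ∀ a b c, P a b c → P b a c)
    (s23 : ∀ a b c, P a b c → P a c b) (sn : ∀ a b c, P (-a) (-b) (-c) → P a b c)
    (core : ∀ p q r, p ≤ q → q ≤ r → q - p ≤ r - q → P p q r) (a b c : ℝ) : P a b c := by
  have sorted : ∀ p q r, p ≤ q → q ≤ r → P p q r := by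
    intro p q r h1 h2
    rcases le_total (q - p) (r - q) with h | h
    · exact core p q r h1 h2 h
    · apply sn
      apply s12; apply s23; apply s12
      apply core <;> linarith
  rcases le_total a b with h1 | h1 <;> rcases le_total b c with h2 | h2 <;>
    rcases le_total a c with h3 | h3
  · exact sorted _ _ _ h1 h2
  · exact sorted _ _ _ h1 h2
  · exact s23 _ _ _ (sorted _ _ _ h3 h2)
  · exact s23 _ _ _ (s12 _ _ _ (sorted _ _ _ h3 h1))
  · exact s12 _ _ _ (sorted _ _ _ h1 h3)
  · exact s12 _ _ _ (s23 _ _ _ (sorted _ _ _ h2 h3))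
  · exact s12 _ _ _ (s23 _ _ _ (s12 _ _ _ (sorted _ _ _ h2 h1)))
  · exact s12 _ _ _ (s23 _ _ _ (s12 _ _ _ (sorted _ _ _ h2 h1)))

def F (t : ℝ) : ℝ := (1 + t) * (1 - t) * (2 - t)^3 / 648

lemma F_nonneg {t : ℝ} (h0 : 0 ≤ t) (h1 : t ≤ 1/2) : 0 ≤ F t := by
  unfold F
  have : 0 ≤ 1 - t := by linarith
  have : 0 ≤ 2 - t := by linarith
  positivity

lemma W_core {p q r t : ℝ} (ht1 : t ≤ 1/2) (h1 : p ≤ q) (h2 : q ≤ r)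
    (h3 : q - p ≤ r - q) (h4 : q - p ≤ t * (r - p)) (ht0 : 0 ≤ t) :
    F t * (r - p)^6 ≤ W p q r := by
  obtain ⟨u, rfl⟩ : ∃ u, q = p + u := ⟨q - p, by ring⟩
  obtain ⟨d, rfl⟩ : ∃ d, r = p + d := ⟨r - p, by ring⟩
  have hu : 0 ≤ u := by linarith
  have hd : 0 ≤ d := by linarith
  have hud : 2 * u ≤ d := by linarith
  have h4' : u ≤ t * d := by linarith
  have a1 : (d + u)/3 ≤ w p ((p+(p+u))/2) ((p+(p+u)+(p+d))/3) :=
    le_trans (by rw [le_abs]; left; linarith) (w31 _ _ _)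
  have a2 : (2*d - u)/6 ≤ w ((p+(p+u))/2) (p+u) ((p+(p+u)+(p+d))/3) :=
    le_trans (by rw [le_abs]; left; linarith) (w31 _ _ _)
  have a3 : (d - u)/2 ≤ w (p+u) (((p+u)+(p+d))/2) ((p+(p+u)+(p+d))/3) :=
    le_trans (by rw [le_abs]; right; linarith) (w12 _ _ _)
  have a4 : (2*d - u)/3 ≤ w (((p+u)+(p+d))/2) (p+d) ((p+(p+u)+(p+d))/3) :=
    le_trans (by rw [le_abs]; left; linarith) (w23 _ _ _)
  have a5 : (2*d - u)/3 ≤ w (p+d) (((p+d)+p)/2) ((p+(p+u)+(p+d))/3) :=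
    le_trans (by rw [le_abs]; right; linarith) (w31 _ _ _)
  have a6 : d/2 ≤ w (((p+d)+p)/2) p ((p+(p+u)+(p+d))/3) :=
    le_trans (by rw [le_abs]; left; linarith) (w12 _ _ _)
  have b0 : 0 ≤ d - u := by linarith
  have b1 : 0 ≤ 2*d - u := by linarith
  have c1 : 0 ≤ 1 - t := by linarith
  have c2 : 0 ≤ 2 - t := by linarith
  have key : (d + u)/3 * ((2*d - u)/6) * ((d - u)/2) * ((2*d - u)/3) * ((2*d - u)/3) * (d/2)
      ≤ W p (p+u) (p+d) := by
    unfold W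
    have := w_nonneg
    have n1 := w_nonneg p ((p+(p+u))/2) ((p+(p+u)+(p+d))/3)
    have n2 := w_nonneg ((p+(p+u))/2) (p+u) ((p+(p+u)+(p+d))/3)
    have n3 := w_nonneg (p+u) (((p+u)+(p+d))/2) ((p+(p+u)+(p+d))/3)
    have n4 := w_nonneg (((p+u)+(p+d))/2) (p+d) ((p+(p+u)+(p+d))/3)
    have n5 := w_nonneg (p+d) (((p+d)+p)/2) ((p+(p+u)+(p+d))/3)
    gcongr
  refine le_trans ?_ key
  have e1 : ((1 + t) * (1 - t)) * d^2 ≤ (d+u)*(d-u) := by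
    nlinarith [mul_self_le_mul_self hu h4']
  have e2 : (2 - t) * d ≤ 2*d - u := by linarith
  calc F t * (p + d - p)^6 = (((1 + t) * (1 - t)) * d^2) * ((2 - t) * d)^3 * d / 648 := by
        unfold F; ring
    _ ≤ ((d+u)*(d-u)) * (2*d-u)^3 * d / 648 := by gcongr
    _ = _ := by ring

lemma W_ge {t : ℝ} (ht0 : 0 ≤ t) (ht1 : t ≤ 1/2) (a b c : ℝ) :
    (|a - b| ≤ t * w a b c ∨ |b - c| ≤ t * w a b c ∨ |c - a| ≤ t * w a b c) →
    F t * (w a b c)^6 ≤ W a b c := by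
  refine sym_ind (P := fun a b c => (|a - b| ≤ t * w a b c ∨ |b - c| ≤ t * w a b c ∨
    |c - a| ≤ t * w a b c) → F t * (w a b c)^6 ≤ W a b c) ?_ ?_ ?_ ?_ a b c
  · intro a b c h
    rw [w_swap12, W_swap12, abs_sub_comm b a, abs_sub_comm a c, abs_sub_comm c b]
    tauto
  · intro a b c h
    rw [w_swap23, W_swap23, abs_sub_comm b a, abs_sub_comm a c, abs_sub_comm c b]
    tauto
  · intro a b c h
    rw [w_neg, W_neg] at h
    rw [show -a - -b = -(a-b) by ring, show -b - -c = -(b-c) by ring,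
      show -c - -a = -(c-a) by ring, abs_neg, abs_neg, abs_neg] at h
    exact h
  · intro p q r h1 h2 h3 h
    rw [w_sorted h1 h2] at h ⊢
    apply W_core ht1 h1 h2 h3 _ ht0
    rcases h with h | h | h
    · linarith [neg_abs_le (p - q)]
    · linarith [neg_abs_le (q - r)]
    · linarith [le_abs_self (r - p)]

lemma W_half (a b c : ℝ) : F (1/2) * (w a b c)^6 ≤ W a b c := by
  apply W_ge (by norm_num) le_rfl
  refine sym_ind (P := fun a b c => (|a - b| ≤ 1/2 * w a b c ∨ |b - c| ≤ 1/2 * w a b c ∨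
    |c - a| ≤ 1/2 * w a b c)) ?_ ?_ ?_ ?_ a b c
  · intro a b c h
    rw [w_swap12, abs_sub_comm b a, abs_sub_comm a c, abs_sub_comm c b]
    tauto
  · intro a b c h
    rw [w_swap23, abs_sub_comm b a, abs_sub_comm a c, abs_sub_comm c b]
    tauto
  · intro a b c h
    rw [w_neg] at h
    rw [show -a - -b = -(a-b) by ring, show -b - -c = -(b-c) by ring,
      show -c - -a = -(c-a) by ring, abs_neg, abs_neg, abs_neg] at h
    exact h
  · intro p q r h1 h2 h3
    left
    rw [w_sorted h1 h2, abs_sub_comm, abs_of_nonneg] <;> linarith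

lemma V_aux {k : ℝ} (hk : 0 ≤ k) (a b c : ℝ)
    (h5 : k * w c ((c+a)/2) ((a+b+c)/3) ^ 6 ≤ W c ((c+a)/2) ((a+b+c)/3))
    (h6 : k * w ((c+a)/2) a ((a+b+c)/3) ^ 6 ≤ W ((c+a)/2) a ((a+b+c)/3)) :
    F (1/2)^4 * k^2 * (W a b c)^6 ≤ V a b c := by
  have hF : 0 ≤ F (1/2) := F_nonneg (by norm_num) le_rfl
  have e : F (1/2)^4 * k^2 * (W a b c)^6 =
    (F (1/2) * w a ((a+b)/2) ((a+b+c)/3) ^ 6) * (F (1/2) * w ((a+b)/2) b ((a+b+c)/3)^6)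
    * (F (1/2) * w b ((b+c)/2) ((a+b+c)/3)^6)
    * (F (1/2) * w ((b+c)/2) c ((a+b+c)/3)^6) * (k * w c ((c+a)/2) ((a+b+c)/3)^6)
    * (k * w ((c+a)/2) a ((a+b+c)/3)^6) := by unfold W; ring
  rw [e]
  unfold V
  have g : ∀ x : ℝ, 0 ≤ x ^ 6 := fun x => by positivity
  have p1 := W_half a ((a+b)/2) ((a+b+c)/3)
  have p2 := W_half ((a+b)/2) b ((a+b+c)/3)
  have p3 := W_half b ((b+c)/2) ((a+b+c)/3)
  have p4 := W_half ((b+c)/2) c ((a+b+c)/3)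
  have n1 := W_nonneg a ((a+b)/2) ((a+b+c)/3)
  have n2 := W_nonneg ((a+b)/2) b ((a+b+c)/3)
  have n3 := W_nonneg b ((b+c)/2) ((a+b+c)/3)
  have n4 := W_nonneg ((b+c)/2) c ((a+b+c)/3)
  have n5 := W_nonneg c ((c+a)/2) ((a+b+c)/3)
  gcongr

lemma V_ge (a b c : ℝ) : 1.004 / 6^36 * (w a b c)^36 ≤ V a b c := by
  refine sym_ind (P := fun a b c => 1.004 / 6^36 * (w a b c)^36 ≤ V a b c) ?_ ?_ ?_ ?_ a b c
  · intro a b c h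
    rw [w_swap12, V_swap12]; exact h
  · intro a b c h
    rw [w_swap23, V_swap23]; exact h
  · intro a b c h
    rw [w_neg, V_neg] at h; exact h
  · intro p q r h1 h2 h3
    have hF : 0 ≤ F (1/2) := F_nonneg (by norm_num) le_rfl
    have hF1 : 0 ≤ F 0.38 := F_nonneg (by norm_num) (by norm_num)
    have hF2 : 0 ≤ F 0.08 := F_nonneg (by norm_num) (by norm_num)
    have hw := w_nonneg p q r
    rcases le_total (q - p) (0.38 * (r - p)) with h | h
    · refine le_trans ?_ (V_aux hF p q r (W_half _ _ _) (W_half _ _ _))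
      have hW := W_core (t := 0.38) (by norm_num) h1 h2 h3 h (by norm_num)
      rw [← w_sorted h1 h2] at hW
      calc 1.004 / 6^36 * (w p q r)^36 ≤ (F (1/2)^6 * F 0.38 ^ 6) * (w p q r)^36 := by
            gcongr
            unfold F; norm_num
        _ = F (1/2)^4 * F (1/2)^2 * (F 0.38 * w p q r ^ 6)^6 := by ring
        _ ≤ _ := by gcongr
    · refine le_trans ?_ (V_aux hF2 p q r ?_ ?_)
      · have hW := W_half p q r
        calc 1.004 / 6^36 * (w p q r)^36 ≤ (F (1/2)^10 * F 0.08 ^ 2) * (w p q r)^36 := by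
              gcongr
              unfold F; norm_num
          _ = F (1/2)^4 * F 0.08^2 * (F (1/2) * w p q r ^ 6)^6 := by ring
          _ ≤ _ := by gcongr
      · apply W_ge (by norm_num) (by norm_num)
        right; left
        rw [abs_of_nonneg (by linarith)]
        have := (le_abs_self _).trans (w31 ((p+q+r)/3) ((r+p)/2) r)
        have := (neg_le_abs _).trans (w31 r ((r+p)/2) ((p+q+r)/3))
        linarith
      · apply W_ge (by norm_num) (by norm_num)
        right; right
        rw [abs_sub_comm, abs_of_nonneg (by linarith)]
        have := (le_abs_self _).trans (w12 ((r+p)/2) p ((p+q+r)/3))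
        linarith

/-! ### Geometry -/

lemma area_subdiv (T : Tri) (i : Fin 6) : triArea (subdiv T i) = triArea T / 6 := by
  obtain ⟨A, B, C⟩ := T
  have key : ∀ x y : ℝ, (x = y / 6 ∨ x = -(y / 6)) → |x| / 2 = |y| / 2 / 6 := by
    intro x y h
    have : |x| = |y| / 6 := by
      rcases h with h | h <;> rw [h] <;> simp [abs_div]
    rw [this]; ring
  have him : ∀ z v : ℂ, (z * starRingEnd ℂ v).im = z.im * v.re - z.re * v.im := by
    intro z v
    simp; ring
  fin_cases i <;> simp only [triArea] <;> apply key <;> left <;> simp only [him] <;>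
    simp [subdiv, Tri.A, Tri.B, Tri.C] <;> ring

lemma exists_proj (v : ℂ) (hv : v ≠ 0) : ∃ f g : ℂ →ₗ[ℝ] ℝ,
    (∀ z, ‖z‖ ^ 2 = f z ^ 2 + g z ^ 2) ∧ f v = ‖v‖ ∧
    (∀ z, g z = (z * starRingEnd ℂ v).im / ‖v‖) := by
  have hn : ‖v‖ ≠ 0 := norm_ne_zero_iff.mpr hv
  refine ⟨(‖v‖⁻¹) • (Complex.reLm ∘ₗ LinearMap.mulRight ℝ (starRingEnd ℂ v)),
    (‖v‖⁻¹) • (Complex.imLm ∘ₗ LinearMap.mulRight ℝ (starRingEnd ℂ v)), ?_, ?_, ?_⟩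
  · intro z
    have h : ‖z * starRingEnd ℂ v‖ ^ 2 = (‖z‖ * ‖v‖)^2 := by
      rw [norm_mul, RCLike.norm_conj]
    rw [← Complex.normSq_eq_norm_sq, Complex.normSq_apply] at h
    simp only [LinearMap.smul_apply, LinearMap.comp_apply, LinearMap.mulRight_apply,
      Complex.reLm_coe, Complex.imLm_coe, smul_eq_mul]
    field_simp
    linarith
  · simp only [LinearMap.smul_apply, LinearMap.comp_apply, LinearMap.mulRight_apply,
      Complex.reLm_coe, smul_eq_mul, Complex.mul_conj, Complex.ofReal_re,
      Complex.normSq_eq_norm_sq]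
    field_simp
  · intro z
    simp only [LinearMap.smul_apply, LinearMap.comp_apply, LinearMap.mulRight_apply,
      Complex.imLm_coe, smul_eq_mul]
    field_simp

/-- If `v` is the longest of three edges `u, s, v` with `u + s = v`. -/
lemma edge_bound (u s v : ℂ) (hv : v ≠ 0) (hsum : u + s = v) (hu : ‖u‖ ≤ ‖v‖) (hs : ‖s‖ ≤ ‖v‖) :
    ∃ f : ℂ →ₗ[ℝ] ℝ, (∀ z, |f z| ≤ ‖z‖) ∧ f v = ‖v‖ ∧
      ‖u‖ + ‖s‖ ≤ ‖v‖ + 2 * (|(u * starRingEnd ℂ v).im| / ‖v‖) := by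
  obtain ⟨f, g, h1, h2, h3⟩ := exists_proj v hv
  have hf : ∀ z, |f z| ≤ ‖z‖ := fun z =>
    abs_le_of_sq_le_sq (by rw [h1]; nlinarith [sq_nonneg (g z)]) (norm_nonneg _)
  refine ⟨f, hf, h2, ?_⟩
  have gv : g v = 0 := by
    rw [h3]; rw [Complex.mul_conj, Complex.ofReal_im, zero_div]
  have gs : g s = - g u := by
    have : g u + g s = g v := by rw [← hsum, map_add]
    linarith
  have fs : f u + f s = ‖v‖ := by rw [← h2, ← hsum, map_add]
  have gu : |g u| = |(u * starRingEnd ℂ v).im| / ‖v‖ := by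
    rw [h3, abs_div, abs_norm]
  rw [← gu]
  have bd : ∀ z, ‖z‖ ≤ |f z| + |g z| := by
    intro z
    refine (sq_le_sq₀ (norm_nonneg _) (by positivity)).mp ?_
    rw [h1, ← sq_abs (f z), ← sq_abs (g z)]
    nlinarith [abs_nonneg (f z), abs_nonneg (g z), mul_nonneg (abs_nonneg (f z)) (abs_nonneg (g z))]
  have fu0 : 0 ≤ f u := by linarith [le_abs_self (f s), hf s]
  have fs0 : 0 ≤ f s := by linarith [le_abs_self (f u), hf u]
  have b1 := bd u
  have b2 := bd s
  rw [gs, abs_neg, abs_of_nonneg fs0] at b2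
  rw [abs_of_nonneg fu0] at b1
  linarith

lemma geom (T : Tri) (hT : T.Nonflat) : ∃ f : ℂ →ₗ[ℝ] ℝ, (∀ z, |f z| ≤ ‖z‖) ∧
    perim T ≤ 2 * w (f T.A) (f T.B) (f T.C) * (1 + charY T) ∧
    0 < w (f T.A) (f T.B) (f T.C) := by
  obtain ⟨A, B, C⟩ := T
  simp only [Tri.Nonflat, Tri.A, Tri.B, Tri.C] at hT
  -- a uniform finishing step
  have fin : ∀ (u s v : ℂ) , u + s = v → ‖u‖ ≤ ‖v‖ → ‖s‖ ≤ ‖v‖ →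
      |(u * starRingEnd ℂ v).im| = |((B - A) * (starRingEnd ℂ (C - A))).im| →
      Lmax (A, B, C) = ‖v‖ → perim (A, B, C) = ‖u‖ + ‖s‖ + ‖v‖ →
      (∀ f : ℂ →ₗ[ℝ] ℝ, |f v| ≤ w (f A) (f B) (f C)) →
      ∃ f : ℂ →ₗ[ℝ] ℝ, (∀ z, |f z| ≤ ‖z‖) ∧
        perim (A, B, C) ≤ 2 * w (f A) (f B) (f C) * (1 + charY (A, B, C)) ∧
        0 < w (f A) (f B) (f C) := by
    intro u s v hsum hu hs ha hL hP hw
    have hv : v ≠ 0 := by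
      rintro rfl
      rw [map_zero, mul_zero, Complex.zero_im, abs_zero] at ha
      exact hT (abs_eq_zero.mp ha.symm)
    have hn : 0 < ‖v‖ := norm_pos_iff.mpr hv
    obtain ⟨f, f1, f2, f3⟩ := edge_bound u s v hv hsum hu hs
    have hfv : ‖v‖ ≤ w (f A) (f B) (f C) := by
      have := hw f
      rwa [f2, abs_norm] at this
    refine ⟨f, f1, ?_, by linarith⟩
    have hy : charY (A, B, C) = |(u * starRingEnd ℂ v).im| / ‖v‖ ^ 2 := by
      rw [charY, hL, ha]; simp only [triArea, Tri.A, Tri.B, Tri.C]; ring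
    have hy0 : 0 ≤ charY (A, B, C) := by rw [hy]; positivity
    calc perim (A, B, C) ≤ 2 * ‖v‖ * (1 + charY (A, B, C)) := by
          rw [hP, hy]
          have : ‖v‖ * (|(u * starRingEnd ℂ v).im| / ‖v‖ ^ 2) = |(u * starRingEnd ℂ v).im| / ‖v‖ := by
            field_simp
          linarith
      _ ≤ _ := by gcongr
  have hcases : (‖A - B‖ ≤ ‖C - A‖ ∧ ‖B - C‖ ≤ ‖C - A‖) ∨ (‖B - C‖ ≤ ‖A - B‖ ∧ ‖C - A‖ ≤ ‖A - B‖)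
      ∨ (‖A - B‖ ≤ ‖B - C‖ ∧ ‖C - A‖ ≤ ‖B - C‖) := by
    rcases le_total ‖A - B‖ ‖C - A‖ with h1 | h1 <;> rcases le_total ‖B - C‖ ‖C - A‖ with h2 | h2 <;>
      rcases le_total ‖A - B‖ ‖B - C‖ with h3 | h3 <;> first | tauto | exact Or.inl ⟨by linarith, by linarith⟩ | exact Or.inr (Or.inr ⟨by linarith, by linarith⟩)
  rcases hcases with ⟨h1, h2⟩ | ⟨h1, h2⟩ | ⟨h1, h2⟩
  · refine fin (A - B) (B - C) (A - C) (by ring) ?_ ?_ ?_ ?_ ?_ ?_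
    · rwa [norm_sub_rev A C]
    · rwa [norm_sub_rev A C]
    · congr 1; simp; ring
    · rw [norm_sub_rev A C]
      simp [Lmax, e₁, e₂, e₃, Tri.A, Tri.B, Tri.C, h1, h2]
    · rw [norm_sub_rev A C]; rfl
    · intro f; rw [map_sub, abs_sub_comm]; exact w31 _ _ _
  · refine fin (B - C) (C - A) (B - A) (by ring) ?_ ?_ ?_ ?_ ?_ ?_
    · rwa [norm_sub_rev B A]
    · rwa [norm_sub_rev B A]
    · congr 1; simp; ring
    · rw [norm_sub_rev B A]
      simp [Lmax, e₁, e₂, e₃, Tri.A, Tri.B, Tri.C, h1, h2]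
    · rw [norm_sub_rev B A]; simp [perim, e₁, e₂, e₃, Tri.A, Tri.B, Tri.C]; ring
    · intro f; rw [map_sub, abs_sub_comm]; exact w12 _ _ _
  · refine fin (C - A) (A - B) (C - B) (by ring) ?_ ?_ ?_ ?_ ?_ ?_
    · rwa [norm_sub_rev C B]
    · rwa [norm_sub_rev C B]
    · congr 1; simp; ring
    · rw [norm_sub_rev C B]
      simp [Lmax, e₁, e₂, e₃, Tri.A, Tri.B, Tri.C, h1, h2]
    · rw [norm_sub_rev C B]; simp [perim, e₁, e₂, e₃, Tri.A, Tri.B, Tri.C]; ring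
    · intro f; rw [map_sub, abs_sub_comm]; exact w23 _ _ _

def wT (f : ℂ →ₗ[ℝ] ℝ) (T : Tri) : ℝ := w (f T.A) (f T.B) (f T.C)

lemma perim_ge (f : ℂ →ₗ[ℝ] ℝ) (hf : ∀ z, |f z| ≤ ‖z‖) (T : Tri) : 2 * wT f T ≤ perim T := by
  have h1 := hf (T.A - T.B)
  have h2 := hf (T.B - T.C)
  have h3 := hf (T.C - T.A)
  rw [map_sub] at h1 h2 h3
  have t1 := norm_sub_le_norm_sub_add_norm_sub T.A T.B T.C
  have t2 := norm_sub_le_norm_sub_add_norm_sub T.B T.C T.A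
  have t3 := norm_sub_le_norm_sub_add_norm_sub T.C T.A T.B
  rw [norm_sub_rev T.A T.C] at t1
  rw [norm_sub_rev T.B T.A] at t2
  rw [norm_sub_rev T.C T.B] at t3
  have : wT f T ≤ perim T / 2 := by
    unfold wT w perim e₁ e₂ e₃
    refine max_le ?_ (max_le ?_ ?_) <;> linarith
  linarith

lemma wT_prod (f : ℂ →ₗ[ℝ] ℝ) (T : Tri) : ∏ j : Fin 6, wT f (subdiv T j)
    = W (f T.A) (f T.B) (f T.C) := by
  have h2 : ∀ z : ℂ, f (z / 2) = f z / 2 := by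
    intro z
    have : z / 2 = (1/2 : ℝ) • z := by simp; ring
    rw [this, map_smul, smul_eq_mul]; ring
  have h3 : ∀ z : ℂ, f (z / 3) = f z / 3 := by
    intro z
    have : z / 3 = (1/3 : ℝ) • z := by simp; ring
    rw [this, map_smul, smul_eq_mul]; ring
  rw [Fin.prod_univ_six]
  unfold W
  rw [← map_add, ← map_add, ← map_add, ← map_add, ← h2, ← h2, ← h2, ← h3]
  rfl

lemma WT_prod (f : ℂ →ₗ[ℝ] ℝ) (T : Tri) : ∏ i : Fin 6, ∏ j : Fin 6, wT f (subdiv (subdiv T i) j)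
    = V (f T.A) (f T.B) (f T.C) := by
  have h2 : ∀ z : ℂ, f (z / 2) = f z / 2 := by
    intro z
    have : z / 2 = (1/2 : ℝ) • z := by simp; ring
    rw [this, map_smul, smul_eq_mul]; ring
  have h3 : ∀ z : ℂ, f (z / 3) = f z / 3 := by
    intro z
    have : z / 3 = (1/3 : ℝ) • z := by simp; ring
    rw [this, map_smul, smul_eq_mul]; ring
  simp only [wT_prod]
  rw [Fin.prod_univ_six]
  unfold V
  rw [← map_add, ← map_add, ← map_add, ← map_add, ← h2, ← h2, ← h2, ← h3]
  rfl

end LogGain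

open LogGain

/-- **Proposition (mean growth of the isoperimetric value near flatness).** There are
`γ > 0` and `ε > 0` such that for every non-flat triangle whose characterizing point
`(x, y)` has `y < ε`, the mean of `ln(I(T_{i,j})/I(T))` over the 36 triangles of the
twice-iterated barycentric subdivision is at least `γ`. -/
theorem isoperimetric_log_gain_near_flat :
    ∃ γ : ℝ, 0 < γ ∧ ∃ ε : ℝ, 0 < ε ∧
      ∀ T : Tri, T.Nonflat → charY T < ε →
        (1/36 : ℝ) *
            ∑ i : Fin 6, ∑ j : Fin 6,
              Real.log (Ival (subdiv (subdiv T i) j) / Ival T) ≥ γ := by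
  refine ⟨2 / 36 * Real.log 1.002, ?_, 0.00001, by norm_num, ?_⟩
  · have := Real.log_pos (show (1:ℝ) < 1.002 by norm_num)
    positivity
  intro T hT hy
  obtain ⟨f, hf, hP, hw⟩ := geom T hT
  have har : 0 < triArea T := by
    unfold triArea
    have : 0 < |((T.B - T.A) * (starRingEnd ℂ (T.C - T.A))).im| := abs_pos.mpr hT
    positivity
  have hy0 : 0 ≤ charY T := by
    unfold charY; positivity
  have hPij := fun i j => perim_ge f hf (subdiv (subdiv T i) j)
  have hV := V_ge (f T.A) (f T.B) (f T.C)
  rw [← WT_prod] at hV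
  set w0 := w (f T.A) (f T.B) (f T.C) with hw0
  have hwn : ∀ S : Tri, 0 ≤ wT f S := fun S => w_nonneg _ _ _
  have hP0 : 0 < perim T := by
    have : 2 * w0 ≤ perim T := perim_ge f hf T
    linarith
  -- positivity of the widths
  have hprod : 0 < ∏ i : Fin 6, ∏ j : Fin 6, wT f (subdiv (subdiv T i) j) :=
    lt_of_lt_of_le (by positivity) hV
  have hwpos : ∀ i j, 0 < wT f (subdiv (subdiv T i) j) := by
    intro i j
    refine lt_of_le_of_ne (hwn _) (fun h => ?_)
    have h1 := Finset.prod_ne_zero_iff.mp hprod.ne' i (Finset.mem_univ _)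
    exact Finset.prod_ne_zero_iff.mp h1 j (Finset.mem_univ _) h.symm
  have hppos : ∀ i j, 0 < perim (subdiv (subdiv T i) j) := fun i j => by
    linarith [hwpos i j, hPij i j]
  have hterm : ∀ i j, 2 * Real.log (12 / perim T * wT f (subdiv (subdiv T i) j)) ≤
      Real.log (Ival (subdiv (subdiv T i) j) / Ival T) := by
    intro i j
    have e : Ival (subdiv (subdiv T i) j) / Ival T
        = (6 / perim T * perim (subdiv (subdiv T i) j)) ^ 2 := by
      unfold Ival
      rw [area_subdiv, area_subdiv]
      field_simp
    rw [e, Real.log_pow]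
    have h1 := hwpos i j
    have h2 : 12 / perim T * wT f (subdiv (subdiv T i) j)
        ≤ 6 / perim T * perim (subdiv (subdiv T i) j) := by
      calc 12 / perim T * wT f (subdiv (subdiv T i) j)
          = 6 / perim T * (2 * wT f (subdiv (subdiv T i) j)) := by ring
        _ ≤ _ := by gcongr; exact hPij i j
    have := Real.log_le_log (by positivity) h2
    push_cast
    linarith
  have hsum : 2 * Real.log 1.002 ≤
      ∑ i : Fin 6, ∑ j : Fin 6, 2 * Real.log (12 / perim T * wT f (subdiv (subdiv T i) j)) := by
    simp only [← Finset.mul_sum]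
    have e : ∑ i : Fin 6, ∑ j : Fin 6, Real.log (12 / perim T * wT f (subdiv (subdiv T i) j))
        = Real.log ((12 / perim T) ^ 36 *
          ∏ i : Fin 6, ∏ j : Fin 6, wT f (subdiv (subdiv T i) j)) := by
      have e1 : (12 / perim T) ^ 36 * ∏ i : Fin 6, ∏ j : Fin 6, wT f (subdiv (subdiv T i) j)
          = ∏ i : Fin 6, ∏ j : Fin 6, (12 / perim T * wT f (subdiv (subdiv T i) j)) := by
        simp only [Finset.prod_mul_distrib, Finset.prod_const, Finset.card_univ, Fintype.card_fin]
        rw [← pow_mul]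
      have hne : ∀ i j, 12 / perim T * wT f (subdiv (subdiv T i) j) ≠ 0 := fun i j =>
        (mul_pos (by positivity) (hwpos i j)).ne'
      rw [e1, Real.log_prod]
      · refine Finset.sum_congr rfl fun i _ => ?_
        rw [Real.log_prod]
        exact fun j _ => hne i j
      · exact fun i _ => Finset.prod_ne_zero_iff.mpr fun j _ => hne i j
    rw [e]
    have h1 : (1.002 : ℝ) ≤ (12 / perim T) ^ 36 *
          ∏ i : Fin 6, ∏ j : Fin 6, wT f (subdiv (subdiv T i) j) := by
      have hP' : perim T ≤ 2 * w0 * 1.00001 := hP.trans (by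
        gcongr; linarith)
      have hq : 6 / (1.00001 * w0) ≤ 12 / perim T := by
        rw [div_le_div_iff₀ (by positivity) hP0]
        linarith
      calc (1.002 : ℝ) ≤ (6 / 1.00001)^36 * (1.004 / 6 ^ 36) := by norm_num
        _ = (6 / (1.00001 * w0))^36 * (1.004 / 6 ^ 36 * w0 ^ 36) := by
            rw [show (6 / (1.00001 * w0)) = (6 / 1.00001) * w0⁻¹ by field_simp]
            rw [mul_pow, inv_pow]
            field_simp
        _ ≤ _ := by gcongr
    have := Real.log_le_log (by norm_num) h1
    linarith
  have hfinal := hsum.trans (Finset.sum_le_sum fun i _ => Finset.sum_le_sum fun j _ => hterm i j)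
  linarith

end
end

section
/- The function F defined on [0,1/2] by F(x) := (1/36)·∑_{i,j=1}^{6} ln( G(j, z_i(x)) · G(i, x) ) is strictly positive at every point of [0,1/2]. -/
open MeasureTheory ProbabilityTheory Filter Set

noncomputable section

variable {Ω : Type*}

/-- The product of the `G(j, x)` over `j`. -/
def pfun (x : ℝ) : ℝ := (1+x)*(2-x)^3*(1-x)/3

/-- A finite product of powers of affine functions. -/
def affProd (L : List (ℝ × ℝ × ℕ)) (x : ℝ) : ℝ :=
  (L.map (fun p => (p.1 * x + p.2.1)^p.2.2)).prod

/-- Positivity of all affine factors. -/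
def AllPos (L : List (ℝ × ℝ × ℕ)) (x : ℝ) : Prop := ∀ p ∈ L, 0 < p.1 * x + p.2.1

lemma affProd_pos {L : List (ℝ × ℝ × ℕ)} {x : ℝ} (h : AllPos L x) : 0 < affProd L x := by
  unfold affProd
  apply List.prod_pos
  intro a ha
  obtain ⟨p, hp, rfl⟩ := List.mem_map.1 ha
  exact pow_pos (h p hp) _

/-- Log-concavity of products of positive affine functions. -/
lemma affProd_log {u v s t : ℝ} (hs : 0 ≤ s) (ht : 0 ≤ t) (hst : s + t = 1)
    (L : List (ℝ × ℝ × ℕ)) (hu : AllPos L u) (hv : AllPos L v) :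
    AllPos L (s*u+t*v) ∧
    s * Real.log (affProd L u) + t * Real.log (affProd L v)
      ≤ Real.log (affProd L (s*u+t*v)) := by
  induction L with
  | nil => simp [affProd, AllPos]
  | cons p L ih =>
    have hu' : AllPos L u := fun q hq => hu q (List.mem_cons_of_mem _ hq)
    have hv' : AllPos L v := fun q hq => hv q (List.mem_cons_of_mem _ hq)
    obtain ⟨ih1, ih2⟩ := ih hu' hv'
    have pu := hu p List.mem_cons_self
    have pv := hv p List.mem_cons_self
    have e : p.1 * (s*u+t*v) + p.2.1 = s * (p.1*u+p.2.1) + t * (p.1*v+p.2.1) := by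
      linear_combination (-p.2.1) * hst
    have hc := strictConcaveOn_log_Ioi.concaveOn.2 (Set.mem_Ioi.2 pu) (Set.mem_Ioi.2 pv) hs ht hst
    simp only [smul_eq_mul] at hc
    have px : 0 < p.1 * (s*u+t*v) + p.2.1 := by
      rw [e]
      rcases hs.eq_or_lt with h | h
      · subst h
        have : t = 1 := by linarith
        subst this
        linarith
      · exact add_pos_of_pos_of_nonneg (mul_pos h pu) (mul_nonneg ht pv.le)
    rw [← e] at hc
    refine ⟨?_, ?_⟩
    · intro q hq
      rcases List.mem_cons.1 hq with rfl | hq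
      · exact px
      · exact ih1 q hq
    · have key : ∀ y, 0 < p.1 * y + p.2.1 → AllPos L y → Real.log (affProd (p :: L) y)
          = p.2.2 * Real.log (p.1 * y + p.2.1) + Real.log (affProd L y) := by
        intro y hy hL
        have : affProd (p :: L) y = (p.1 * y + p.2.1)^p.2.2 * affProd L y := by
          simp [affProd]
        rw [this, Real.log_mul (pow_pos hy _).ne' (affProd_pos hL).ne', Real.log_pow]
      rw [key u pu hu', key v pv hv', key _ px ih1]
      have := mul_le_mul_of_nonneg_left hc (Nat.cast_nonneg (α := ℝ) p.2.2)
      linarith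

lemma affProd_gt_one {u v x : ℝ} (huv : u < v) (hx : x ∈ Set.Icc u v)
    (L : List (ℝ × ℝ × ℕ)) (hu : AllPos L u) (hv : AllPos L v)
    (h1 : 1 < affProd L u) (h2 : 1 < affProd L v) : 1 < affProd L x := by
  obtain ⟨hx1, hx2⟩ := hx
  have hd : 0 < v - u := sub_pos.2 huv
  have hs : 0 ≤ (v - x)/(v-u) := div_nonneg (by linarith) hd.le
  have ht : 0 ≤ (x - u)/(v-u) := div_nonneg (by linarith) hd.le
  have hst : (v - x)/(v-u) + (x - u)/(v-u) = 1 := by field_simp; ring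
  have hxx : (v - x)/(v-u) * u + (x - u)/(v-u) * v = x := by field_simp; ring
  obtain ⟨hp, hl⟩ := affProd_log hs ht hst L hu hv
  rw [hxx] at hp hl
  have l1 := Real.log_pos h1
  have l2 := Real.log_pos h2
  have : 0 < Real.log (affProd L x) := by
    refine lt_of_lt_of_le ?_ hl
    rcases hs.eq_or_lt with h | h
    · rw [← h] at hst ⊢
      have : (x - u)/(v-u) = 1 := by linarith
      rw [this]
      linarith
    · exact add_pos_of_pos_of_nonneg (mul_pos h l1) (mul_nonneg ht l2.le)
  exact (Real.log_pos_iff (affProd_pos hp).le).1 this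

lemma Gfun_pos (j : Fin 6) {x : ℝ} (hx : x ∈ Set.Icc (0:ℝ) (1/2)) : 0 < Gfun j x := by
  obtain ⟨h0, h1⟩ := hx
  have a : 0 < 1 + x := by linarith
  have b : 0 < 2 - x := by linarith
  have c : 0 < 1 - x := by linarith
  fin_cases j <;> simp [Gfun, a, b, c]

lemma prod_Gfun (x : ℝ) : ∏ j, Gfun j x = pfun x := by
  have e1 : Real.sqrt (1/6) = Real.sqrt (2/3) / 2 := by
    rw [show (1/6:ℝ) = (2/3) / 2^2 by norm_num, Real.sqrt_div (by norm_num),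
      Real.sqrt_sq (by norm_num)]
  have e2 : Real.sqrt (2/3) * Real.sqrt (3/2) = 1 := by
    rw [← Real.sqrt_mul (by norm_num)]; norm_num
  have e3 : Real.sqrt (2/3) ^ 2 = 2/3 := Real.sq_sqrt (by norm_num)
  simp only [Fin.prod_univ_six, Gfun, pfun]
  simp only [Matrix.cons_val]
  rw [e1]
  generalize Real.sqrt (2/3) = a at *
  generalize Real.sqrt (3/2) = b at *
  have : a * ((a/2)) * b * a * a * b = 1/3 := by
    have : a * ((a/2)) * b * a * a * b = (a*b)^2 * a^2 / 2 := by ring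
    rw [this, e2, e3]; norm_num
  linear_combination ((1+x)*(2-x)^3*(1-x)) * this

lemma zfun_mem (i : Fin 6) {x : ℝ} (hx : x ∈ Set.Icc (0:ℝ) (1/2)) :
    zfun i x ∈ Set.Icc (0:ℝ) (1/2) := by
  obtain ⟨h0, h1⟩ := hx
  have a : 0 < 2 + 2*x := by linarith
  have b : 0 < 2 - x := by linarith
  have c : 0 < 3 - 3*x := by linarith
  have d : 0 < 4 - 2*x := by linarith
  fin_cases i <;> simp only [zfun, Set.mem_Icc] <;> simp
  · exact ⟨by positivity, by rw [div_le_iff₀ a]; linarith⟩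
  · split_ifs with h
    · exact ⟨by positivity, by rw [div_le_iff₀ b]; linarith⟩
    · exact ⟨div_nonneg (by linarith) b.le, by rw [div_le_iff₀ b]; linarith⟩
  · split_ifs with h
    · exact ⟨div_nonneg (by linarith) c.le, by rw [div_le_iff₀ c]; linarith⟩
    · exact ⟨div_nonneg (by linarith) c.le, by rw [div_le_iff₀ c]; linarith⟩
  · exact ⟨div_nonneg (by linarith) d.le, by rw [div_le_iff₀ d]; linarith⟩
  · exact ⟨div_nonneg (by linarith) d.le, by rw [div_le_iff₀ d]; linarith⟩
  · exact ⟨by linarith, by linarith⟩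

lemma sum_eq {x : ℝ} (hx : x ∈ Set.Icc (0:ℝ) (1/2)) :
    ∑ i : Fin 6, ∑ j : Fin 6, Real.log (Gfun j (zfun i x) * Gfun i x)
      = Real.log ((∏ i, pfun (zfun i x)) * pfun x ^ 6) := by
  have h1 : ∀ i j : Fin 6, Gfun j (zfun i x) * Gfun i x ≠ 0 := fun i j =>
    (mul_pos (Gfun_pos j (zfun_mem i hx)) (Gfun_pos i hx)).ne'
  have h2 : ∀ i : Fin 6, ∑ j : Fin 6, Real.log (Gfun j (zfun i x) * Gfun i x)
      = Real.log (pfun (zfun i x) * Gfun i x ^ 6) := by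
    intro i
    rw [← Real.log_prod (fun j _ => h1 i j), Finset.prod_mul_distrib, prod_Gfun]
    simp
  rw [Finset.sum_congr rfl (fun i _ => h2 i), ← Real.log_prod, Finset.prod_mul_distrib,
    Finset.prod_pow, prod_Gfun]
  intro i _
  rw [← prod_Gfun]
  exact (mul_pos (Finset.prod_pos fun j _ => Gfun_pos j (zfun_mem i hx))
    (pow_pos (Gfun_pos i hx) 6)).ne'

lemma pfun_div {n d : ℝ} (hd : d ≠ 0) :
    pfun (n/d) = (d+n)*(2*d-n)^3*(d-n)/(3*d^5) := by
  unfold pfun; field_simp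

lemma piece0 {x : ℝ} (hx : x ∈ Set.Icc (0:ℝ) (1/2))
    (h1 : 0 ≤ x) (h2 : x < 1/5) :
    1 < (∏ i, pfun (zfun i x)) * pfun x ^ 6 := by
  have h := affProd_gt_one (u := 0) (v := 1/5) (x := x) (by norm_num) ⟨h1, h2.le⟩
    [(5, 2, 1), (1, 4, 3), (-1, 2, 1), (2, 2, 1), (-5, 4, 3), (-4, 2, 1), (-2, 4, 1), (-7, 5, 3), (-4, 2, 1), (-1, 5, 1), (-5, 7, 3), (-3, 3, 1), (-4, 5, 1), (-2, 7, 3), (-2, 4, 1), (2, 5, 3), (2, 2, 1), (1, 1, 1), (-1, 2, 3), (-1, 1, 1), (0, 1 / (3^21 * 2^15), 1)]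
    (by simp only [AllPos, List.forall_mem_cons]; norm_num)
    (by simp only [AllPos, List.forall_mem_cons]; norm_num)
    (by simp only [affProd, List.map_cons, List.map_nil, List.prod_cons, List.prod_nil]; norm_num)
    (by simp only [affProd, List.map_cons, List.map_nil, List.prod_cons, List.prod_nil]; norm_num)
  refine lt_of_lt_of_eq h ?_
  obtain ⟨h0, h3⟩ := hx
  have a : 1 + x ≠ 0 := by linarith
  have b : 2 - x ≠ 0 := by linarith
  have c : 1 - x ≠ 0 := by linarith
  have c2 : x < 2/7 := by linarith
  have c3 : x < 1/5 := by linarith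
  simp only [Fin.prod_univ_six, zfun, Matrix.cons_val, if_pos c2, if_pos c3]
  rw [show 2+2*x = 2*(1+x) by ring, show 3-3*x = 3*(1-x) by ring,
    show 4-2*x = 2*(2-x) by ring]
  rw [pfun_div (by positivity), pfun_div (by positivity), pfun_div (by positivity),
    pfun_div (by positivity), pfun_div (by positivity), pfun_div (by positivity)]
  simp only [affProd, List.map_cons, List.map_nil, List.prod_cons, List.prod_nil, pfun]
  generalize hA : 1 + x = A at *
  generalize hB : 2 - x = B at *
  generalize hC : 1 - x = C at *
  field_simp
  subst hA hB hC
  ring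

lemma piece1 {x : ℝ} (hx : x ∈ Set.Icc (0:ℝ) (1/2))
    (h1 : 1/5 ≤ x) (h2 : x < 2/7) :
    1 < (∏ i, pfun (zfun i x)) * pfun x ^ 6 := by
  have h := affProd_gt_one (u := 1/5) (v := 2/7) (x := x) (by norm_num) ⟨h1, h2.le⟩
    [(5, 2, 1), (1, 4, 3), (-1, 2, 1), (2, 2, 1), (-5, 4, 3), (-4, 2, 1), (-7, 5, 1), (-2, 4, 3), (1, 1, 1), (-1, 5, 1), (-5, 7, 3), (-3, 3, 1), (-4, 5, 1), (-2, 7, 3), (-2, 4, 1), (2, 5, 3), (2, 2, 1), (1, 1, 1), (-1, 2, 3), (-1, 1, 1), (0, 1 / (3^21 * 2^15), 1)]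
    (by simp only [AllPos, List.forall_mem_cons]; norm_num)
    (by simp only [AllPos, List.forall_mem_cons]; norm_num)
    (by simp only [affProd, List.map_cons, List.map_nil, List.prod_cons, List.prod_nil]; norm_num)
    (by simp only [affProd, List.map_cons, List.map_nil, List.prod_cons, List.prod_nil]; norm_num)
  refine lt_of_lt_of_eq h ?_
  obtain ⟨h0, h3⟩ := hx
  have a : 1 + x ≠ 0 := by linarith
  have b : 2 - x ≠ 0 := by linarith
  have c : 1 - x ≠ 0 := by linarith
  have c2 : x < 2/7 := by linarith
  have c3 : x ≥ 1/5 := by linarith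
  simp only [Fin.prod_univ_six, zfun, Matrix.cons_val, if_pos c2, if_neg c3.not_gt]
  rw [show 2+2*x = 2*(1+x) by ring, show 3-3*x = 3*(1-x) by ring,
    show 4-2*x = 2*(2-x) by ring]
  rw [pfun_div (by positivity), pfun_div (by positivity), pfun_div (by positivity),
    pfun_div (by positivity), pfun_div (by positivity), pfun_div (by positivity)]
  simp only [affProd, List.map_cons, List.map_nil, List.prod_cons, List.prod_nil, pfun]
  generalize hA : 1 + x = A at *
  generalize hB : 2 - x = B at *
  generalize hC : 1 - x = C at *
  field_simp
  subst hA hB hC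
  ring

lemma piece2 {x : ℝ} (hx : x ∈ Set.Icc (0:ℝ) (1/2))
    (h1 : 2/7 ≤ x) (h2 : x ≤ 1/2) :
    1 < (∏ i, pfun (zfun i x)) * pfun x ^ 6 := by
  have h := affProd_gt_one (u := 2/7) (v := 1/2) (x := x) (by norm_num) ⟨h1, h2⟩
    [(5, 2, 1), (1, 4, 3), (-1, 2, 1), (-5, 4, 1), (2, 2, 3), (3, 0, 1), (-7, 5, 1), (-2, 4, 3), (1, 1, 1), (-1, 5, 1), (-5, 7, 3), (-3, 3, 1), (-4, 5, 1), (-2, 7, 3), (-2, 4, 1), (2, 5, 3), (2, 2, 1), (1, 1, 1), (-1, 2, 3), (-1, 1, 1), (0, 1 / (3^21 * 2^15), 1)]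
    (by simp only [AllPos, List.forall_mem_cons]; norm_num)
    (by simp only [AllPos, List.forall_mem_cons]; norm_num)
    (by simp only [affProd, List.map_cons, List.map_nil, List.prod_cons, List.prod_nil]; norm_num)
    (by simp only [affProd, List.map_cons, List.map_nil, List.prod_cons, List.prod_nil]; norm_num)
  refine lt_of_lt_of_eq h ?_
  obtain ⟨h0, h3⟩ := hx
  have a : 1 + x ≠ 0 := by linarith
  have b : 2 - x ≠ 0 := by linarith
  have c : 1 - x ≠ 0 := by linarith
  have c2 : x ≥ 2/7 := by linarith
  have c3 : x ≥ 1/5 := by linarith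
  simp only [Fin.prod_univ_six, zfun, Matrix.cons_val, if_neg c2.not_gt, if_neg c3.not_gt]
  rw [show 2+2*x = 2*(1+x) by ring, show 3-3*x = 3*(1-x) by ring,
    show 4-2*x = 2*(2-x) by ring]
  rw [pfun_div (by positivity), pfun_div (by positivity), pfun_div (by positivity),
    pfun_div (by positivity), pfun_div (by positivity), pfun_div (by positivity)]
  simp only [affProd, List.map_cons, List.map_nil, List.prod_cons, List.prod_nil, pfun]
  generalize hA : 1 + x = A at *
  generalize hB : 2 - x = B at *
  generalize hC : 1 - x = C at *
  field_simp
  subst hA hB hC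
  ring

/-- **Positivity of the function `F`.** The function
`F(x) = (1/36)·∑_{i,j} ln(G(j, z_i(x))·G(i, x))` is strictly positive on `[0, 1/2]`. -/
theorem F_pos_on_Icc :
    ∀ x ∈ Set.Icc (0 : ℝ) (1/2),
      0 < (1/36 : ℝ) *
            ∑ i : Fin 6, ∑ j : Fin 6, Real.log (Gfun j (zfun i x) * Gfun i x) := by
  intro x hx
  rw [sum_eq hx]
  have h : 1 < (∏ i, pfun (zfun i x)) * pfun x ^ 6 := by
    rcases lt_or_ge x (1/5) with h | h
    · exact piece0 hx hx.1 h
    · rcases lt_or_ge x (2/7) with h' | h'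
      · exact piece1 hx h h'
      · exact piece2 hx h' hx.2
  exact mul_pos (by norm_num) (Real.log_pos h)

end
end

section
/- Let S ⊂ ℝ be a nonempty compact set, let f₁,…,f_m : S → S be Lipschitz maps, let p = (p₁,…,p_m) be a probability vector, and suppose there exist q ∈ (0,1] and ρ ∈ (0,1) such that for all x,y ∈ S, ∑_{i=1}^{m} p_i·|f_i(y) − f_i(x)|^q ≤ ρ·|y − x|^q. Let μ be a probability measure on S invariant for the kernel N(x,·) := ∑_i p_i·δ_{f_i(x)} (i.e. μ(B) = ∑_i p_i·μ(f_i^{-1}(B)) for every Borel set B). Then for every x ∈ S, the Markov chain U₀ = x, U_{n+1} = f_{ι_{n+1}}(U_n), where (ι_n)_{n≥1} is i.i.d. with P[ι_n = i] = p_i, satisfies the strong law of large numbers: for every continuous function g : S → ℝ, almost surely lim_{N→∞} (1/(N+1))·∑_{n=0}^{N} g(U_n) = ∫ g dμ. -/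
open MeasureTheory ProbabilityTheory Filter Set

noncomputable section

theorem slln_orth {Ω : Type*} [MeasurableSpace Ω] (P : Measure Ω) [IsProbabilityMeasure P]
    (D : ℕ → Ω → ℝ) (C : ℝ) (hm : ∀ n, Measurable (D n)) (hb : ∀ n ω, |D n ω| ≤ C)
    (ho : ∀ n k, k < n → ∫ ω, D n ω * D k ω ∂P = 0) :
    ∀ᵐ ω ∂P, Tendsto (fun N : ℕ => (∑ n ∈ Finset.range N, D n ω) / (N : ℝ)) atTop (nhds 0) := by
  set S : ℕ → Ω → ℝ := fun N ω => ∑ n ∈ Finset.range N, D n ω with hSdef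
  have hSs : ∀ N ω, S (N+1) ω = S N ω + D N ω := fun N ω => Finset.sum_range_succ _ _
  have hSm : ∀ N, Measurable (S N) := fun N => Finset.measurable_fun_sum _ (fun i _ => hm i)
  have hgap : ∀ ω a b, a ≤ b → |S b ω - S a ω| ≤ C * ((b:ℝ) - a) := by
    intro ω a b hab
    induction b, hab using Nat.le_induction with
    | base => simp
    | succ b hab ih =>
      rw [hSs]
      have h1 := hb b ω
      have h2 : S b ω + D b ω - S a ω = (S b ω - S a ω) + D b ω := by ring
      rw [h2]
      push_cast
      linarith [abs_add_le (S b ω - S a ω) (D b ω)]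
  have hSb : ∀ N ω, |S N ω| ≤ C * N := by
    intro N ω
    have := hgap ω 0 N (Nat.zero_le _)
    simpa [hSdef] using this
  have hint : ∀ (X : Ω → ℝ) (B : ℝ), Measurable X → (∀ ω, |X ω| ≤ B) → Integrable X P := by
    intro X B hX hB
    exact Integrable.of_bound hX.aestronglyMeasurable B (Eventually.of_forall hB)
  have hDi : ∀ n, Integrable (D n) P := fun n => hint _ C (hm n) (hb n)
  have hSi : ∀ n, Integrable (S n) P := fun n => hint _ _ (hSm n) (hSb n)
  have hDD : ∀ n k, Integrable (fun ω => D n ω * D k ω) P := fun n k =>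
    (hDi k).bdd_mul (hm n).aestronglyMeasurable (Eventually.of_forall (hb n))
  have hDS : ∀ n k, Integrable (fun ω => D n ω * S k ω) P := fun n k =>
    (hSi k).bdd_mul (hm n).aestronglyMeasurable (Eventually.of_forall (hb n))
  have hSS : ∀ n k, Integrable (fun ω => S n ω * S k ω) P := fun n k =>
    (hSi k).bdd_mul (hSm n).aestronglyMeasurable (Eventually.of_forall (hSb n))
  have hE : ∀ N, ∫ ω, S N ω * S N ω ∂P ≤ N * C^2 := by
    intro N
    induction N with
    | zero => simp [hSdef]
    | succ N ih =>
      have h1 : ∀ ω, S (N+1) ω * S (N+1) ω = S N ω * S N ω + (2 * (D N ω * S N ω) + D N ω * D N ω) := by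
        intro ω; rw [hSs]; ring
      simp_rw [h1]
      have hI : Integrable (fun ω => 2 * (D N ω * S N ω) + D N ω * D N ω) P :=
        ((hDS _ _).const_mul 2).add (hDD _ _)
      rw [integral_add (hSS _ _) hI,
        integral_add ((hDS _ _).const_mul 2) (hDD _ _), integral_const_mul]
      have h2 : ∫ ω, D N ω * S N ω ∂P = 0 := by
        simp_rw [hSdef, Finset.mul_sum]
        rw [integral_finsetSum _ (fun i _ => hDD _ _)]
        exact Finset.sum_eq_zero (fun i hi => ho N i (Finset.mem_range.1 hi))
      have h3 : ∫ ω, D N ω * D N ω ∂P ≤ C^2 := by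
        calc ∫ ω, D N ω * D N ω ∂P ≤ ∫ ω, C^2 ∂P := by
              refine integral_mono (hDD _ _) (integrable_const _) (fun ω => ?_)
              have := hb N ω
              have h4 := abs_mul_abs_self (D N ω)
              have := abs_nonneg (D N ω)
              show D N ω * D N ω ≤ C^2
              nlinarith
          _ = C^2 := by simp
      rw [h2]; push_cast; linarith
  have hsub : ∀ᵐ ω ∂P, Tendsto (fun k : ℕ => S (k^2) ω / ((k:ℝ)^2)) atTop (nhds 0) := by
    have hfin : ∫⁻ ω, ∑' k : ℕ, ENNReal.ofReal ((S (k^2) ω / ((k:ℝ)^2))^2) ∂P ≠ ⊤ := by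
      rw [lintegral_tsum (fun k => (((hSm _).div_const _).pow_const 2).ennreal_ofReal.aemeasurable)]
      have hle : ∀ k : ℕ, ∫⁻ ω, ENNReal.ofReal ((S (k^2) ω / ((k:ℝ)^2))^2) ∂P
          ≤ ENNReal.ofReal (C^2 * (1 / (k:ℝ)^2)) := by
        intro k
        have he : ∀ ω, (S (k^2) ω / ((k:ℝ)^2))^2 = (((k:ℝ)^2)^2)⁻¹ * (S (k^2) ω * S (k^2) ω) := by
          intro ω; rw [div_pow, div_eq_inv_mul]; ring
        simp_rw [he]
        rw [← ofReal_integral_eq_lintegral_ofReal ((hSS _ _).const_mul _)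
          (Eventually.of_forall (fun ω => by
            have := mul_self_nonneg (S (k^2) ω)
            show 0 ≤ (((k:ℝ)^2)^2)⁻¹ * (S (k^2) ω * S (k^2) ω)
            positivity))]
        apply ENNReal.ofReal_le_ofReal
        rw [integral_const_mul]
        have := hE (k^2)
        rcases Nat.eq_zero_or_pos k with rfl | hk
        · simp
        · have hk' : (0:ℝ) < k := by exact_mod_cast hk
          calc (((k:ℝ)^2)^2)⁻¹ * ∫ ω, S (k^2) ω * S (k^2) ω ∂P
              ≤ (((k:ℝ)^2)^2)⁻¹ * (((k^2 : ℕ):ℝ) * C^2) := by gcongr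
            _ = C^2 * (1 / (k:ℝ)^2) := by push_cast; field_simp
      refine ne_top_of_le_ne_top ?_ (ENNReal.tsum_le_tsum hle)
      exact ((Real.summable_one_div_nat_pow.2 (by norm_num)).mul_left (C^2)).tsum_ofReal_ne_top
    have hmeas : Measurable (fun ω => ∑' k : ℕ, ENNReal.ofReal ((S (k^2) ω / ((k:ℝ)^2))^2)) :=
      Measurable.tsum (fun k => (((hSm _).div_const _).pow_const 2).ennreal_ofReal)
    filter_upwards [ae_lt_top hmeas hfin] with ω hω
    have h1 := ENNReal.tendsto_atTop_zero_of_tsum_ne_top hω.ne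
    have h2 : Tendsto (fun k : ℕ => (S (k^2) ω / ((k:ℝ)^2))^2) atTop (nhds 0) := by
      have h3 := (ENNReal.tendsto_toReal ENNReal.zero_ne_top).comp h1
      simp only [ENNReal.toReal_zero] at h3
      refine h3.congr (fun k => ?_)
      simp only [Function.comp]
      rw [ENNReal.toReal_ofReal (sq_nonneg _)]
    have h4 := (Real.continuous_sqrt.tendsto 0).comp h2
    rw [Real.sqrt_zero] at h4
    rw [tendsto_zero_iff_abs_tendsto_zero]
    refine h4.congr (fun k => ?_)
    simp only [Function.comp, Real.sqrt_sq_eq_abs]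
  have hsq : Tendsto Nat.sqrt atTop atTop := by
    refine tendsto_atTop.2 (fun b => ?_)
    filter_upwards [eventually_ge_atTop (b^2)] with n hn
    exact Nat.le_sqrt'.2 hn
  filter_upwards [hsub] with ω hω
  have hC : 0 ≤ C := (abs_nonneg _).trans (hb 0 ω)
  have h1 := (hω.abs).comp hsq
  have h2 : Tendsto (fun N : ℕ => (2 * C) / (Nat.sqrt N : ℝ)) atTop (nhds 0) :=
    (tendsto_const_div_atTop_nhds_zero_nat (2*C)).comp hsq
  have h3 := h1.add h2
  simp only [abs_zero, add_zero] at h3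
  refine squeeze_zero_norm' ?_ h3
  filter_upwards [eventually_ge_atTop 1] with N hN
  have hk : 1 ≤ Nat.sqrt N := Nat.le_sqrt'.2 (by simpa using hN)
  have hk2 := Nat.sqrt_le' N
  have hk3 := Nat.lt_succ_sqrt' N
  simp only [Function.comp]
  set k := Nat.sqrt N
  have hk' : (1:ℝ) ≤ k := by exact_mod_cast hk
  have hk2' : (k:ℝ)^2 ≤ N := by exact_mod_cast hk2
  have hk3' : (N:ℝ) ≤ k^2 + 2*k := by
    have : N ≤ k^2 + 2*k := by rw [Nat.succ_eq_add_one] at hk3; nlinarith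
    exact_mod_cast this
  have hg := hgap ω (k^2) N hk2
  push_cast at hg
  have hkp : (0:ℝ) < (k:ℝ)^2 := by positivity
  have hS1 : |S N ω| ≤ |S (k^2) ω| + 2 * C * k := by
    have h5 : S N ω = S (k^2) ω + (S N ω - S (k^2) ω) := by ring
    have h6 := abs_add_le (S (k^2) ω) (S N ω - S (k^2) ω)
    rw [← h5] at h6
    nlinarith
  rw [Real.norm_eq_abs, abs_div, abs_div, abs_of_pos hkp, abs_of_pos (show (0:ℝ) < N by linarith)]
  calc |S N ω| / N ≤ (|S (k^2) ω| + 2 * C * k) / (k:ℝ)^2 := by gcongr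
    _ = _ := by field_simp

/-- The transition operator. -/
def ifsT {m : ℕ} (f : Fin m → ℝ → ℝ) (p : Fin m → ℝ) (g : ℝ → ℝ) : ℝ → ℝ :=
  fun y => ∑ i, p i * g (f i y)

theorem ifsT_meas {m : ℕ} (f : Fin m → ℝ → ℝ) (p : Fin m → ℝ) (hfm : ∀ i, Measurable (f i))
    (g : ℝ → ℝ) (hg : Measurable g) : Measurable (ifsT f p g) :=
  Finset.measurable_fun_sum _ (fun i _ => (hg.comp (hfm i)).const_mul _)

theorem ifsT_bound {m : ℕ} (f : Fin m → ℝ → ℝ) (p : Fin m → ℝ) (hp : ∀ i, 0 ≤ p i)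
    (hp1 : ∑ i : Fin m, p i = 1) (g : ℝ → ℝ) (C : ℝ) (hg : ∀ y, |g y| ≤ C) (y : ℝ) :
    |ifsT f p g y| ≤ C := by
  calc |ifsT f p g y| ≤ ∑ i, |p i * g (f i y)| := Finset.abs_sum_le_sum_abs _ _
    _ ≤ ∑ i, p i * C := Finset.sum_le_sum (fun i _ => by
        rw [abs_mul, abs_of_nonneg (hp i)]
        exact mul_le_mul_of_nonneg_left (hg _) (hp i))
    _ = C := by rw [← Finset.sum_mul, hp1, one_mul]

theorem ifsT_integral {m : ℕ} (f : Fin m → ℝ → ℝ) (p : Fin m → ℝ) (hp : ∀ i, 0 ≤ p i)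
    (hfm : ∀ i, Measurable (f i)) (μ : Measure ℝ) [IsProbabilityMeasure μ]
    (hinv : ∀ B : Set ℝ, MeasurableSet B →
        μ B = ∑ i : Fin m, ENNReal.ofReal (p i) * μ (f i ⁻¹' B))
    (g : ℝ → ℝ) (C : ℝ) (hgm : Measurable g) (hg : ∀ y, |g y| ≤ C) :
    ∫ y, ifsT f p g y ∂μ = ∫ y, g y ∂μ := by
  have hμ : μ = ∑ i, ENNReal.ofReal (p i) • μ.map (f i) := by
    ext B hB
    rw [hinv B hB, Measure.finsetSum_apply]
    refine Finset.sum_congr rfl (fun i _ => ?_)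
    rw [Measure.smul_apply, Measure.map_apply (hfm i) hB, smul_eq_mul]
  have hint : ∀ i, Integrable (fun y => g (f i y)) μ := fun i =>
    Integrable.of_bound (hgm.comp (hfm i)).aestronglyMeasurable C (Eventually.of_forall (fun y => hg _))
  have hint2 : ∀ i, Integrable g (μ.map (f i)) := fun i =>
    (integrable_map_measure hgm.aestronglyMeasurable (hfm i).aemeasurable).2 (hint i)
  conv_rhs => rw [hμ]
  rw [integral_finsetSum_measure (fun i _ => (hint2 i).smul_measure ENNReal.ofReal_ne_top)]
  unfold ifsT
  rw [integral_finsetSum _ (fun i _ => (hint i).const_mul _)]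
  refine Finset.sum_congr rfl (fun i _ => ?_)
  rw [integral_const_mul, integral_smul_measure, integral_map (hfm i).aemeasurable hgm.aestronglyMeasurable,
    ENNReal.toReal_ofReal (hp i), smul_eq_mul]

theorem ifsT_osc {m : ℕ} (S : Set ℝ) (f : Fin m → ℝ → ℝ) (hfS : ∀ i, MapsTo (f i) S S)
    (p : Fin m → ℝ) (hp : ∀ i, 0 ≤ p i) (hp1 : ∑ i : Fin m, p i = 1) (q ρ : ℝ)
    (hcontr : ∀ x ∈ S, ∀ y ∈ S,
        ∑ i : Fin m, p i * |f i y - f i x| ^ q ≤ ρ * |y - x| ^ q)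
    (h : ℝ → ℝ) (ε A : ℝ) (hA : 0 ≤ A)
    (hh : ∀ x ∈ S, ∀ y ∈ S, |h y - h x| ≤ ε + A * |y - x| ^ q) :
    ∀ x ∈ S, ∀ y ∈ S, |ifsT f p h y - ifsT f p h x| ≤ ε + (ρ * A) * |y - x| ^ q := by
  intro x hx y hy
  calc |ifsT f p h y - ifsT f p h x| = |∑ i, p i * (h (f i y) - h (f i x))| := by
        simp only [ifsT, ← Finset.sum_sub_distrib, mul_sub]
    _ ≤ ∑ i, |p i * (h (f i y) - h (f i x))| := Finset.abs_sum_le_sum_abs _ _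
    _ ≤ ∑ i, (p i * ε + A * (p i * |f i y - f i x| ^ q)) := Finset.sum_le_sum (fun i _ => by
        rw [abs_mul, abs_of_nonneg (hp i)]
        have := mul_le_mul_of_nonneg_left (hh _ (hfS i hx) _ (hfS i hy)) (hp i)
        linarith)
    _ = ε + A * ∑ i, p i * |f i y - f i x| ^ q := by
        rw [Finset.sum_add_distrib, ← Finset.sum_mul, hp1, one_mul, Finset.mul_sum]
    _ ≤ _ := by
        have := mul_le_mul_of_nonneg_left (hcontr x hx y hy) hA
        linarith

theorem ifsT_unif {m : ℕ} (S : Set ℝ) (hS : IsCompact S) (f : Fin m → ℝ → ℝ)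
    (hfm : ∀ i, Measurable (f i)) (hfS : ∀ i, MapsTo (f i) S S)
    (p : Fin m → ℝ) (hp : ∀ i, 0 ≤ p i) (hp1 : ∑ i : Fin m, p i = 1)
    (q ρ : ℝ) (hq : q ∈ Set.Ioc (0:ℝ) 1) (hρ : ρ ∈ Set.Ioo (0:ℝ) 1)
    (hcontr : ∀ x ∈ S, ∀ y ∈ S,
        ∑ i : Fin m, p i * |f i y - f i x| ^ q ≤ ρ * |y - x| ^ q)
    (μ : Measure ℝ) [IsProbabilityMeasure μ] (hμS : μ S = 1)
    (hinv : ∀ B : Set ℝ, MeasurableSet B →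
        μ B = ∑ i : Fin m, ENNReal.ofReal (p i) * μ (f i ⁻¹' B))
    (g : ℝ → ℝ) (C : ℝ) (hgm : Measurable g) (hg : ∀ y, |g y| ≤ C) (hgc : ContinuousOn g S)
    (ε : ℝ) (hε : 0 < ε) :
    ∃ k : ℕ, ∀ y ∈ S, |(ifsT f p)^[k] g y - ∫ z, g z ∂μ| ≤ ε := by
  have hC : 0 ≤ C := (abs_nonneg _).trans (hg 0)
  have huc := Metric.uniformContinuousOn_iff.1 (hS.uniformContinuousOn_of_continuous hgc)
  obtain ⟨δ, hδ, hδ'⟩ := huc (ε/2) (by positivity)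
  set A : ℝ := 2 * C / δ ^ q with hAdef
  have hδq : 0 < δ ^ q := Real.rpow_pos_of_pos hδ q
  have hA : 0 ≤ A := by positivity
  have h0 : ∀ x ∈ S, ∀ y ∈ S, |g y - g x| ≤ ε/2 + A * |y - x| ^ q := by
    intro x hx y hy
    have hnn : 0 ≤ |y - x| ^ q := Real.rpow_nonneg (abs_nonneg _) _
    by_cases hd : |y - x| < δ
    · have := hδ' y hy x hx hd
      rw [Real.dist_eq] at this
      have := mul_nonneg hA hnn
      linarith
    · have h1 : δ ^ q ≤ |y - x| ^ q :=
        Real.rpow_le_rpow hδ.le (not_lt.1 hd) hq.1.le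
      have h2 : 2 * C ≤ A * |y - x| ^ q := by
        calc 2 * C = A * δ ^ q := by rw [hAdef]; field_simp
          _ ≤ _ := by gcongr
      have h3 := abs_sub (g y) (g x)
      linarith [hg x, hg y]
  have hk : ∀ k : ℕ, (Measurable ((ifsT f p)^[k] g)) ∧ (∀ y, |(ifsT f p)^[k] g y| ≤ C) ∧
      (∫ y, (ifsT f p)^[k] g y ∂μ = ∫ y, g y ∂μ) ∧
      (∀ x ∈ S, ∀ y ∈ S, |(ifsT f p)^[k] g y - (ifsT f p)^[k] g x|
        ≤ ε/2 + (ρ^k * A) * |y - x| ^ q) := by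
    intro k
    induction k with
    | zero => simpa using ⟨hgm, hg, h0⟩
    | succ k ih =>
      obtain ⟨i1, i2, i3, i4⟩ := ih
      rw [Function.iterate_succ_apply']
      refine ⟨ifsT_meas f p hfm _ i1, ifsT_bound f p hp hp1 _ C i2, ?_, ?_⟩
      · rw [ifsT_integral f p hp hfm μ hinv _ C i1 i2, i3]
      · have := ifsT_osc S f hfS p hp hp1 q ρ hcontr _ (ε/2) (ρ^k * A)
          (mul_nonneg (pow_nonneg hρ.1.le _) hA) i4
        rw [pow_succ', mul_assoc]
        exact this
  obtain ⟨R, hR⟩ := Metric.isBounded_iff.1 hS.isBounded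
  have hlim : Tendsto (fun k : ℕ => ρ^k * (A * (max R 0) ^ q)) atTop (nhds 0) := by
    simpa using (tendsto_pow_atTop_nhds_zero_of_lt_one hρ.1.le hρ.2).mul_const (A * (max R 0) ^ q)
  obtain ⟨k, hk'⟩ := (hlim.eventually (gt_mem_nhds (show 0 < ε/2 by positivity))).exists
  refine ⟨k, fun y hy => ?_⟩
  obtain ⟨i1, i2, i3, i4⟩ := hk k
  have hI : Integrable ((ifsT f p)^[k] g) μ :=
    Integrable.of_bound i1.aestronglyMeasurable C (Eventually.of_forall i2)
  have haeS : ∀ᵐ z ∂μ, z ∈ S :=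
    (mem_ae_iff_prob_eq_one hS.measurableSet).2 hμS
  have h5 : (ifsT f p)^[k] g y - ∫ z, g z ∂μ
      = ∫ z, ((ifsT f p)^[k] g y - (ifsT f p)^[k] g z) ∂μ := by
    rw [integral_sub (integrable_const _) hI, i3]; simp
  rw [h5]
  have h6 := norm_integral_le_of_norm_le_const (μ := μ) (C := ε)
    (f := fun z => (ifsT f p)^[k] g y - (ifsT f p)^[k] g z) (by
      filter_upwards [haeS] with z hz
      have h7 := i4 z hz y hy
      have h8 : |y - z| ^ q ≤ (max R 0) ^ q :=
        Real.rpow_le_rpow (abs_nonneg _) ((hR hy hz).trans (le_max_left _ _)) hq.1.le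
      have h9 : (ρ^k * A) * |y - z| ^ q ≤ ρ^k * (A * (max R 0) ^ q) := by
        rw [← mul_assoc]
        exact mul_le_mul_of_nonneg_left h8 (mul_nonneg (pow_nonneg hρ.1.le _) hA)
      rw [Real.norm_eq_abs]
      linarith)
  simpa using h6

theorem ifs_step {m : ℕ} (f : Fin m → ℝ → ℝ)
    (p : Fin m → ℝ) (hp : ∀ i, 0 ≤ p i) (hp1 : ∑ i : Fin m, p i = 1)
    {Ω : Type*} [MeasurableSpace Ω] (P : Measure Ω) [IsProbabilityMeasure P]
    (ι : ℕ → Ω → Fin m)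
    (hmeas : ∀ n, Measurable (ι n))
    (hindep : iIndepFun ι P)
    (hlaw : ∀ n i, P {ω | ι n ω = i} = ENNReal.ofReal (p i))
    (x : ℝ) (U : ℕ → Ω → ℝ)
    (hU0 : ∀ ω, U 0 ω = x)
    (hU : ∀ n ω, U (n+1) ω = f (ι (n+1) ω) (U n ω))
    (g : ℝ → ℝ) (C : ℝ) (hg : ∀ y, |g y| ≤ C) :
    ∀ᵐ ω ∂P, Tendsto (fun N : ℕ => (∑ n ∈ Finset.range N, (g (U n ω) - ifsT f p g (U n ω))) / (N : ℝ))
      atTop (nhds 0) := by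
  let past : ℕ → (Ω → ℝ) → Prop := fun n X =>
    ∃ u : ((Finset.range (n+1)) → Fin m) → ℝ, ∀ ω, X ω = u (fun j => ι j ω)
  have hpm : ∀ n X, past n X → Measurable X := by
    rintro n X ⟨u, hu⟩
    have : X = u ∘ (fun ω (j : Finset.range (n+1)) => ι j ω) := funext hu
    rw [this]
    exact (measurable_of_finite u).comp (measurable_pi_lambda _ (fun j => hmeas j))
  have hmono : ∀ n k X, n ≤ k → past n X → past k X := by
    rintro n k X hnk ⟨u, hu⟩
    refine ⟨fun v => u (fun j => v ⟨j.1, Finset.mem_range.2 (by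
      have := Finset.mem_range.1 j.2; omega)⟩), fun ω => hu ω⟩
  have hnext : ∀ n X (G : Fin m → ℝ → ℝ), past n X → past (n+1) (fun ω => G (ι (n+1) ω) (X ω)) := by
    intro n X G hX
    obtain ⟨u, hu⟩ := hmono n (n+1) X (Nat.le_succ n) hX
    exact ⟨fun v => G (v ⟨n+1, Finset.mem_range.2 (by omega)⟩) (u v), fun ω => by simp only [hu]⟩
  have hUp : ∀ n, past n (U n) := by
    intro n
    induction n with
    | zero => exact ⟨fun _ => x, hU0⟩
    | succ n ih =>
      have := hnext n (U n) f ih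
      have he : U (n+1) = fun ω => f (ι (n+1) ω) (U n ω) := funext (hU n)
      rw [he]; exact this
  let G : Fin m → ℝ → ℝ := fun i y => g (f i y) - ifsT f p g y
  have hGb : ∀ i y, |G i y| ≤ 2 * C := by
    intro i y
    have h1 := abs_sub (g (f i y)) (ifsT f p g y)
    have h2 := ifsT_bound f p hp hp1 g C hg y
    have h3 := hg (f i y)
    show |g (f i y) - ifsT f p g y| ≤ _
    linarith
  have hG0 : ∀ y, ∑ i, p i * G i y = 0 := by
    intro y
    simp only [G, mul_sub, Finset.sum_sub_distrib, ← Finset.sum_mul, hp1, one_mul]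
    simp [ifsT]
  let D : ℕ → Ω → ℝ := fun n ω => G (ι (n+1) ω) (U n ω)
  have hDp : ∀ n, past (n+1) (D n) := fun n => hnext n (U n) G (hUp n)
  have hDm : ∀ n, Measurable (D n) := fun n => hpm _ _ (hDp n)
  have hDb : ∀ n ω, |D n ω| ≤ 2 * C := fun n ω => hGb _ _
  have hind : ∀ n (X : Ω → ℝ) (i : Fin m), past n X →
      ∫ ω, (if ι (n+1) ω = i then (1:ℝ) else 0) * X ω ∂P = p i * ∫ ω, X ω ∂P := by
    rintro n X i ⟨u, hu⟩
    have h1 := hindep.indepFun_finset {n+1} (Finset.range (n+1)) (by simp) hmeas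
    have h2 := h1.comp (φ := fun v => if v ⟨n+1, Finset.mem_singleton_self _⟩ = i then (1:ℝ) else 0)
      (ψ := u) (measurable_of_finite _) (measurable_of_finite _)
    have hX : X = u ∘ (fun ω (j : Finset.range (n+1)) => ι j ω) := funext hu
    rw [← hX] at h2
    have h3 := h2.integral_fun_mul_eq_mul_integral
      ((measurable_of_finite (fun j : Fin m => if j = i then (1:ℝ) else 0)).comp
        (hmeas (n+1))).aestronglyMeasurable
      (hpm n X ⟨u, hu⟩).aestronglyMeasurable
    simp only [Function.comp] at h3
    rw [h3]
    congr 1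
    have hms : MeasurableSet {ω | ι (n+1) ω = i} := hmeas (n+1) (measurableSet_singleton i)
    have h4 : (fun ω => if ι (n+1) ω = i then (1:ℝ) else 0)
        = {ω | ι (n+1) ω = i}.indicator (fun _ => (1:ℝ)) := by
      ext ω; simp [Set.indicator]
    rw [h4, integral_indicator_const _ hms, Measure.real, hlaw, ENNReal.toReal_ofReal (hp i)]
    simp
  have horth : ∀ n k, k < n → ∫ ω, D n ω * D k ω ∂P = 0 := by
    intro n k hkn
    have hDk : past n (D k) := hmono _ _ _ hkn (hDp k)
    have hY : ∀ i, past n (fun ω => G i (U n ω) * D k ω) := by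
      intro i
      obtain ⟨u, hu⟩ := hUp n
      obtain ⟨v, hv⟩ := hDk
      exact ⟨fun w => G i (u w) * v w, fun ω => by simp only [hu, hv]⟩
    have hYb : ∀ i ω, |G i (U n ω) * D k ω| ≤ (2 * C) * (2 * C) := by
      intro i ω
      rw [abs_mul]
      exact mul_le_mul (hGb _ _) (hDb _ _) (abs_nonneg _) ((abs_nonneg _).trans (hGb i 0))
    have hYi : ∀ i, Integrable (fun ω => G i (U n ω) * D k ω) P := fun i =>
      Integrable.of_bound (hpm _ _ (hY i)).aestronglyMeasurable _ (Eventually.of_forall (hYb i))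
    have hZi : ∀ i, Integrable (fun ω => (if ι (n+1) ω = i then (1:ℝ) else 0)
        * (G i (U n ω) * D k ω)) P := fun i =>
      (hYi i).bdd_mul (c := 1) ((measurable_of_finite (fun j : Fin m => if j = i then (1:ℝ) else 0)).comp
        (hmeas (n+1))).aestronglyMeasurable
        (Eventually.of_forall (fun ω => by split_ifs <;> simp))
    have he : ∀ ω, D n ω * D k ω = ∑ i, (if ι (n+1) ω = i then (1:ℝ) else 0)
        * (G i (U n ω) * D k ω) := by
      intro ω
      simp [D]
    simp_rw [he]
    rw [integral_finsetSum _ (fun i _ => hZi i)]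
    simp_rw [hind n _ _ (hY _)]
    simp_rw [← integral_const_mul]
    rw [← integral_finsetSum _ (fun i _ => (hYi i).const_mul _)]
    simp_rw [← mul_assoc, ← Finset.sum_mul, hG0]
    simp
  filter_upwards [slln_orth P D (2*C) hDm hDb horth] with ω hω
  have hb : Tendsto (fun N : ℕ => (g (U N ω) - g (U 0 ω)) / (N:ℝ)) atTop (nhds 0) := by
    refine squeeze_zero_norm (fun N => ?_) (tendsto_const_div_atTop_nhds_zero_nat (2*C))
    rw [Real.norm_eq_abs, abs_div, Nat.abs_cast]
    have := abs_sub (g (U N ω)) (g (U 0 ω))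
    have h1 := hg (U N ω)
    have h2 := hg (U 0 ω)
    gcongr
    linarith
  have h := hω.sub hb
  rw [sub_zero] at h
  refine h.congr (fun N => ?_)
  rw [← sub_div, ← Finset.sum_range_sub (fun n => g (U n ω)), ← Finset.sum_sub_distrib]
  congr 1
  refine Finset.sum_congr rfl (fun n _ => ?_)
  simp only [D, G, ← hU]
  ring

/-- **Lemma (strong law of large numbers for contracting-on-average IFS).** For the
Markov chain `U₀ = x`, `U_{n+1} = f_{ι_{n+1}}(U_n)` driven by i.i.d. choices with law
`p`, started at `x ∈ S`, and `μ` an invariant probability measure, for every continuous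
`g : S → ℝ`, almost surely the time averages of `g` along the chain converge to `∫ g dμ`. -/
theorem ifs_strong_law_of_large_numbers
    {m : ℕ} (S : Set ℝ) (hS : IsCompact S) (hSne : S.Nonempty)
    (f : Fin m → ℝ → ℝ)
    (hfm : ∀ i, Measurable (f i))
    (hfLip : ∀ i, ∃ K : NNReal, LipschitzOnWith K (f i) S)
    (hfS : ∀ i, MapsTo (f i) S S)
    (p : Fin m → ℝ) (hp : ∀ i, 0 ≤ p i) (hp1 : ∑ i : Fin m, p i = 1)
    (q ρ : ℝ) (hq : q ∈ Set.Ioc (0:ℝ) 1) (hρ : ρ ∈ Set.Ioo (0:ℝ) 1)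
    (hcontr : ∀ x ∈ S, ∀ y ∈ S,
        ∑ i : Fin m, p i * |f i y - f i x| ^ q ≤ ρ * |y - x| ^ q)
    (μ : Measure ℝ) (hμ : IsProbabilityMeasure μ) (hμS : μ S = 1)
    (hinv : ∀ B : Set ℝ, MeasurableSet B →
        μ B = ∑ i : Fin m, ENNReal.ofReal (p i) * μ (f i ⁻¹' B))
    (Ω : Type*) [MeasurableSpace Ω] (P : Measure Ω) [IsProbabilityMeasure P]
    (ι : ℕ → Ω → Fin m)
    (hmeas : ∀ n, Measurable (ι n))
    (hindep : iIndepFun ι P)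
    (hlaw : ∀ n i, P {ω | ι n ω = i} = ENNReal.ofReal (p i))
    (x : ℝ) (hx : x ∈ S)
    (U : ℕ → Ω → ℝ)
    (hU0 : ∀ ω, U 0 ω = x)
    (hU : ∀ n ω, U (n+1) ω = f (ι (n+1) ω) (U n ω)) :
    ∀ g : ℝ → ℝ, ContinuousOn g S →
      ∀ᵐ ω ∂P,
        Tendsto (fun N : ℕ => (∑ n ∈ Finset.range (N+1), g (U n ω)) / ((N : ℝ)+1))
          atTop (nhds (∫ y, g y ∂μ)) := by
  intro g hgc
  have := hμ
  set g' : ℝ → ℝ := S.indicator g with hg'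
  have heq : EqOn g' g S := fun y hy => Set.indicator_of_mem hy g
  have hgc' : ContinuousOn g' S := hgc.congr heq
  have hgm : Measurable g' := by
    classical
    have := hgc.measurable_piecewise (g := (0 : ℝ → ℝ)) continuousOn_const hS.measurableSet
    rwa [Set.piecewise_eq_indicator] at this
  obtain ⟨C0, hC0⟩ := hS.exists_bound_of_continuousOn hgc
  have hb : ∀ y, |g' y| ≤ max C0 0 := by
    intro y
    by_cases hy : y ∈ S
    · rw [heq hy]; exact (hC0 y hy).trans (le_max_left _ _)
    · rw [hg', Set.indicator_of_notMem hy]; simp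
  have haeS : ∀ᵐ z ∂μ, z ∈ S :=
    (mem_ae_iff_prob_eq_one hS.measurableSet).2 hμS
  have hI : ∫ y, g y ∂μ = ∫ y, g' y ∂μ := by
    refine integral_congr_ae ?_
    filter_upwards [haeS] with z hz
    exact (heq hz).symm
  have hUS : ∀ n ω, U n ω ∈ S := by
    intro n ω
    induction n with
    | zero => rw [hU0]; exact hx
    | succ n ih => rw [hU]; exact hfS _ ih
  have hTb : ∀ k y, |(ifsT f p)^[k] g' y| ≤ max C0 0 := by
    intro k
    induction k with
    | zero => simpa using hb
    | succ k ih =>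
      rw [Function.iterate_succ_apply']
      exact ifsT_bound f p hp hp1 _ _ ih
  have hstep : ∀ k, ∀ᵐ ω ∂P, Tendsto (fun N : ℕ => (∑ n ∈ Finset.range N,
      ((ifsT f p)^[k] g' (U n ω) - (ifsT f p)^[k+1] g' (U n ω))) / (N : ℝ)) atTop (nhds 0) := by
    intro k
    rw [Function.iterate_succ_apply']
    exact ifs_step f p hp hp1 P ι hmeas hindep hlaw x U hU0 hU _ _ (hTb k)
  filter_upwards [ae_all_iff.2 hstep] with ω hω
  have hk : ∀ k, Tendsto (fun N : ℕ => (∑ n ∈ Finset.range N,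
      (g' (U n ω) - (ifsT f p)^[k] g' (U n ω))) / (N : ℝ)) atTop (nhds 0) := by
    intro k
    induction k with
    | zero => simp
    | succ k ih =>
      have h := ih.add (hω k)
      rw [add_zero] at h
      refine h.congr (fun N => ?_)
      rw [← add_div, ← Finset.sum_add_distrib]
      congr 1
      exact Finset.sum_congr rfl (fun n _ => by ring)
  have hmain : Tendsto (fun N : ℕ => (∑ n ∈ Finset.range N, g (U n ω)) / (N : ℝ)) atTop
      (nhds (∫ y, g y ∂μ)) := by
    rw [Metric.tendsto_nhds]
    intro ε hε
    obtain ⟨k, hk'⟩ := ifsT_unif S hS f hfm hfS p hp hp1 q ρ hq hρ hcontr μ hμS hinv g' _ hgm hb hgc'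
      (ε/2) (by positivity)
    rw [← hI] at hk'
    filter_upwards [(Metric.tendsto_nhds.1 (hk k)) (ε/2) (by positivity), eventually_ge_atTop 1] with N hN hN1
    have hN0 : (0:ℝ) < N := by exact_mod_cast hN1
    rw [Real.dist_eq, sub_zero] at hN
    rw [Real.dist_eq]
    set c := ∫ y, g y ∂μ
    have h1 : (∑ n ∈ Finset.range N, g (U n ω)) / (N : ℝ) - c
        = (∑ n ∈ Finset.range N, (g' (U n ω) - (ifsT f p)^[k] g' (U n ω))) / (N : ℝ)
          + (∑ n ∈ Finset.range N, ((ifsT f p)^[k] g' (U n ω) - c)) / (N:ℝ) := by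
      rw [← add_div, ← Finset.sum_add_distrib]
      have : ∀ n, (g' (U n ω) - (ifsT f p)^[k] g' (U n ω)) + ((ifsT f p)^[k] g' (U n ω) - c)
          = g (U n ω) - c := by
        intro n; rw [heq (hUS n ω)]; ring
      simp_rw [this, Finset.sum_sub_distrib, Finset.sum_const, Finset.card_range, nsmul_eq_mul]
      field_simp
    have h2 : |(∑ n ∈ Finset.range N, ((ifsT f p)^[k] g' (U n ω) - c)) / (N:ℝ)| ≤ ε/2 := by
      rw [abs_div, abs_of_pos hN0, div_le_iff₀ hN0]
      calc _ ≤ ∑ n ∈ Finset.range N, |(ifsT f p)^[k] g' (U n ω) - c| := Finset.abs_sum_le_sum_abs _ _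
        _ ≤ ∑ n ∈ Finset.range N, ε/2 := Finset.sum_le_sum (fun n _ => hk' _ (hUS n ω))
        _ = ε/2 * N := by simp [mul_comm]
    rw [h1]
    refine (abs_add_le _ _).trans_lt ?_
    linarith
  have := hmain.comp (tendsto_add_atTop_nat 1)
  refine this.congr (fun N => ?_)
  simp only [Function.comp]
  push_cast
  rfl

end
end
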